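/- Let a = a(ε) ≥ 0 be bounded as ε → 0, let v_{ε,a} be a global minimizer of E, and let Ω be an open subset of the open disc D(0;ρ) such that v_{ε,a} ≠ 0 on Ω for every sufficiently small ε. Then |v_{ε,a}| converges to √μ in C⁰_loc(Ω) as ε → 0. -/

import Mathlib

open MeasureTheory Filter Real Set
open scoped Topology ENNReal

noncomputable section

/-- We identify the plane with the Euclidean space `ℝ²`. -/
abbrev E2 : Type := EuclideanSpace ℝ (Fin 2)

/-- The standard basis vectors of `ℝ²`. -/
def e2basis (i : Fin 2) : E2 := EuclideanSpace.single i 1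

/-- Rotation of a vector by `π/2` (multiplication by `i` in complex notation). -/
def perp (e : E2) : E2 := EuclideanSpace.single 0 (-(e 1)) + EuclideanSpace.single 1 (e 0)

/-- The unit vector `e^{iθ}`. -/
def uvec (θ : ℝ) : E2 := EuclideanSpace.single 0 (Real.cos θ) + EuclideanSpace.single 1 (Real.sin θ)

/-- The Laplacian of a map `u : ℝ² → ℝ²`. -/
def lap (u : E2 → E2) (x : E2) : E2 :=
  ∑ i : Fin 2, fderiv ℝ (fun y => fderiv ℝ u y (e2basis i)) x (e2basis i)

/-- `|∇u|²`, the squared Hilbert-Schmidt norm of the full gradient of `u : ℝ² → ℝ²`. -/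
def gradSq (u : E2 → E2) (x : E2) : ℝ := ∑ i : Fin 2, ‖fderiv ℝ u x (e2basis i)‖ ^ 2

/-- `∑_j ∇u_j · ∇ψ_j`, the Hilbert-Schmidt inner product of the gradients. -/
def gradInner (u ψ : E2 → E2) (x : E2) : ℝ :=
  ∑ i : Fin 2, (inner ℝ (fderiv ℝ u x (e2basis i)) (fderiv ℝ ψ x (e2basis i)) : ℝ)

/-- Membership in `H¹(ℝ²,ℝ²)`: `u ∈ L²` together with its gradient. -/
def MemH1 (u : E2 → E2) : Prop :=
  Differentiable ℝ u ∧ MemLp u 2 (volume : Measure E2) ∧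
    MemLp (fun x => fderiv ℝ u x) 2 (volume : Measure E2)

/-- The Ginzburg–Landau energy
`E(u) = ∫ (1/2)|∇u|² − (1/(2ε²))μ|u|² + (1/(4ε²))|u|⁴ − (a/ε) f·u`. -/
def energy (ε a : ℝ) (μ : E2 → ℝ) (f : E2 → E2) (u : E2 → E2) : ℝ :=
  ∫ x : E2, ((1/2) * gradSq u x - (1/(2*ε^2)) * μ x * ‖u x‖^2
    + (1/(4*ε^2)) * ‖u x‖^4 - (a/ε) * (inner ℝ (f x) (u x) : ℝ))

/-- `v` is a global minimizer of `E` over `H¹(ℝ²,ℝ²)`. -/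
def IsMinimizer (ε a : ℝ) (μ : E2 → ℝ) (f : E2 → E2) (v : E2 → E2) : Prop :=
  MemH1 v ∧ ∀ u : E2 → E2, MemH1 u → energy ε a μ f v ≤ energy ε a μ f u

/-- `u` is a smooth classical solution of the Euler–Lagrange equation
`ε²Δu + μu − |u|²u + εa f = 0` on `ℝ²`. -/
def IsSolution (ε a : ℝ) (μ : E2 → ℝ) (f : E2 → E2) (u : E2 → E2) : Prop :=
  ContDiff ℝ (⊤ : ℕ∞) u ∧ ∀ x : E2, ε^2 • lap u x + μ x • u x - ‖u x‖^2 • u x + (ε*a) • f x = 0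

/-- Hypotheses on the radial coefficient `μ`. -/
structure MuHyp (μ : E2 → ℝ) (μrad : ℝ → ℝ) (ρ : ℝ) : Prop where
  smooth : ContDiff ℝ (⊤ : ℕ∞) μ
  smooth_rad : ContDiff ℝ (⊤ : ℕ∞) μrad
  even_rad : ∀ r : ℝ, μrad (-r) = μrad r
  radial : ∀ x : E2, μ x = μrad ‖x‖
  bdd : ∃ C : ℝ, ∀ x : E2, |μ x| ≤ C
  deriv_neg : ∀ r : ℝ, 0 < r → deriv μrad r < 0
  rho_pos : 0 < ρ
  rho_root : μrad ρ = 0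
  rho_unique : ∀ r : ℝ, 0 < r → μrad r = 0 → r = ρ

/-- Hypotheses on the radial vector field `f`. -/
structure FHyp (f : E2 → E2) (frad : ℝ → ℝ) : Prop where
  smooth : ContDiff ℝ (⊤ : ℕ∞) f
  smooth_rad : ContDiff ℝ (⊤ : ℕ∞) frad
  odd_rad : ∀ r : ℝ, frad (-r) = -frad r
  radial : ∀ x : E2, x ≠ 0 → f x = (frad ‖x‖ / ‖x‖) • x
  integrable : Integrable f (volume : Measure E2)
  bdd : ∃ C : ℝ, ∀ x : E2, ‖f x‖ ≤ C
  pos_rad : ∀ r : ℝ, 0 < r → 0 < frad r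

/-- Convergence in `C²_loc(ℝ²,ℝ²)` of a sequence of maps. -/
def TendstoC2LocSeq (F : ℕ → E2 → E2) (g : E2 → E2) : Prop :=
  TendstoLocallyUniformly F g atTop ∧
  TendstoLocallyUniformly (fun n x => fderiv ℝ (F n) x) (fun x => fderiv ℝ g x) atTop ∧
  TendstoLocallyUniformly (fun n x => fderiv ℝ (fderiv ℝ (F n)) x)
    (fun x => fderiv ℝ (fderiv ℝ g) x) atTop

/-- `l` is a limit point (as `ε → 0`) of the set of zeros of the family `v ε`. -/
def IsZeroLimitPoint (v : ℝ → E2 → E2) (l : E2) : Prop :=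
  ∃ (εs : ℕ → ℝ) (xs : ℕ → E2), (∀ n, 0 < εs n) ∧ Tendsto εs atTop (𝓝 (0:ℝ)) ∧
    (∀ n, v (εs n) (xs n) = 0) ∧ Tendsto xs atTop (𝓝 l)

set_option linter.all false
set_option linter.unusedVariables false
set_option linter.unusedSimpArgs false
set_option linter.deprecated false

/-- The energy density. -/
def dens (ε a : ℝ) (μ : E2 → ℝ) (f : E2 → E2) (u : E2 → E2) (x : E2) : ℝ :=
  (1/2) * gradSq u x - (1/(2*ε^2)) * μ x * ‖u x‖^2
    + (1/(4*ε^2)) * ‖u x‖^4 - (a/ε) * (inner ℝ (f x) (u x) : ℝ)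

lemma energy_eq (ε a : ℝ) (μ : E2 → ℝ) (f u : E2 → E2) :
    energy ε a μ f u = ∫ x, dens ε a μ f u x := rfl

lemma hasDerivAt_posPow (n : ℕ) (t : ℝ) :
    HasDerivAt (fun t : ℝ => (max t 0)^(n+2)) ((n+2) * (max t 0)^(n+1)) t := by
  rcases lt_trichotomy t 0 with h | h | h
  · have : (fun t : ℝ => (max t 0)^(n+2)) =ᶠ[𝓝 t] fun _ => 0 := by
      filter_upwards [Iio_mem_nhds h] with s hs
      rw [max_eq_right (le_of_lt hs)]; simp
    rw [max_eq_right h.le]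
    simpa using (hasDerivAt_const t (0:ℝ)).congr_of_eventuallyEq this
  · subst h
    simp only [max_self]
    rw [hasDerivAt_iff_isLittleO]
    simp only [sub_zero, max_self]
    have h1 : (fun s : ℝ => (max s 0)^(n+2)) =O[𝓝 0] fun s : ℝ => s^(n+2) := by
      apply Asymptotics.IsBigO.of_bound 1
      filter_upwards with s
      rw [one_mul, norm_pow, norm_pow]
      apply pow_le_pow_left₀ (norm_nonneg _)
      rw [Real.norm_eq_abs, Real.norm_eq_abs, abs_of_nonneg (le_max_right _ _)]
      exact max_le (le_abs_self s) (abs_nonneg s)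
    have h2 : (fun s : ℝ => s^(n+2)) =o[𝓝 0] fun s : ℝ => s := by
      simpa using Asymptotics.isLittleO_pow_pow (𝕜 := ℝ) (m := 1) (n := n+2) (by omega)
    refine (h1.trans_isLittleO h2).congr_left ?_
    intro s; simp
  · have : (fun t : ℝ => (max t 0)^(n+2)) =ᶠ[𝓝 t] fun t => t^(n+2) := by
      filter_upwards [Ioi_mem_nhds h] with s hs
      rw [max_eq_left (le_of_lt hs)]
    rw [max_eq_left h.le]
    have h3 := hasDerivAt_pow (n+2) t
    have h4 := h3.congr_of_eventuallyEq this
    have e : ((n + 2 : ℕ) : ℝ) * t ^ (n + 2 - 1) = (n + 2) * t ^ (n + 1) := by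
      push_cast; rfl
    rw [e] at h4
    exact h4

lemma hasDerivAt_posSq (t : ℝ) :
    HasDerivAt (fun t : ℝ => (max t 0)^2) (2 * max t 0) t := by
  simpa using hasDerivAt_posPow 0 t

lemma hasDerivAt_posCube (t : ℝ) :
    HasDerivAt (fun t : ℝ => (max t 0)^3) (3 * (max t 0)^2) t := by
  have := hasDerivAt_posPow 1 t
  norm_num at this
  convert this using 1

lemma e2_decomp (h : E2) : h = h 0 • e2basis 0 + h 1 • e2basis 1 := by
  ext i; fin_cases i <;> simp [e2basis]

lemma e2_norm_sq (h : E2) : ‖h‖^2 = h 0 ^2 + h 1 ^ 2 := by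
  rw [EuclideanSpace.norm_sq_eq]; simp

lemma norm_e2basis (i : Fin 2) : ‖e2basis i‖ = 1 := by simp [e2basis]

lemma opnorm_sq_le {F : Type*} [NormedAddCommGroup F] [NormedSpace ℝ F] (L : E2 →L[ℝ] F) :
    ‖L‖^2 ≤ ∑ i : Fin 2, ‖L (e2basis i)‖^2 := by
  have h0 : 0 ≤ ∑ i : Fin 2, ‖L (e2basis i)‖^2 := by positivity
  rw [← Real.le_sqrt (norm_nonneg _) h0]
  refine L.opNorm_le_bound (Real.sqrt_nonneg _) fun h => ?_
  have h1 : ‖L h‖ ≤ |h 0| * ‖L (e2basis 0)‖ + |h 1| * ‖L (e2basis 1)‖ := by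
    conv_lhs => rw [e2_decomp h, map_add, map_smul, map_smul]
    refine (norm_add_le _ _).trans ?_
    rw [norm_smul, norm_smul, Real.norm_eq_abs, Real.norm_eq_abs]
  refine h1.trans ?_
  rw [← Real.sqrt_sq (norm_nonneg h), ← Real.sqrt_mul h0]
  apply Real.le_sqrt_of_sq_le
  rw [e2_norm_sq, Fin.sum_univ_two, ← sq_abs (h 0), ← sq_abs (h 1)]
  nlinarith [sq_nonneg (|h 0| * ‖L (e2basis 1)‖ - |h 1| * ‖L (e2basis 0)‖)]

lemma norm_basis_le {F : Type*} [NormedAddCommGroup F] [NormedSpace ℝ F] (L : E2 →L[ℝ] F)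
    (i : Fin 2) : ‖L (e2basis i)‖ ≤ ‖L‖ := by
  simpa [norm_e2basis] using L.le_opNorm (e2basis i)

lemma gradSq_nonneg (u : E2 → E2) (x : E2) : 0 ≤ gradSq u x := by
  unfold gradSq; positivity

lemma gradSq_le (u : E2 → E2) (x : E2) : gradSq u x ≤ 2 * ‖fderiv ℝ u x‖^2 := by
  unfold gradSq
  rw [Fin.sum_univ_two]
  have h0 := norm_basis_le (fderiv ℝ u x) 0
  have h1 := norm_basis_le (fderiv ℝ u x) 1
  have := pow_le_pow_left₀ (norm_nonneg _) h0 2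
  have := pow_le_pow_left₀ (norm_nonneg _) h1 2
  linarith

lemma le_gradSq (u : E2 → E2) (x : E2) : ‖fderiv ℝ u x‖^2 ≤ gradSq u x := opnorm_sq_le _

lemma measurable_gradSq (u : E2 → E2) : Measurable (gradSq u) := by
  unfold gradSq
  apply Finset.measurable_sum
  intro i _
  exact (measurable_fderiv_apply_const ℝ u _).norm.pow_const 2

lemma MemH1.integrable_gradSq {u : E2 → E2} (h : MemH1 u) : Integrable (gradSq u) := by
  have h1 : Integrable (fun x => ‖fderiv ℝ u x‖^2) :=
    (memLp_two_iff_integrable_sq_norm h.2.2.1).1 h.2.2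
  refine (h1.const_mul 2).mono' (measurable_gradSq u).aestronglyMeasurable ?_
  filter_upwards with x
  rw [Real.norm_of_nonneg (gradSq_nonneg u x)]
  exact gradSq_le u x

lemma MemH1.integrable_sq {u : E2 → E2} (h : MemH1 u) : Integrable (fun x => ‖u x‖^2) :=
  (memLp_two_iff_integrable_sq_norm h.2.1.1).1 h.2.1

lemma memH1_of_bound {u : E2 → E2} (hd : Differentiable ℝ u) {g g' : E2 → ℝ}
    (hg : Integrable g) (hg' : Integrable g') (h1 : ∀ x, ‖u x‖^2 ≤ g x)
    (h2 : ∀ x, gradSq u x ≤ g' x) : MemH1 u := by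
  have m1 : AEStronglyMeasurable u volume := hd.continuous.aestronglyMeasurable
  have m2 : AEStronglyMeasurable (fun x => fderiv ℝ u x) volume :=
    (measurable_fderiv ℝ u).aestronglyMeasurable
  refine ⟨hd, ?_, ?_⟩
  · rw [memLp_two_iff_integrable_sq_norm m1]
    refine hg.mono' (m1.norm.pow 2) ?_
    filter_upwards with x
    rw [Real.norm_of_nonneg (by positivity)]; exact h1 x
  · rw [memLp_two_iff_integrable_sq_norm m2]
    refine hg'.mono' (m2.norm.pow 2) ?_
    filter_upwards with x
    rw [Real.norm_of_nonneg (by positivity)]; exact (le_gradSq u x).trans (h2 x)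

section integ
variable {μ : E2 → ℝ} {μrad : ℝ → ℝ} {ρ : ℝ} {f : E2 → E2} {frad : ℝ → ℝ}

lemma FHyp.integrable_sq (hf : FHyp f frad) : Integrable (fun x => ‖f x‖^2) := by
  obtain ⟨C, hC⟩ := hf.bdd
  refine (hf.integrable.norm.const_mul C).mono'
    (hf.smooth.continuous.norm.pow 2).aestronglyMeasurable ?_
  filter_upwards with x
  rw [Real.norm_of_nonneg (by positivity)]
  nlinarith [hC x, norm_nonneg (f x)]

lemma integrable_inner_f (hf : FHyp f frad) {u : E2 → E2} (hu : MemH1 u) :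
    Integrable (fun x => (inner ℝ (f x) (u x) : ℝ)) := by
  refine (hf.integrable_sq.add hu.integrable_sq).mono'
    (hf.smooth.continuous.inner hu.1.continuous).aestronglyMeasurable ?_
  filter_upwards with x
  have := norm_inner_le_norm (𝕜 := ℝ) (f x) (u x)
  simp only [Pi.add_apply]
  nlinarith [sq_nonneg (‖f x‖ - ‖u x‖), sq_nonneg (‖f x‖), sq_nonneg (‖u x‖)]

lemma integrable_mu_sq (hμ : MuHyp μ μrad ρ) {u : E2 → E2} (hu : MemH1 u) :
    Integrable (fun x => μ x * ‖u x‖^2) := by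
  obtain ⟨C, hC⟩ := hμ.bdd
  refine (hu.integrable_sq.const_mul C).mono'
    (hμ.smooth.continuous.mul (hu.1.continuous.norm.pow 2)).aestronglyMeasurable ?_
  filter_upwards with x
  rw [norm_mul, Real.norm_eq_abs, Real.norm_of_nonneg (by positivity : 0 ≤ ‖u x‖^2)]
  exact mul_le_mul_of_nonneg_right (hC x) (by positivity)

lemma integrable_dens (hμ : MuHyp μ μrad ρ) (hf : FHyp f frad) (ε a : ℝ) {u : E2 → E2}
    (hu : MemH1 u) (h4 : Integrable (fun x => ‖u x‖^4)) : Integrable (dens ε a μ f u) := by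
  have := (((hu.integrable_gradSq.const_mul (1/2)).sub
    ((integrable_mu_sq hμ hu).const_mul (1/(2*ε^2)))).add (h4.const_mul (1/(4*ε^2)))).sub
    ((integrable_inner_f hf hu).const_mul (a/ε))
  refine this.congr ?_
  filter_upwards with x
  simp [dens, mul_assoc]

lemma integrable_four (hμ : MuHyp μ μrad ρ) (hf : FHyp f frad) {ε a : ℝ} (hε : 0 < ε)
    {u : E2 → E2} (hu : MemH1 u) (h : Integrable (dens ε a μ f u)) :
    Integrable (fun x => ‖u x‖^4) := by
  have := (((h.sub (hu.integrable_gradSq.const_mul (1/2))).add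
    ((integrable_mu_sq hμ hu).const_mul (1/(2*ε^2)))).add
    ((integrable_inner_f hf hu).const_mul (a/ε))).const_mul (4*ε^2)
  refine this.congr ?_
  filter_upwards with x
  simp only [Pi.add_apply, Pi.sub_apply, dens]
  field_simp
  ring

lemma integrable_four_of_bdd {u : E2 → E2} (hu : MemH1 u) {M : ℝ} (hM : ∀ x, ‖u x‖ ≤ M) :
    Integrable (fun x => ‖u x‖^4) := by
  refine (hu.integrable_sq.const_mul (M^2)).mono'
    (hu.1.continuous.norm.pow 4).aestronglyMeasurable ?_
  filter_upwards with x
  rw [Real.norm_of_nonneg (by positivity)]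
  have := pow_le_pow_left₀ (norm_nonneg _) (hM x) 2
  nlinarith [sq_nonneg (‖u x‖)]

end integ

section mufacts
variable {μ : E2 → ℝ} {μrad : ℝ → ℝ} {ρ : ℝ}

lemma MuHyp.antiOn (hμ : MuHyp μ μrad ρ) : StrictAntiOn μrad (Ici 0) := by
  apply strictAntiOn_of_deriv_neg (convex_Ici 0) hμ.smooth_rad.continuous.continuousOn
  intro x hx
  rw [interior_Ici] at hx
  exact hμ.deriv_neg x hx

lemma MuHyp.pos (hμ : MuHyp μ μrad ρ) {x : E2} (hx : ‖x‖ < ρ) : 0 < μ x := by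
  rw [hμ.radial, ← hμ.rho_root]
  exact hμ.antiOn (norm_nonneg x) hμ.rho_pos.le hx

lemma MuHyp.nonpos (hμ : MuHyp μ μrad ρ) {x : E2} (hx : ρ ≤ ‖x‖) : μ x ≤ 0 := by
  rw [hμ.radial, ← hμ.rho_root]
  exact hμ.antiOn.antitoneOn hμ.rho_pos.le (norm_nonneg x) hx

lemma MuHyp.lower (hμ : MuHyp μ μrad ρ) :
    ∃ c : ℝ, 0 < c ∧ ∀ x : E2, c * min |‖x‖ - ρ| ρ ≤ |μ x| := by
  have hρ := hμ.rho_pos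
  have hcd : Continuous (deriv μrad) := hμ.smooth_rad.continuous_deriv (by simp)
  obtain ⟨r0, hr0, hmax⟩ := (isCompact_Icc (a := ρ/2) (b := 2*ρ)).exists_isMaxOn
    ⟨ρ, by constructor <;> linarith⟩ hcd.continuousOn
  set c := - deriv μrad r0 with hc
  have hcpos : 0 < c := by
    have := hμ.deriv_neg r0 (by have := hr0.1; linarith)
    linarith
  have key : ∀ x ∈ Icc (ρ/2) (2*ρ), ∀ y ∈ Icc (ρ/2) (2*ρ), x ≤ y →
      μrad y - μrad x ≤ -c * (y - x) := by
    apply (convex_Icc (ρ/2) (2*ρ)).image_sub_le_mul_sub_of_deriv_le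
      hμ.smooth_rad.continuous.continuousOn
      (hμ.smooth_rad.differentiable (by simp)).differentiableOn
    intro x hx
    have := hmax (interior_subset hx)
    simp only [mem_ofPred_eq] at this
    simpa [hc] using this
  refine ⟨c/2, by linarith, fun x => ?_⟩
  rw [hμ.radial]
  set r := ‖x‖ with hr
  have hr0' : 0 ≤ r := norm_nonneg x
  have hroot := hμ.rho_root
  rcases le_total r (ρ/2) with h1 | h1
  · have h2 := key (ρ/2) ⟨le_rfl, by linarith⟩ ρ ⟨by linarith, by linarith⟩ (by linarith)
    have h3 : μrad (ρ/2) ≤ μrad r := hμ.antiOn.antitoneOn hr0' (by simp; linarith) h1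
    have h4 := min_le_right |r - ρ| ρ
    have h5 := le_abs_self (μrad r)
    nlinarith
  · rcases le_total r ρ with h2 | h2
    · have h3 := key r ⟨h1, by linarith⟩ ρ ⟨by linarith, by linarith⟩ h2
      have h4 : min |r - ρ| ρ ≤ -(r - ρ) :=
        (min_le_left _ _).trans_eq (abs_of_nonpos (by linarith))
      have h5 := le_abs_self (μrad r)
      nlinarith
    · rcases le_total r (2*ρ) with h6 | h6
      · have h3 := key ρ ⟨by linarith, by linarith⟩ r ⟨h1, h6⟩ h2
        have h4 : min |r - ρ| ρ ≤ r - ρ :=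
          (min_le_left _ _).trans_eq (abs_of_nonneg (by linarith))
        have h5 := neg_le_abs (μrad r)
        nlinarith
      · have h3 := key ρ ⟨by linarith, by linarith⟩ (2*ρ) ⟨by linarith, le_rfl⟩ (by linarith)
        have h7 : μrad r ≤ μrad (2*ρ) :=
          hμ.antiOn.antitoneOn (by simp; linarith) hr0' h6
        have h4 := min_le_right |r - ρ| ρ
        have h5 := neg_le_abs (μrad r)
        nlinarith

lemma MuHyp.grad_bdd (hμ : MuHyp μ μrad ρ) (r : ℝ) :
    ∃ L : ℝ, 0 < L ∧ ∀ x : E2, ‖x‖ ≤ r → ‖fderiv ℝ μ x‖ ≤ L := by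
  have hc : Continuous (fun x => fderiv ℝ μ x) := hμ.smooth.continuous_fderiv (by simp)
  obtain ⟨L, hL⟩ := (isCompact_closedBall (0:E2) r).exists_bound_of_continuousOn hc.continuousOn
  refine ⟨max L 1, by positivity, fun x hx => (hL x (by simpa using hx)).trans (le_max_left _ _)⟩

end mufacts

lemma smoothTransition_deriv_bdd : ∃ C : ℝ, 0 < C ∧ ∀ t, |deriv Real.smoothTransition t| ≤ C := by
  have hc : Continuous (deriv Real.smoothTransition) :=
    (Real.smoothTransition.contDiff (n := 1)).continuous_deriv (by simp)
  obtain ⟨C, hC⟩ := (isCompact_Icc (a := (0:ℝ)) (b := 1)).exists_bound_of_continuousOn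
    hc.continuousOn
  refine ⟨max C 1, by positivity, fun t => ?_⟩
  by_cases h : t ∈ Icc (0:ℝ) 1
  · exact (hC t h).trans (le_max_left _ _)
  · have : deriv Real.smoothTransition t = 0 := by
      rw [mem_Icc, not_and_or, not_le, not_le] at h
      rcases h with h | h
      · have : Real.smoothTransition =ᶠ[𝓝 t] fun _ => 0 := by
          filter_upwards [Iio_mem_nhds h] with s hs
          exact Real.smoothTransition.zero_of_nonpos (le_of_lt hs)
        rw [this.deriv_eq]; simp
      · have : Real.smoothTransition =ᶠ[𝓝 t] fun _ => 1 := by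
          filter_upwards [Ioi_mem_nhds h] with s hs
          exact Real.smoothTransition.one_of_one_le (le_of_lt hs)
        rw [this.deriv_eq]; simp
    rw [this]; simp

/-- Volume constant. -/
def vol1 : ℝ := (volume : Measure E2).real (Metric.ball 0 1)

lemma vol1_pos : 0 < vol1 := by
  unfold vol1
  rw [measureReal_def]
  exact ENNReal.toReal_pos (Metric.measure_ball_pos volume 0 one_pos).ne' measure_ball_lt_top.ne

lemma vol_ball (x : E2) {r : ℝ} (hr : 0 ≤ r) :
    (volume : Measure E2).real (Metric.ball x r) = r^2 * vol1 := by
  rw [measureReal_def, Measure.addHaar_ball _ _ hr]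
  simp [vol1, measureReal_def, ENNReal.toReal_mul, hr]

lemma setIntegral_radial (g : ℝ → ℝ) {r : ℝ} :
    ∫ x in Metric.ball (0:E2) r, g ‖x‖ = 2 * vol1 * ∫ y in Ioo 0 r, y * g y := by
  have h1 : ∫ x in Metric.ball (0:E2) r, g ‖x‖ = ∫ x : E2, (Iio r).indicator g ‖x‖ := by
    rw [← integral_indicator measurableSet_ball]
    congr 1; ext x
    by_cases h : ‖x‖ < r <;> simp [h]
  rw [h1, integral_fun_norm_addHaar]
  have h2 : ∫ y in Ioi (0:ℝ), y ^ (Module.finrank ℝ E2 - 1) • (Iio r).indicator g y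
      = ∫ y in Ioo 0 r, y * g y := by
    rw [← Ioi_inter_Iio, ← setIntegral_indicator measurableSet_Iio]
    congr 1; ext y
    by_cases h : y < r <;> simp [h]
  rw [h2]
  simp [vol1, mul_assoc]

lemma log_inv_bound {A : ℝ} (hA : 0 < A) : ∃ C : ℝ, 0 < C ∧ ∀ s : ℝ, 0 < s → s ≤ 1 →
    Real.log ((A + s)/s) ≤ C * (1 + Real.log (1/s)) := by
  refine ⟨max 1 (Real.log (A+1)), by positivity, fun s hs hs1 => ?_⟩
  have h1 : 0 ≤ Real.log (1/s) := Real.log_nonneg (by rw [le_div_iff₀ hs]; linarith)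
  have h2 : Real.log ((A+s)/s) = Real.log (A+s) + Real.log (1/s) := by
    rw [← Real.log_mul (by positivity) (by positivity)]; congr 1; ring
  have h3 : Real.log (A+s) ≤ Real.log (A+1) := Real.log_le_log (by positivity) (by linarith)
  have h4 := le_max_left 1 (Real.log (A+1))
  have h5 := le_max_right 1 (Real.log (A+1))
  rw [h2]
  nlinarith

lemma int_vortex {ρ : ℝ} (hρ : 0 < ρ) : ∃ C : ℝ, 0 < C ∧ ∀ ε : ℝ, 0 < ε → ε ≤ 1 →
    ∫ x in Metric.ball (0:E2) ρ, 1/(‖x‖^2 + ε^2) ≤ C * (1 + Real.log (1/ε)) := by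
  obtain ⟨C, hC, hCb⟩ := log_inv_bound (A := ρ^2) (by positivity)
  refine ⟨2 * vol1 * (2*C), by have := vol1_pos; positivity, fun ε hε hε1 => ?_⟩
  rw [setIntegral_radial (fun y => 1/(y^2+ε^2))]
  have h0 : ∀ y : ℝ, y^2 + ε^2 ≠ 0 := fun y => by positivity
  have h1 : ∫ y in Ioo 0 ρ, y * (1/(y^2+ε^2)) = 1/2 * Real.log ((ρ^2+ε^2)/ε^2) := by
    rw [← integral_Ioc_eq_integral_Ioo, ← intervalIntegral.integral_of_le hρ.le]
    rw [intervalIntegral.integral_eq_sub_of_hasDerivAt (f := fun y => 1/2 * Real.log (y^2+ε^2))]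
    · rw [Real.log_div (h0 ρ) (by positivity)]; simp; ring
    · intro y _
      have := (((hasDerivAt_pow 2 y).add_const (ε^2)).log (h0 y)).const_mul (1/2)
      refine this.congr_deriv ?_
      have := h0 y
      push_cast
      simp only [show 2 - 1 = 1 from rfl, pow_one]
      field_simp
    · apply Continuous.intervalIntegrable
      exact continuous_id.mul (continuous_const.div (by fun_prop) h0)
  rw [h1]
  have h2 := hCb (ε^2) (by positivity) (by nlinarith)
  have h3 : Real.log (1/ε^2) = 2 * Real.log (1/ε) := by
    rw [← one_div_pow, Real.log_pow]; simp
  rw [h3] at h2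
  have h4 : 0 ≤ Real.log (1/ε) := Real.log_nonneg (by rw [le_div_iff₀ hε]; linarith)
  rw [mul_assoc (2*vol1)]
  apply mul_le_mul_of_nonneg_left _ (by have := vol1_pos; positivity)
  nlinarith

lemma int_layer {μ : E2 → ℝ} {μrad : ℝ → ℝ} {ρ : ℝ} (hμ : MuHyp μ μrad ρ) :
    ∃ C : ℝ, 0 < C ∧ ∀ s : ℝ, 0 < s → s ≤ 1 →
    ∫ x in Metric.ball (0:E2) (2*ρ), 1/(|μ x| + s) ≤ C * (1 + Real.log (1/s)) := by
  have hρ := hμ.rho_pos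
  obtain ⟨c, hc, hcl⟩ := hμ.lower
  obtain ⟨C, hC, hCb⟩ := log_inv_bound (A := c*ρ) (by positivity)
  refine ⟨2 * vol1 * (2 * ρ) * (2/c*C), by have := vol1_pos; positivity, fun s hs hs1 => ?_⟩
  have hcont : Continuous (fun x => 1/(|μ x| + s)) :=
    continuous_const.div (by have := hμ.smooth.continuous; fun_prop) (fun x => by positivity)
  have hcont2 : Continuous (fun y : ℝ => 1/(c*|y-ρ| + s)) :=
    continuous_const.div (by fun_prop) (fun x => by positivity)
  have hle : ∫ x in Metric.ball (0:E2) (2*ρ), 1/(|μ x| + s) ≤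
      ∫ x in Metric.ball (0:E2) (2*ρ), (fun y => 1/(c*|y-ρ| + s)) ‖x‖ := by
    apply setIntegral_mono_on
    · exact (hcont.continuousOn.integrableOn_compact (isCompact_closedBall (0:E2) (2*ρ))).mono_set
        Metric.ball_subset_closedBall
    · exact ((hcont2.comp continuous_norm).continuousOn.integrableOn_compact
        (isCompact_closedBall (0:E2) (2*ρ))).mono_set Metric.ball_subset_closedBall
    · exact measurableSet_ball
    · intro x hx
      have hx' : ‖x‖ < 2*ρ := by simpa using hx
      apply one_div_le_one_div_of_le (by positivity)
      have h1 := hcl x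
      have : |‖x‖ - ρ| ≤ ρ := by rw [abs_le]; constructor <;> linarith [norm_nonneg x]
      rw [min_eq_left this] at h1
      linarith
  refine hle.trans ?_
  rw [setIntegral_radial (fun y => 1/(c*|y-ρ| + s)), mul_assoc (2*vol1), mul_assoc (2*vol1)]
  apply mul_le_mul_of_nonneg_left _ (by have := vol1_pos; positivity)
  have hle2 : ∫ y in Ioo 0 (2*ρ), y * (1/(c*|y-ρ| + s)) ≤
      ∫ y in Ioo 0 (2*ρ), (2*ρ) * (1/(c*|y-ρ| + s)) := by
    apply setIntegral_mono_on
    · exact ((continuous_id.mul hcont2).continuousOn.integrableOn_compact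
        (isCompact_Icc (a := 0) (b := 2*ρ))).mono_set Ioo_subset_Icc_self
    · exact ((continuous_const.mul hcont2).continuousOn.integrableOn_compact
        (isCompact_Icc (a := 0) (b := 2*ρ))).mono_set Ioo_subset_Icc_self
    · exact measurableSet_Ioo
    · intro y hy
      exact mul_le_mul_of_nonneg_right hy.2.le (by positivity)
  refine hle2.trans ?_
  rw [integral_const_mul, mul_assoc (2*ρ)]
  apply mul_le_mul_of_nonneg_left _ (by positivity)
  have hintg : ∫ y in Ioo 0 (2*ρ), 1/(c*|y-ρ| + s) = 2/c * Real.log ((c*ρ+s)/s) := by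
    rw [← integral_Ioc_eq_integral_Ioo, ← intervalIntegral.integral_of_le (by linarith),
      ← intervalIntegral.integral_add_adjacent_intervals (b := ρ)
        (hcont2.intervalIntegrable _ _) (hcont2.intervalIntegrable _ _)]
    have e1 : ∫ y in (0:ℝ)..ρ, 1/(c*|y-ρ| + s) = ∫ y in (0:ℝ)..ρ, 1/(c*(ρ-y) + s) := by
      apply intervalIntegral.integral_congr
      intro y hy
      rw [uIcc_of_le hρ.le] at hy
      simp only
      rw [abs_of_nonpos (by linarith [hy.2])]; ring_nf
    have e2 : ∫ y in ρ..(2*ρ), 1/(c*|y-ρ| + s) = ∫ y in ρ..(2*ρ), 1/(c*(y-ρ) + s) := by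
      apply intervalIntegral.integral_congr
      intro y hy
      rw [uIcc_of_le (by linarith)] at hy
      simp only
      rw [abs_of_nonneg (by linarith [hy.1])]
    have g2 : ∫ y in ρ..(2*ρ), 1/(c*(y-ρ) + s) = 1/c * Real.log ((c*ρ+s)/s) := by
      rw [intervalIntegral.integral_eq_sub_of_hasDerivAt
        (f := fun y => 1/c * Real.log (c*(y-ρ)+s))]
      · rw [Real.log_div (by positivity) (by positivity)]; simp; ring_nf
      · intro y hy
        rw [uIcc_of_le (by linarith)] at hy
        have hp : c*(y-ρ)+s ≠ 0 := by have := hy.1; nlinarith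
        have := (((((hasDerivAt_id y).sub_const ρ).const_mul c).add_const s).log hp).const_mul (1/c)
        refine HasDerivAt.congr_deriv this ?_
        simp only [id_eq]; field_simp
      · apply ContinuousOn.intervalIntegrable
        rw [uIcc_of_le (by linarith)]
        apply ContinuousOn.div continuousOn_const (by fun_prop)
        intro y hy
        have := hy.1; nlinarith
    have g1 : ∫ y in (0:ℝ)..ρ, 1/(c*(ρ-y) + s) = 1/c * Real.log ((c*ρ+s)/s) := by
      rw [intervalIntegral.integral_eq_sub_of_hasDerivAt
        (f := fun y => -(1/c * Real.log (c*(ρ-y)+s)))]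
      · rw [Real.log_div (by positivity) (by positivity)]; simp; ring_nf
      · intro y hy
        rw [uIcc_of_le (by linarith)] at hy
        have hp : c*(ρ-y)+s ≠ 0 := by have := hy.2; nlinarith
        have := ((((((hasDerivAt_id y).const_sub ρ).const_mul c).add_const s).log hp).const_mul
          (1/c)).neg
        refine HasDerivAt.congr_deriv this ?_
        simp only [id_eq]; field_simp
      · apply ContinuousOn.intervalIntegrable
        rw [uIcc_of_le (by linarith)]
        apply ContinuousOn.div continuousOn_const (by fun_prop)
        intro y hy
        have := hy.2; nlinarith
    rw [e1, e2, g1, g2]; ring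
  rw [hintg, mul_assoc]
  apply mul_le_mul_of_nonneg_left (hCb s hs hs1) (by positivity)

/-- Truncated square root. -/
def Qs (s m : ℝ) : ℝ := √m * Real.smoothTransition (m/s - 1)

lemma Qs_nonneg (s m : ℝ) : 0 ≤ Qs s m :=
  mul_nonneg (Real.sqrt_nonneg _) (Real.smoothTransition.nonneg _)

lemma Qs_le (s m : ℝ) : Qs s m ≤ √m :=
  mul_le_of_le_one_right (Real.sqrt_nonneg _) (Real.smoothTransition.le_one _)

lemma Qs_zero {s m : ℝ} (hs : 0 < s) (h : m ≤ s) : Qs s m = 0 := by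
  unfold Qs
  rw [Real.smoothTransition.zero_of_nonpos, mul_zero]
  rw [sub_nonpos, div_le_one hs]; exact h

lemma Qs_eq {s m : ℝ} (hs : 0 < s) (h : 2*s ≤ m) : Qs s m = √m := by
  unfold Qs
  rw [Real.smoothTransition.one_of_one_le, mul_one]
  rw [le_sub_iff_add_le, le_div_iff₀ hs]; linarith

lemma Qs_deriv : ∃ C : ℝ, 0 < C ∧ ∀ s m : ℝ, 0 < s → ∃ d, HasDerivAt (Qs s) d m ∧
    d^2 ≤ C/(|m|+s) ∧ (m < s → d = 0) := by
  obtain ⟨C, hC, hCb⟩ := smoothTransition_deriv_bdd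
  refine ⟨2*(1 + 2*C)^2, by positivity, fun s m hs => ?_⟩
  rcases lt_or_ge m s with h | h
  · refine ⟨0, ?_, by simp; positivity, fun _ => rfl⟩
    have : Qs s =ᶠ[𝓝 m] fun _ => 0 := by
      filter_upwards [Iio_mem_nhds h] with y hy using Qs_zero hs (le_of_lt hy)
    exact (hasDerivAt_const m (0:ℝ)).congr_of_eventuallyEq this
  · have hm : 0 < m := hs.trans_le h
    have hq : 0 < √m := Real.sqrt_pos.2 hm
    have h1 : HasDerivAt (fun m => Real.smoothTransition (m/s - 1))
        (deriv Real.smoothTransition (m/s-1) * (1/s)) m := by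
      have ha : HasDerivAt Real.smoothTransition (deriv Real.smoothTransition (m/s-1)) (m/s-1) :=
        ((Real.smoothTransition.contDiff (n := 1)).differentiable (by simp) _).hasDerivAt
      exact ha.comp m (((hasDerivAt_id m).div_const s).sub_const 1)
    have h2 := (Real.hasDerivAt_sqrt hm.ne').mul h1
    refine ⟨_, h2, ?_, fun h' => absurd h' (not_lt.2 h)⟩
    have hη0 := Real.smoothTransition.nonneg (m/s - 1)
    have hη1 := Real.smoothTransition.le_one (m/s - 1)
    have hb : |deriv Real.smoothTransition (m/s-1)| * (m/s) ≤ 2*C := by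
      rcases le_or_gt (m/s) 2 with h3 | h3
      · have : 0 ≤ m/s := by positivity
        nlinarith [hCb (m/s-1), abs_nonneg (deriv Real.smoothTransition (m/s-1))]
      · have : deriv Real.smoothTransition (m/s-1) = 0 := by
          have : Real.smoothTransition =ᶠ[𝓝 (m/s-1)] fun _ => 1 := by
            filter_upwards [Ioi_mem_nhds (show (1:ℝ) < m/s-1 by linarith)] with s hs
            exact Real.smoothTransition.one_of_one_le (le_of_lt hs)
          rw [this.deriv_eq]; simp
        rw [this]; simp; positivity
    set D := deriv Real.smoothTransition (m/s-1) with hD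
    set η := Real.smoothTransition (m/s-1) with hη
    have hsq : √m * √m = m := Real.mul_self_sqrt hm.le
    have e : 1/(2*√m) * η + √m * (D * (1/s)) = (η/2 + D*(m/s))/√m := by
      field_simp
      rw [sq, hsq]; ring
    rw [e, div_pow, sq √m, hsq, abs_of_pos hm, div_le_div_iff₀ hm (by positivity)]
    have hb' : |η/2 + D*(m/s)| ≤ 1 + 2*C := by
      refine (abs_add_le _ _).trans ?_
      rw [abs_of_nonneg (by positivity), abs_mul, abs_of_pos (show 0 < m/s by positivity)]
      linarith
    have := sq_le_sq' (by linarith [abs_le.1 hb']) (abs_le.1 hb').2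
    nlinarith [sq_nonneg (1+2*C)]

/-- Regularized radial direction normalizer. -/
def nrm (ε : ℝ) (x : E2) : ℝ := √(‖x‖^2 + ε^2)

lemma nrm_pos {ε : ℝ} (hε : 0 < ε) (x : E2) : 0 < nrm ε x := Real.sqrt_pos.2 (by positivity)

lemma nrm_sq {ε : ℝ} (hε : 0 < ε) (x : E2) : nrm ε x ^ 2 = ‖x‖^2 + ε^2 :=
  Real.sq_sqrt (by positivity)

lemma norm_le_nrm {ε : ℝ} (hε : 0 < ε) (x : E2) : ‖x‖ ≤ nrm ε x :=
  Real.le_sqrt_of_sq_le (by nlinarith)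

lemma hasFDerivAt_ninv {ε : ℝ} (hε : 0 < ε) (x : E2) :
    HasFDerivAt (fun x => (nrm ε x)⁻¹) ((-(nrm ε x ^ 3)⁻¹) • innerSL ℝ x) x := by
  have h1 : HasFDerivAt (fun x : E2 => ‖x‖^2 + ε^2) (2 • innerSL ℝ x) x :=
    (hasStrictFDerivAt_norm_sq x).hasFDerivAt.add_const _
  have hp := nrm_pos hε x
  have hsq := nrm_sq hε x
  have h2 := h1.sqrt (by positivity)
  have h3 : HasFDerivAt (fun x => (nrm ε x)⁻¹) _ x := 
    (hasDerivAt_inv hp.ne').comp_hasFDerivAt x h2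
  refine h3.congr_fderiv ?_
  refine ContinuousLinearMap.ext fun y => ?_
  change -(nrm ε x ^ 2)⁻¹ * (1/(2*nrm ε x) * ((2:ℕ) • innerSL ℝ x) y) = (-(nrm ε x ^ 3)⁻¹) * innerSL ℝ x y
  simp
  field_simp

lemma comp_deriv {μ : E2 → ℝ} (hμd : Differentiable ℝ μ) : ∃ C : ℝ, 0 < C ∧
    ∀ s ε : ℝ, 0 < s → 0 < ε → ∀ x : E2,
    DifferentiableAt ℝ (fun x => (Qs s (μ x)) • (nrm ε x)⁻¹ • x) x ∧
    (μ x < s → gradSq (fun x => (Qs s (μ x)) • (nrm ε x)⁻¹ • x) x = 0) ∧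
    gradSq (fun x => (Qs s (μ x)) • (nrm ε x)⁻¹ • x) x ≤
      C * (‖fderiv ℝ μ x‖^2/(|μ x|+s) + |μ x| / (‖x‖^2+ε^2)) := by
  obtain ⟨C, hC, hQ⟩ := Qs_deriv
  refine ⟨4*C+16, by positivity, fun s ε hs hε x => ?_⟩
  obtain ⟨d, hd, hdb, hd0⟩ := hQ s (μ x) hs
  have h1 : HasFDerivAt (fun x => Qs s (μ x)) (d • fderiv ℝ μ x) x :=
    hd.comp_hasFDerivAt x (hμd x).hasFDerivAt
  have h2 := (hasFDerivAt_ninv hε x).smul (hasFDerivAt_id x)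
  have h3 := h1.smul h2
  have hp := nrm_pos hε x
  have hsq := nrm_sq hε x
  have hle := norm_le_nrm hε x
  have hfd : fderiv ℝ (fun x => (Qs s (μ x)) • (nrm ε x)⁻¹ • x) x = _ := h3.fderiv
  refine ⟨h3.differentiableAt, fun hlt => ?_, ?_⟩
  · unfold gradSq
    rw [hfd, hd0 hlt, Qs_zero hs hlt.le]
    simp
  · refine (gradSq_le _ _).trans ?_
    rw [hfd]
    have hn : ‖(Qs s (μ x)) • ((nrm ε x)⁻¹ • ContinuousLinearMap.id ℝ E2 +
        ((-(nrm ε x ^ 3)⁻¹) • innerSL ℝ x).smulRight (id x)) + 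
        (d • fderiv ℝ μ x).smulRight ((nrm ε x)⁻¹ • id x)‖ ≤
        Qs s (μ x) * (2 * (nrm ε x)⁻¹) + |d| * ‖fderiv ℝ μ x‖ := by
      refine (norm_add_le _ _).trans (add_le_add ?_ ?_)
      · rw [norm_smul, Real.norm_of_nonneg (Qs_nonneg _ _)]
        apply mul_le_mul_of_nonneg_left _ (Qs_nonneg _ _)
        refine (norm_add_le _ _).trans ?_
        rw [two_mul]
        refine add_le_add ?_ ?_
        · rw [norm_smul, Real.norm_of_nonneg (by positivity)]
          exact mul_le_of_le_one_right (by positivity) ContinuousLinearMap.norm_id_le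
        · rw [ContinuousLinearMap.norm_smulRight_apply, norm_smul, norm_neg,
            Real.norm_of_nonneg (by positivity), innerSL_apply_norm, id]
          rw [mul_assoc, inv_mul_le_iff₀ (by positivity)]
          have : nrm ε x ^ 3 * (nrm ε x)⁻¹ = nrm ε x * nrm ε x := by field_simp
          rw [this]
          exact mul_le_mul hle hle (norm_nonneg _) hp.le
      · rw [ContinuousLinearMap.norm_smulRight_apply, norm_smul, norm_smul, Real.norm_eq_abs,
          Real.norm_of_nonneg (by positivity), id]
        apply mul_le_of_le_one_right (by positivity)
        rw [inv_mul_le_iff₀ hp]; linarith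
    have hn2 := pow_le_pow_left₀ (norm_nonneg _) hn 2
    refine (mul_le_mul_of_nonneg_left hn2 (by norm_num)).trans ?_
    have hQsq : Qs s (μ x) ^2 ≤ |μ x| := by
      have := Qs_le s (μ x)
      rcases le_total (μ x) 0 with h | h
      · rw [Qs_zero hs (by linarith)]; simp
      · rw [abs_of_nonneg h, ← Real.sq_sqrt h]
        exact pow_le_pow_left₀ (Qs_nonneg _ _) (by rwa [Real.sq_sqrt h]) 2
    have e1 : (Qs s (μ x) * (2 * (nrm ε x)⁻¹))^2 ≤ 4 * (|μ x| / (‖x‖^2+ε^2)) := by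
      rw [← hsq]
      have : (Qs s (μ x) * (2 * (nrm ε x)⁻¹))^2 = 4 * (Qs s (μ x) ^2/ nrm ε x ^2) := by
        field_simp; ring
      rw [this]; gcongr
    have e2 : (|d| * ‖fderiv ℝ μ x‖)^2 ≤ C * (‖fderiv ℝ μ x‖^2/(|μ x|+s)) := by
      rw [mul_pow, sq_abs]
      calc _ ≤ C/(|μ x|+s) * ‖fderiv ℝ μ x‖^2 := by gcongr
        _ = _ := by ring
    have p1 : 0 ≤ ‖fderiv ℝ μ x‖^2/(|μ x|+s) := by positivity
    have p2 : 0 ≤ |μ x| / (‖x‖^2+ε^2) := by positivity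
    nlinarith [sq_nonneg (Qs s (μ x) * (2 * (nrm ε x)⁻¹) - |d| * ‖fderiv ℝ μ x‖)]

lemma alg_young {A ε q z : ℝ} (hε : 0 < ε) (hq : 0 < q) :
    (A/ε) * z ≤ (1/(8*ε^2)) * (q*z)^2 + 2*A^2/q^2 := by
  have : (1/(8*ε^2)) * (q*z)^2 + 2*A^2/q^2 - (A/ε) * z = 2 * (q*z/(4*ε) - A/q)^2 := by
    field_simp; ring
  nlinarith [sq_nonneg (q*z/(4*ε) - A/q)]

lemma alg_neg {A ε m t : ℝ} (hε : 0 < ε) (hm : m < 0) (ht : 0 ≤ t) :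
    (A/ε) * t ≤ (-m)*t^2/(2*ε^2) + A^2/(2*(-m)) := by
  have hm' : 0 < -m := by linarith
  have hq : 0 < √(-m) := Real.sqrt_pos.2 hm'
  have e : √(-m)^2 = -m := Real.sq_sqrt hm'.le
  rw [← e]
  have : √(-m)^2*t^2/(2*ε^2) + A^2/(2*√(-m)^2) - (A/ε)*t = (1/2) * (√(-m)*t/ε - A/√(-m))^2 := by
    field_simp; ring
  nlinarith [sq_nonneg (√(-m)*t/ε - A/√(-m))]

lemma alg_mid {A σ z : ℝ} (hσ : 0 < σ) :
    (A/σ^3) * z ≤ (1/(8*(σ^3)^2)) * (z^2)^2 + (A^2+1)/σ^2 := by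
  obtain ⟨ζ, rfl⟩ : ∃ ζ, z = σ*ζ := ⟨z/σ, by field_simp⟩
  have : (1/(8*(σ^3)^2)) * ((σ*ζ)^2)^2 + (A^2+1)/σ^2 - (A/σ^3) * (σ*ζ)
    = (ζ^4/8 + (A^2+1) - A*ζ)/σ^2 := by field_simp
  have h2 : 0 ≤ ζ^4/8 + (A^2+1) - A*ζ := by
    nlinarith [sq_nonneg (ζ^2-1), sq_nonneg (ζ/2 - A)]
  have := div_nonneg h2 (sq_nonneg σ)
  linarith

lemma alg_err1 {A A0 σ m t : ℝ} (hσ : 0 < σ) (ht : 0 ≤ t) (hA : 0 ≤ A) (hA0 : A ≤ A0) :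
    (A/σ^3) * (t - √m) ≤ (1/(8*(σ^3)^2)) * (t^2 - max m 0)^2
      + (max m 0 - m)*t^2/(2*(σ^3)^2) + (4*A0^2+2)/(|m|+σ^2) := by
  have hAA : A^2 ≤ A0^2 := pow_le_pow_left₀ hA hA0 2
  have hs : 0 < σ^2 := by positivity
  have hε : 0 < σ^3 := by positivity
  have hpos : 0 ≤ (4*A0^2+2)/(|m|+σ^2) := by positivity
  have hm0 : 0 ≤ (max m 0 - m)*t^2/(2*(σ^3)^2) := by
    have : 0 ≤ max m 0 - m := by linarith [le_max_left m 0]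
    positivity
  have hsq : √m^2 = max m 0 := by
    rcases le_total m 0 with h | h
    · rw [Real.sqrt_eq_zero_of_nonpos h, max_eq_right h]; simp
    · rw [Real.sq_sqrt h, max_eq_left h]
  have hq0 : 0 ≤ √m := Real.sqrt_nonneg m
  rcases le_total t √m with h | h
  · have : (A/σ^3) * (t - √m) ≤ 0 :=
      mul_nonpos_of_nonneg_of_nonpos (by positivity) (by linarith)
    have : 0 ≤ (1/(8*(σ^3)^2)) * (t^2 - max m 0)^2 := by positivity
    linarith
  rcases le_total (σ^2) m with h1 | h1
  · have hm : 0 < m := hs.trans_le h1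
    have hq : 0 < √m := Real.sqrt_pos.2 hm
    have h2 := alg_young (A := A) (z := t - √m) hε hq
    have h3 : (√m * (t-√m))^2 ≤ (t^2 - max m 0)^2 := by
      apply pow_le_pow_left₀ (mul_nonneg hq0 (by linarith))
      rw [← hsq]; nlinarith
    have h4 : 2*A^2/√m^2 ≤ (4*A0^2+2)/(|m|+σ^2) := by
      rw [Real.sq_sqrt hm.le, abs_of_pos hm, div_le_div_iff₀ hm (by positivity)]
      nlinarith [sq_nonneg A]
    have h5 := mul_le_mul_of_nonneg_left h3 (show 0 ≤ 1/(8*(σ^3)^2) by positivity)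
    linarith
  · rcases le_total m (-σ^2) with h2 | h2
    · have hm : m < 0 := by linarith
      have h3 := alg_neg (A := A) hε hm ht
      rw [Real.sqrt_eq_zero_of_nonpos hm.le, max_eq_right hm.le, abs_of_neg hm]
      have h4 : A^2/(2*(-m)) ≤ (4*A0^2+2)/(-m+σ^2) := by
        rw [div_le_div_iff₀ (by linarith) (by linarith)]
        nlinarith [sq_nonneg A]
      have : 0 ≤ (1/(8*(σ^3)^2)) * (t^2 - 0)^2 := by positivity
      simp only [sub_zero, zero_sub] at *
      linarith
    · have h3 := alg_mid (A := A) (z := t - √m) hσ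
      have h4 : ((t-√m)^2)^2 ≤ (t^2 - max m 0)^2 := by
        apply pow_le_pow_left₀ (sq_nonneg _)
        rw [← hsq]; nlinarith
      have hm : |m| ≤ σ^2 := abs_le.2 ⟨by linarith, h1⟩
      have h5 : (A^2+1)/σ^2 ≤ (4*A0^2+2)/(|m|+σ^2) := by
        rw [div_le_div_iff₀ hs (by positivity)]
        nlinarith [sq_nonneg A]
      have h6 := mul_le_mul_of_nonneg_left h4 (show 0 ≤ 1/(8*(σ^3)^2) by positivity)
      linarith

lemma alg_err2 {A A0 M0 σ m : ℝ} (x : E2) (hσ : 0 < σ) (hσ1 : σ ≤ 1) (hA : 0 ≤ A) (hA0 : A ≤ A0)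
    (hm : 0 ≤ m) (hM : m ≤ M0) :
    (A/σ^3) * √m ≤ (A/σ^3) * (Qs (σ^2) m * ‖x‖ * (nrm (σ^3) x)⁻¹)
      + 6*A0/(|m|+σ^2) + A0 * √M0 * (1/(‖x‖^2+(σ^3)^2)) := by
  have hs : 0 < σ^2 := by positivity
  have hε : 0 < σ^3 := by positivity
  have hN := nrm_pos hε x
  have hN2 := nrm_sq hε x
  have hle := norm_le_nrm hε x
  have hA0' : 0 ≤ A0 := hA.trans hA0
  have p1 : 0 ≤ 6*A0/(|m|+σ^2) := by positivity
  have p2 : 0 ≤ A0 * √M0 * (1/(‖x‖^2+(σ^3)^2)) := by positivity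
  have p3 : 0 ≤ (A/σ^3) * (Qs (σ^2) m * ‖x‖ * (nrm (σ^3) x)⁻¹) := by
    have := Qs_nonneg (σ^2) m
    positivity
  rcases le_total (2*σ^2) m with h | h
  · rw [Qs_eq hs h]
    have hr : 1 - ‖x‖ * (nrm (σ^3) x)⁻¹ ≤ (σ^3)^2 * (1/(‖x‖^2+(σ^3)^2)) := by
      rw [← hN2]
      have : (σ^3)^2 = nrm (σ^3) x ^2 - ‖x‖^2 := by linarith
      rw [this]
      have e : (nrm (σ^3) x ^2 - ‖x‖^2) * (1/nrm (σ^3) x ^2) - (1 - ‖x‖ * (nrm (σ^3) x)⁻¹)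
        = ‖x‖ * (nrm (σ^3) x - ‖x‖) / nrm (σ^3) x ^2 := by field_simp; ring
      have : 0 ≤ ‖x‖ * (nrm (σ^3) x - ‖x‖) / nrm (σ^3) x ^2 := by
        have : 0 ≤ nrm (σ^3) x - ‖x‖ := by linarith
        positivity
      linarith
    have hsq : √m ≤ √M0 := Real.sqrt_le_sqrt hM
    have h1 : (A/σ^3) * √m * (1 - ‖x‖ * (nrm (σ^3) x)⁻¹) ≤
        A0 * √M0 * (1/(‖x‖^2+(σ^3)^2)) := by
      calc _ ≤ (A/σ^3) * √m * ((σ^3)^2 * (1/(‖x‖^2+(σ^3)^2))) := by gcongr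
        _ = (A * √m * σ^3) * (1/(‖x‖^2+(σ^3)^2)) := by field_simp
        _ ≤ (A0 * √M0 * 1) * (1/(‖x‖^2+(σ^3)^2)) := by
          gcongr
          exact pow_le_one₀ hσ.le hσ1
        _ = _ := by ring
    nlinarith
  · have h1 : √m ≤ 2*σ := by
      rw [Real.sqrt_le_left (by positivity)]; nlinarith
    have h2 : (A/σ^3) * √m ≤ 6*A0/(|m|+σ^2) := by
      calc _ ≤ (A0/σ^3) * (2*σ) := by gcongr
        _ = 2*A0/σ^2 := by field_simp
        _ ≤ _ := by
          rw [abs_of_nonneg hm, div_le_div_iff₀ hs (by positivity)]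
          nlinarith
    linarith

lemma alg_err3 {M0 σ m : ℝ} (x : E2) (hσ : 0 < σ)
    (hm : 0 ≤ m) (hM : m ≤ M0) :
    (1/(4*(σ^3)^2)) * ((Qs (σ^2) m * (‖x‖ * (nrm (σ^3) x)⁻¹))^2 - m)^2
      ≤ 3/(|m|+σ^2) + M0^2 * (1/(‖x‖^2+(σ^3)^2)) := by
  have hs : 0 < σ^2 := by positivity
  have hε : 0 < σ^3 := by positivity
  have hN := nrm_pos hε x
  have hN2 := nrm_sq hε x
  have hle := norm_le_nrm hε x
  have p1 : 0 ≤ 3/(|m|+σ^2) := by positivity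
  have p2 : 0 ≤ M0^2 * (1/(‖x‖^2+(σ^3)^2)) := by positivity
  rw [mul_pow]
  rcases le_total (2*σ^2) m with h | h
  · rw [Qs_eq hs h, Real.sq_sqrt hm]
    have e : m * (‖x‖ * (nrm (σ^3) x)⁻¹)^2 - m = -(m * (σ^3)^2 / nrm (σ^3) x ^2) := by
      have : (σ^3)^2 = nrm (σ^3) x ^2 - ‖x‖^2 := by linarith
      rw [this]; field_simp; ring
    rw [e]
    have : (1/(4*(σ^3)^2)) * (-(m * (σ^3)^2 / nrm (σ^3) x ^2))^2 
      = (m^2 * (1/(nrm (σ^3) x ^2))) * ((σ^3)^2/(nrm (σ^3) x ^2)) * (1/4) := by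
      field_simp
    rw [this, ← hN2]
    have h1 : (σ^3)^2/(nrm (σ^3) x ^2) ≤ 1 := by
      rw [div_le_one (by positivity)]; nlinarith [sq_nonneg ‖x‖]
    have h2 : m^2 * (1/(nrm (σ^3) x ^2)) ≤ M0^2 * (1/(nrm (σ^3) x ^2)) := by gcongr
    have h3 : 0 ≤ m^2 * (1/(nrm (σ^3) x ^2)) := by positivity
    have h4 : 0 ≤ (σ^3)^2/(nrm (σ^3) x ^2) := by positivity
    nlinarith
  · have hq : Qs (σ^2) m ^2 ≤ m := by
      rw [← Real.sq_sqrt hm]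
      exact pow_le_pow_left₀ (Qs_nonneg _ _) (by rw [Real.sq_sqrt hm]; exact Qs_le _ _) 2
    have hr : (‖x‖ * (nrm (σ^3) x)⁻¹)^2 ≤ 1 := by
      apply pow_le_one₀ (by positivity)
      rw [mul_inv_le_iff₀ hN]; linarith
    have h0 : 0 ≤ Qs (σ^2) m ^2 * (‖x‖ * (nrm (σ^3) x)⁻¹)^2 := by positivity
    have h1 : Qs (σ^2) m ^2 * (‖x‖ * (nrm (σ^3) x)⁻¹)^2 ≤ m := by
      nlinarith [sq_nonneg (Qs (σ^2) m)]
    have h2 : (Qs (σ^2) m ^2 * (‖x‖ * (nrm (σ^3) x)⁻¹)^2 - m)^2 ≤ (2*σ^2)^2 := by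
      apply sq_le_sq' <;> linarith
    have h3 : (1/(4*(σ^3)^2)) * (Qs (σ^2) m ^2 * (‖x‖ * (nrm (σ^3) x)⁻¹)^2 - m)^2 ≤ 1/σ^2 := by
      calc _ ≤ (1/(4*(σ^3)^2)) * (2*σ^2)^2 := by gcongr
        _ = _ := by field_simp; ring
    have h4 : 1/σ^2 ≤ 3/(|m|+σ^2) := by
      rw [abs_of_nonneg hm, div_le_div_iff₀ hs (by positivity)]; linarith
    linarith

/-- The competitor. -/
def w0 (μ : E2 → ℝ) (σ : ℝ) (x : E2) : E2 := (Qs (σ^2) (μ x)) • (nrm (σ^3) x)⁻¹ • x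

/-- The error density. -/
def Gerr (μ : E2 → ℝ) (ρ σ : ℝ) (x : E2) : ℝ :=
  (Metric.ball (0:E2) (2*ρ)).indicator (fun x => 1/(|μ x|+σ^2)) x +
  (Metric.ball (0:E2) ρ).indicator (fun x => 1/(‖x‖^2+(σ^3)^2)) x

section eb
variable {μ : E2 → ℝ} {μrad : ℝ → ℝ} {ρ : ℝ} {f : E2 → E2} {frad : ℝ → ℝ}

lemma log_nonneg' {s : ℝ} (h : 0 < s) (h1 : s ≤ 1) : 0 ≤ Real.log (1/s) :=
  Real.log_nonneg (by rw [le_div_iff₀ h]; linarith)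

lemma Gerr_int (hμ : MuHyp μ μrad ρ) : ∃ C : ℝ, 0 < C ∧ ∀ σ : ℝ, 0 < σ → σ ≤ 1 →
    Integrable (Gerr μ ρ σ) ∧ ∫ x, Gerr μ ρ σ x ≤ C * (1 + Real.log (1/σ)) := by
  obtain ⟨C1, h1, H1⟩ := int_layer hμ
  obtain ⟨C2, h2, H2⟩ := int_vortex hμ.rho_pos
  refine ⟨2*C1+3*C2, by positivity, fun σ hσ hσ1 => ?_⟩
  have c1 : Continuous (fun x => 1/(|μ x| + σ^2)) :=
    continuous_const.div (by have := hμ.smooth.continuous; fun_prop) (fun x => by positivity)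
  have c2 : Continuous (fun x : E2 => 1/(‖x‖^2 + (σ^3)^2)) :=
    continuous_const.div (by fun_prop) (fun x => by positivity)
  have i1 : Integrable ((Metric.ball (0:E2) (2*ρ)).indicator (fun x => 1/(|μ x|+σ^2))) := by
    rw [integrable_indicator_iff measurableSet_ball]
    exact (c1.continuousOn.integrableOn_compact (isCompact_closedBall (0:E2) (2*ρ))).mono_set
      Metric.ball_subset_closedBall
  have i2 : Integrable ((Metric.ball (0:E2) ρ).indicator (fun x => 1/(‖x‖^2+(σ^3)^2))) := by
    rw [integrable_indicator_iff measurableSet_ball]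
    exact (c2.continuousOn.integrableOn_compact (isCompact_closedBall (0:E2) ρ)).mono_set
      Metric.ball_subset_closedBall
  refine ⟨i1.add i2, ?_⟩
  unfold Gerr
  rw [integral_add i1 i2, integral_indicator measurableSet_ball,
    integral_indicator measurableSet_ball]
  have a1 := H1 (σ^2) (by positivity) (pow_le_one₀ hσ.le hσ1)
  have a2 := H2 (σ^3) (by positivity) (pow_le_one₀ hσ.le hσ1)
  have l1 : Real.log (1/σ^2) = 2 * Real.log (1/σ) := by
    rw [← one_div_pow, Real.log_pow]; simp
  have l2 : Real.log (1/σ^3) = 3 * Real.log (1/σ) := by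
    rw [← one_div_pow, Real.log_pow]; simp
  rw [l1] at a1
  rw [l2] at a2
  have := log_nonneg' hσ hσ1
  nlinarith

lemma Gerr_nonneg (μ : E2 → ℝ) (ρ : ℝ) (σ : ℝ) (x : E2) : 0 ≤ Gerr μ ρ σ x := by
  unfold Gerr
  apply add_nonneg <;> apply indicator_nonneg <;> intro y _ <;> positivity

lemma norm_w0 (μ : E2 → ℝ) {σ : ℝ} (hσ : 0 < σ) (x : E2) :
    ‖w0 μ σ x‖ = Qs (σ^2) (μ x) * (‖x‖ * (nrm (σ^3) x)⁻¹) := by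
  have := nrm_pos (show 0 < σ^3 by positivity) x
  rw [w0, norm_smul, norm_smul, Real.norm_of_nonneg (Qs_nonneg _ _),
    Real.norm_of_nonneg (by positivity)]; ring

lemma inner_w0 (hf : FHyp f frad) (μ : E2 → ℝ) (σ : ℝ) (x : E2) :
    (inner ℝ (f x) (w0 μ σ x) : ℝ) = ‖f x‖ * (Qs (σ^2) (μ x) * ‖x‖ * (nrm (σ^3) x)⁻¹) := by
  by_cases hx : x = 0
  · simp [hx, w0]
  · have hr : 0 < ‖x‖ := norm_pos_iff.2 hx
    have hp := hf.pos_rad _ hr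
    have h1 : ‖f x‖ = frad ‖x‖ := by
      rw [hf.radial x hx, norm_smul, Real.norm_of_nonneg (by positivity)]; field_simp
    rw [h1]
    conv_lhs => rw [hf.radial x hx]
    rw [w0, inner_smul_left, inner_smul_right, inner_smul_right, real_inner_self_eq_norm_sq]
    simp
    field_simp

lemma dens_id (ε a : ℝ) (hε : 0 < ε) (μ : E2 → ℝ) (f u : E2 → E2) (x : E2) :
    dens ε a μ f u x = (1/2) * gradSq u x + (1/(4*ε^2)) * (‖u x‖^2 - max (μ x) 0)^2
      - (max (μ x) 0)^2/(4*ε^2) + (max (μ x) 0 - μ x)*‖u x‖^2/(2*ε^2)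
      - (a/ε) * (inner ℝ (f x) (u x) : ℝ) := by
  unfold dens
  field_simp
  ring

set_option maxHeartbeats 1000000 in
lemma pointwise_bound (hμ : MuHyp μ μrad ρ) (hf : FHyp f frad) (A0 : ℝ) :
    ∃ C σ0 : ℝ, 0 < C ∧ 0 < σ0 ∧ σ0 ≤ 1 ∧ ∀ σ a : ℝ, 0 < σ → σ ≤ σ0 → 0 ≤ a → a ≤ A0 → 
    ∀ x : E2, 
    (1/2) * gradSq (w0 μ σ) x + (1/(4*(σ^3)^2)) * (‖w0 μ σ x‖^2 - max (μ x) 0)^2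
      ≤ C * Gerr μ ρ σ x ∧
    (max (μ x) 0 - μ x)*‖w0 μ σ x‖^2 = 0 ∧
    (a*‖f x‖/σ^3) * √(μ x) ≤ (a/σ^3) * (inner ℝ (f x) (w0 μ σ x) : ℝ) + C * Gerr μ ρ σ x ∧
    ∀ t : ℝ, 0 ≤ t → (a*‖f x‖/σ^3) * (t - √(μ x)) ≤ (1/(8*(σ^3)^2)) * (t^2 - max (μ x) 0)^2
      + (max (μ x) 0 - μ x)*t^2/(2*(σ^3)^2) + C * (Gerr μ ρ σ x + ‖f x‖^2) := by
  have hρ := hμ.rho_pos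
  obtain ⟨M0, hM0⟩ := hμ.bdd
  have hM0' : 0 ≤ M0 := (abs_nonneg _).trans (hM0 0)
  obtain ⟨F, hF⟩ := hf.bdd
  have hF' : 0 ≤ F := (norm_nonneg _).trans (hF 0)
  obtain ⟨c, hc, hcl⟩ := hμ.lower
  obtain ⟨L, hL, hLb⟩ := hμ.grad_bdd ρ
  obtain ⟨C1, hC1, hC1b⟩ := comp_deriv (hμ.smooth.differentiable (by simp))
  obtain ⟨B, hB⟩ : ∃ t, t = |A0| * F := ⟨_, rfl⟩
  have hB0 : 0 ≤ B := by rw [hB]; positivity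
  obtain ⟨K1, hK1⟩ : ∃ t, t = C1 * L^2 + C1*M0 + 3 + M0^2 := ⟨_, rfl⟩
  obtain ⟨K2, hK2⟩ : ∃ t, t = 6*B + B*√M0 := ⟨_, rfl⟩
  obtain ⟨K3, hK3⟩ : ∃ t, t = 4*B^2 + 2 + A0^2/(2*(c*ρ)) := ⟨_, rfl⟩
  have k1 : 0 < K1 := by rw [hK1]; positivity
  have k2 : 0 ≤ K2 := by rw [hK2]; positivity
  have k3 : 0 < K3 := by rw [hK3]; positivity
  refine ⟨K1+K2+K3, min 1 (c*ρ), by positivity, by positivity, min_le_left _ _, ?_⟩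
  intro σ a hσ hσ0 ha haA x
  have hσ1 : σ ≤ 1 := hσ0.trans (min_le_left _ _)
  have hσ2 : σ^2 ≤ c*ρ := by
    have := hσ0.trans (min_le_right _ _); nlinarith
  have hε : 0 < σ^3 := by positivity
  have hs : 0 < σ^2 := by positivity
  have hG := Gerr_nonneg μ ρ σ x
  have hAF0 : 0 ≤ a*‖f x‖ := by positivity
  have hAF : a*‖f x‖ ≤ B := by
    rw [hB]; exact mul_le_mul (haA.trans (le_abs_self _)) (hF x) (norm_nonneg _) (abs_nonneg _)
  -- lower bounds for G
  have hGa : ‖x‖ < 2*ρ → 1/(|μ x|+σ^2) ≤ Gerr μ ρ σ x := by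
    intro h
    unfold Gerr
    rw [indicator_of_mem (by simpa using h)]
    have : 0 ≤ (Metric.ball (0:E2) ρ).indicator (fun x => 1/(‖x‖^2+(σ^3)^2)) x :=
      indicator_nonneg (fun y _ => by positivity) _
    linarith
  have hGb : ‖x‖ < ρ → 1/(‖x‖^2+(σ^3)^2) ≤ Gerr μ ρ σ x := by
    intro h
    unfold Gerr
    rw [indicator_of_mem (s := Metric.ball (0:E2) ρ) (by simpa using h)]
    have : 0 ≤ (Metric.ball (0:E2) (2*ρ)).indicator (fun x => 1/(|μ x|+σ^2)) x :=
      indicator_nonneg (fun y _ => by positivity) _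
    linarith
  refine ⟨?_, ?_, ?_, ?_⟩
  · rcases lt_or_ge ‖x‖ ρ with h | h
    · have hm := hμ.pos h
      have hm0 : μ x ≤ M0 := (le_abs_self _).trans (hM0 x)
      have h3 := alg_err3 x hσ hm.le hm0
      rw [norm_w0 μ hσ, max_eq_left hm.le]
      have h4 := (hC1b (σ^2) (σ^3) hs hε x).2.2
      have h4' : gradSq (w0 μ σ) x ≤ C1 * (L^2 * (1/(|μ x|+σ^2)) + M0 * (1/(‖x‖^2+(σ^3)^2))) := by
        refine h4.trans ?_
        rw [mul_one_div, mul_one_div]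
        gcongr
        · exact hLb x h.le
        · exact hM0 x
      have ga := hGa (by linarith)
      have gb := hGb h
      have h5 : gradSq (w0 μ σ) x ≤ C1 * (L^2 * Gerr μ ρ σ x + M0 * Gerr μ ρ σ x) := 
        h4'.trans (by gcongr)
      have h6 : 3/(|μ x|+σ^2) = 3 * (1/(|μ x|+σ^2)) := by ring
      have h7 : M0^2 * (1/(‖x‖^2+(σ^3)^2)) ≤ M0^2 * Gerr μ ρ σ x := by gcongr
      have h8 : 0 ≤ (K2+K3) * Gerr μ ρ σ x := by positivity
      have h9 : 0 ≤ gradSq (w0 μ σ) x := gradSq_nonneg _ _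
      have e : (K1+K2+K3) * Gerr μ ρ σ x = C1 * (L^2 * Gerr μ ρ σ x + M0 * Gerr μ ρ σ x)
        + 3 * Gerr μ ρ σ x + M0^2 * Gerr μ ρ σ x + (K2+K3) * Gerr μ ρ σ x := by rw [hK1]; ring
      rw [e]
      linarith
    · have hm := hμ.nonpos h
      have h1 : w0 μ σ x = 0 := by simp [w0, Qs_zero hs (show μ x ≤ σ^2 by linarith)]
      have h2 : gradSq (w0 μ σ) x = 0 := (hC1b (σ^2) (σ^3) hs hε x).2.1 (by linarith)
      rw [h1, h2, max_eq_right hm]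
      simp
      positivity
  · rcases le_total 0 (μ x) with h | h
    · rw [max_eq_left h]; simp
    · have h1 : w0 μ σ x = 0 := by simp [w0, Qs_zero hs (show μ x ≤ σ^2 by linarith)]
      rw [h1]; simp
  · rcases lt_or_ge ‖x‖ ρ with h | h
    · have hm := hμ.pos h
      have h2 := alg_err2 x hσ hσ1 hAF0 hAF hm.le ((le_abs_self _).trans (hM0 x))
      rw [inner_w0 hf]
      have ga := hGa (by linarith)
      have gb := hGb h
      have h6 : 6*B/(|μ x|+σ^2) = 6*B * (1/(|μ x|+σ^2)) := by ring
      have h7 : 6*B * (1/(|μ x|+σ^2)) ≤ 6*B * Gerr μ ρ σ x := by gcongr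
      have h8 : B * √M0 * (1/(‖x‖^2+(σ^3)^2)) ≤ B * √M0 * Gerr μ ρ σ x := by gcongr
      have h9 : 0 ≤ (K1+K3) * Gerr μ ρ σ x := by positivity
      have h10 : (a/σ^3) * (‖f x‖ * (Qs (σ^2) (μ x) * ‖x‖ * (nrm (σ^3) x)⁻¹)) =
        (a*‖f x‖/σ^3) * (Qs (σ^2) (μ x) * ‖x‖ * (nrm (σ^3) x)⁻¹) := by ring
      rw [h10]
      have e : (K1+K2+K3) * Gerr μ ρ σ x = 6*B * Gerr μ ρ σ x + B * √M0 * Gerr μ ρ σ x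
        + (K1+K3) * Gerr μ ρ σ x := by rw [hK2]; ring
      rw [e]
      linarith
    · have hm := hμ.nonpos h
      have h1 : w0 μ σ x = 0 := by simp [w0, Qs_zero hs (show μ x ≤ σ^2 by linarith)]
      rw [Real.sqrt_eq_zero_of_nonpos hm, h1]
      simp
      positivity
  · intro t ht
    have hf2 : 0 ≤ ‖f x‖^2 := by positivity
    rcases lt_or_ge ‖x‖ (2*ρ) with h | h
    · have h1 := alg_err1 (m := μ x) hσ ht hAF0 hAF
      have ga := hGa h
      have h2 : (4*B^2+2)/(|μ x|+σ^2) = (4*B^2+2) * (1/(|μ x|+σ^2)) := by ring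
      have h3 : (4*B^2+2) * (1/(|μ x|+σ^2)) ≤ (K1+K2+K3) * (Gerr μ ρ σ x + ‖f x‖^2) := by
        apply mul_le_mul _ (by linarith) (by positivity) (by positivity)
        have : 0 ≤ A0^2/(2*(c*ρ)) := by positivity
        rw [hK3]; linarith
      linarith
    · have h1 := hcl x
      rw [min_eq_right (by rw [abs_of_nonneg (by linarith)]; linarith)] at h1
      have hm := hμ.nonpos (show ρ ≤ ‖x‖ by linarith)
      rw [abs_of_nonpos hm] at h1
      have hcρ : 0 < c*ρ := by positivity
      have hm' : μ x < 0 := by linarith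
      have h2 := alg_neg (A := a*‖f x‖) hε hm' ht
      have h3 : (a*‖f x‖)^2/(2*(-μ x)) ≤ (K1+K2+K3) * (Gerr μ ρ σ x + ‖f x‖^2) := by
        calc (a*‖f x‖)^2/(2*(-μ x)) ≤ (A0*‖f x‖)^2/(2*(c*ρ)) := by gcongr
          _ = (A0^2/(2*(c*ρ))) * ‖f x‖^2 := by ring
          _ ≤ _ := by
            apply mul_le_mul _ (by linarith) (by positivity) (by positivity)
            have : 0 ≤ B^2 := by positivity
            rw [hK3]; linarith
      rw [Real.sqrt_eq_zero_of_nonpos hm, max_eq_right hm]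
      have : 0 ≤ (1/(8*(σ^3)^2)) * (t^2 - 0)^2 := by positivity
      simp only [sub_zero, zero_sub] at *
      linarith

lemma integrable_muPlus (hμ : MuHyp μ μrad ρ) : Integrable (fun x => (max (μ x) 0)^2) := by
  have hc : Continuous (fun x => (max (μ x) 0)^2) := by
    have := hμ.smooth.continuous; fun_prop
  apply hc.integrable_of_hasCompactSupport
  apply HasCompactSupport.intro (isCompact_closedBall (0:E2) ρ)
  intro x hx
  have : ρ < ‖x‖ := by simpa using hx
  rw [max_eq_right (hμ.nonpos this.le)]; simp

lemma integrable_pot (hμ : MuHyp μ μrad ρ) {u : E2 → E2} (hu : MemH1 u)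
    (h4 : Integrable (fun x => ‖u x‖^4)) : 
    Integrable (fun x => (‖u x‖^2 - max (μ x) 0)^2) := by
  refine ((h4.add (integrable_muPlus hμ)).const_mul 2).mono' ?_ ?_
  · have := hμ.smooth.continuous
    have := hu.1.continuous
    exact Continuous.aestronglyMeasurable (by fun_prop)
  · filter_upwards with x
    rw [Real.norm_of_nonneg (by positivity)]
    simp only [Pi.add_apply]
    nlinarith [sq_nonneg (‖u x‖^2 + max (μ x) 0)]

lemma memH1_w0 (hμ : MuHyp μ μrad ρ) {σ : ℝ} (hσ : 0 < σ) {C : ℝ} 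
    (hG : Integrable (Gerr μ ρ σ))
    (h : ∀ x, (1/2) * gradSq (w0 μ σ) x + (1/(4*(σ^3)^2)) * (‖w0 μ σ x‖^2 - max (μ x) 0)^2
      ≤ C * Gerr μ ρ σ x) : MemH1 (w0 μ σ) ∧ Integrable (fun x => ‖w0 μ σ x‖^4) := by
  obtain ⟨M0, hM0⟩ := hμ.bdd
  obtain ⟨C1, hC1, hC1b⟩ := comp_deriv (hμ.smooth.differentiable (by simp))
  have hd : Differentiable ℝ (w0 μ σ) := fun x =>
    (hC1b (σ^2) (σ^3) (by positivity) (by positivity) x).1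
  have hz : ∀ x, x ∉ Metric.closedBall (0:E2) ρ → w0 μ σ x = 0 := by
    intro x hx
    have : ρ < ‖x‖ := by simpa using hx
    have hm := hμ.nonpos this.le
    have hs : 0 < σ^2 := by positivity
    simp [w0, Qs_zero hs (show μ x ≤ σ^2 by linarith)]
  have i2 : Integrable (fun x => ‖w0 μ σ x‖^2) := by
    have hc : Continuous (fun x => ‖w0 μ σ x‖^2) := hd.continuous.norm.pow 2
    refine hc.integrable_of_hasCompactSupport
      (HasCompactSupport.intro (isCompact_closedBall (0:E2) ρ) fun x hx => ?_)
    rw [hz x hx]; simp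
  have i4 : Integrable (fun x => ‖w0 μ σ x‖^4) := by
    have hc : Continuous (fun x => ‖w0 μ σ x‖^4) := hd.continuous.norm.pow 4
    refine hc.integrable_of_hasCompactSupport
      (HasCompactSupport.intro (isCompact_closedBall (0:E2) ρ) fun x hx => ?_)
    rw [hz x hx]; simp
  refine ⟨memH1_of_bound hd i2 (hG.const_mul (2*C)) (fun x => le_rfl) fun x => ?_, i4⟩
  have h1 := h x
  have : 0 ≤ (1/(4*(σ^3)^2)) * (‖w0 μ σ x‖^2 - max (μ x) 0)^2 := by positivity
  linarith

set_option maxHeartbeats 1000000 in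
theorem energy_bound (hμ : MuHyp μ μrad ρ) (hf : FHyp f frad) (A0 : ℝ) :
    ∃ C σ0 : ℝ, 0 < C ∧ 0 < σ0 ∧ σ0 ≤ 1 ∧ ∀ σ a : ℝ, 0 < σ → σ ≤ σ0 → 0 ≤ a → a ≤ A0 → 
    ∀ v : E2 → E2, IsMinimizer (σ^3) a μ f v → 
    Integrable (dens (σ^3) a μ f v) ∧ 
    Integrable (fun x => (1/2) * gradSq v x + (1/(8*(σ^3)^2)) * (‖v x‖^2 - max (μ x) 0)^2) ∧
    ∫ x, ((1/2) * gradSq v x + (1/(8*(σ^3)^2)) * (‖v x‖^2 - max (μ x) 0)^2) ≤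
      C * (1 + Real.log (1/σ)) := by
  obtain ⟨C, σ1, hC, hσ1, hσ1', H⟩ := pointwise_bound hμ hf A0
  obtain ⟨D, hD, hGi⟩ := Gerr_int hμ
  set I0 := ∫ x, (max (μ x) 0)^2 with hI0
  have hI0p : 0 < I0 := by
    rw [hI0, integral_pos_iff_support_of_nonneg (fun x => by positivity) (integrable_muPlus hμ)]
    refine lt_of_lt_of_le (Metric.measure_ball_pos volume (0:E2) hμ.rho_pos) (measure_mono ?_)
    intro x hx
    have := hμ.pos (show ‖x‖ < ρ by simpa using hx)
    simp only [Function.mem_support]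
    rw [max_eq_left this.le]; positivity
  set If := ∫ x, ‖f x‖^2 with hIf
  have hIf0 : 0 ≤ If := integral_nonneg fun x => by positivity
  refine ⟨3*C*(D+If), min σ1 (I0/(8*C*D)), by positivity, by positivity,
    (min_le_left _ _).trans hσ1', ?_⟩
  intro σ a hσ hσ0 ha haA v hv
  have hσσ1 := hσ0.trans (min_le_left _ _)
  have hσle1 := hσσ1.trans hσ1'
  have hσ2 : σ ≤ I0/(8*C*D) := hσ0.trans (min_le_right _ _)
  have hε : 0 < σ^3 := by positivity
  obtain ⟨hGint, hGb⟩ := hGi σ hσ hσle1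
  have P := H σ a hσ hσσ1 ha haA
  obtain ⟨hw1, hw4⟩ := memH1_w0 hμ hσ hGint (fun x => (P x).1)
  have hmin := hv.2 _ hw1
  have hwi : Integrable (dens (σ^3) a μ f (w0 μ σ)) := integrable_dens hμ hf _ _ hw1 hw4
  have hlog := log_nonneg' hσ hσle1
  have hneg : energy (σ^3) a μ f (w0 μ σ) < 0 := by
    rw [energy_eq]
    have h1 : ∫ x, dens (σ^3) a μ f (w0 μ σ) x ≤
        ∫ x, (C * Gerr μ ρ σ x - (1/(4*(σ^3)^2)) * (max (μ x) 0)^2) := by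
      apply integral_mono hwi ((hGint.const_mul C).sub ((integrable_muPlus hμ).const_mul _))
      intro x
      change dens (σ^3) a μ f (w0 μ σ) x ≤ C * Gerr μ ρ σ x - (1/(4*(σ^3)^2)) * (max (μ x) 0)^2
      rw [dens_id _ _ hε, (P x).2.1, inner_w0 hf]
      have h2 := (P x).1
      have h3 : 0 ≤ a/σ^3 * (‖f x‖ * (Qs (σ^2) (μ x) * ‖x‖ * (nrm (σ^3) x)⁻¹)) := by
        have := Qs_nonneg (σ^2) (μ x)
        have := nrm_pos hε x
        positivity
      have h4 : (max (μ x) 0)^2/(4*(σ^3)^2) = (1/(4*(σ^3)^2)) * (max (μ x) 0)^2 := by ring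
      rw [zero_div]
      linarith
    refine h1.trans_lt ?_
    rw [integral_sub (hGint.const_mul C) ((integrable_muPlus hμ).const_mul _),
      integral_const_mul, integral_const_mul, ← hI0]
    have h2 : 1 + Real.log (1/σ) ≤ 1/σ := by
      have := Real.log_le_sub_one_of_pos (show 0 < 1/σ by positivity)
      linarith
    have h3 : C * ∫ x, Gerr μ ρ σ x ≤ C * (D * (1/σ)) := by
      apply mul_le_mul_of_nonneg_left _ hC.le
      exact hGb.trans (mul_le_mul_of_nonneg_left h2 hD.le)
    have h4 : C * (D * (1/σ)) < 1/(4*(σ^3)^2) * I0 := by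
      have h5 : σ * (8*C*D) ≤ I0 := by rwa [le_div_iff₀ (by positivity)] at hσ2
      have h6 : C * (D * (1/σ)) ≤ I0/(8*σ^2) := by
        rw [le_div_iff₀ (by positivity)]
        calc C * (D * (1/σ)) * (8*σ^2) = σ * (8*C*D) := by field_simp
          _ ≤ I0 := h5
      refine h6.trans_lt ?_
      rw [one_div_mul_eq_div]
      apply div_lt_div_of_pos_left hI0p (by positivity)
      have : (σ^3)^2 ≤ σ^2 := by
        have : σ^4 ≤ 1 := pow_le_one₀ hσ.le hσle1
        nlinarith [sq_nonneg σ]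
      have : 0 < σ^2 := by positivity
      linarith
    linarith
  have hvi : Integrable (dens (σ^3) a μ f v) := by
    by_contra hcon
    have : energy (σ^3) a μ f v = 0 := by
      rw [energy_eq]; exact integral_undef hcon
    linarith
  have hv4 := integrable_four hμ hf hε hv.1 hvi
  have hLi : Integrable (fun x => (1/2) * gradSq v x + 
      (1/(8*(σ^3)^2)) * (‖v x‖^2 - max (μ x) 0)^2) :=
    (hv.1.integrable_gradSq.const_mul _).add ((integrable_pot hμ hv.1 hv4).const_mul _)
  refine ⟨hvi, hLi, ?_⟩
  have hRi : Integrable (fun x => (dens (σ^3) a μ f v x - dens (σ^3) a μ f (w0 μ σ) x) + 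
      3*C*(Gerr μ ρ σ x + ‖f x‖^2)) :=
    (hvi.sub hwi).add ((hGint.add hf.integrable_sq).const_mul (3*C))
  have hle : ∫ x, ((1/2) * gradSq v x + (1/(8*(σ^3)^2)) * (‖v x‖^2 - max (μ x) 0)^2) ≤
      ∫ x, ((dens (σ^3) a μ f v x - dens (σ^3) a μ f (w0 μ σ) x) + 
      3*C*(Gerr μ ρ σ x + ‖f x‖^2)) := by
    apply integral_mono hLi hRi
    intro x
    simp only
    obtain ⟨p1, p2, p3, p4⟩ := P x
    have p5 := p4 ‖v x‖ (norm_nonneg _)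
    rw [dens_id _ _ hε, dens_id _ _ hε, p2]
    have hin : (a/σ^3) * (inner ℝ (f x) (v x) : ℝ) ≤ (a*‖f x‖/σ^3) * ‖v x‖ := by
      have := real_inner_le_norm (f x) (v x)
      calc (a/σ^3) * (inner ℝ (f x) (v x) : ℝ) ≤ (a/σ^3) * (‖f x‖ * ‖v x‖) := by gcongr
        _ = _ := by ring
    have hf2 : 0 ≤ C * ‖f x‖^2 := by positivity
    have h8 : (1/(4*(σ^3)^2)) * (‖v x‖^2 - max (μ x) 0)^2 = 
      2 * ((1/(8*(σ^3)^2)) * (‖v x‖^2 - max (μ x) 0)^2) := by field_simp; ring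
    rw [h8, zero_div]
    have e1 : (a*‖f x‖/σ^3) * (‖v x‖ - √(μ x)) = (a*‖f x‖/σ^3) * ‖v x‖ - (a*‖f x‖/σ^3) * √(μ x) := by
      ring
    rw [e1] at p5
    have e2 : C * (Gerr μ ρ σ x + ‖f x‖^2) = C * Gerr μ ρ σ x + C * ‖f x‖^2 := by ring
    have e3 : 3*C*(Gerr μ ρ σ x + ‖f x‖^2) = 3*(C * Gerr μ ρ σ x) + 3*(C * ‖f x‖^2) := by ring
    rw [e2] at p5
    rw [e3]
    linarith
  refine hle.trans ?_
  have hGf : Integrable (fun x => Gerr μ ρ σ x + ‖f x‖^2) := hGint.add hf.integrable_sq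
  have hvw : Integrable (fun x => dens (σ^3) a μ f v x - dens (σ^3) a μ f (w0 μ σ) x) :=
    hvi.sub hwi
  rw [integral_add hvw (hGf.const_mul (3*C)),
    integral_sub hvi hwi, integral_const_mul, integral_add hGint hf.integrable_sq,
    ← energy_eq, ← energy_eq, ← hIf]
  have : 3*C*((∫ x, Gerr μ ρ σ x) + If) ≤ 3*C*(D+If) * (1 + Real.log (1/σ)) := by
    rw [mul_assoc (3*C)]
    apply mul_le_mul_of_nonneg_left _ (by positivity)
    nlinarith
  linarith

end eb

/-- Cutoff used for the a priori sup bound. -/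
def cutB (z : ℝ) : ℝ := 1 - (1/4) * ((max (z-1) 0)^2 / (1 + (max (z-1) 0)^2))

lemma cutB_deriv (z : ℝ) : HasDerivAt cutB
    (-((max (z-1) 0) / (2*(1 + (max (z-1) 0)^2)^2))) z := by
  have h1 : HasDerivAt (fun z : ℝ => (max (z-1) 0)^2) (2 * max (z-1) 0) z := by
    have := (hasDerivAt_posSq (z-1)).comp z ((hasDerivAt_id z).sub_const 1)
    refine HasDerivAt.congr_deriv this ?_
    ring
  have hne : 1 + (max (z-1) 0)^2 ≠ 0 := by positivity
  have h2 := ((h1.div (h1.const_add 1) hne).const_mul (1/4)).const_sub 1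
  refine HasDerivAt.congr_deriv h2 ?_
  field_simp
  ring

lemma cutB_nonneg (z : ℝ) : 3/4 ≤ cutB z := by
  unfold cutB
  have : (max (z-1) 0)^2 / (1 + (max (z-1) 0)^2) ≤ 1 := by
    rw [div_le_one (by positivity)]; linarith
  linarith

lemma cutB_le (z : ℝ) : cutB z ≤ 1 := by
  unfold cutB
  have : 0 ≤ (max (z-1) 0)^2 / (1 + (max (z-1) 0)^2) := by positivity
  linarith

lemma cutB_lt {z : ℝ} (h : 1 < z) : cutB z < 1 := by
  unfold cutB
  rw [max_eq_left (by linarith)]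
  have h1 : 0 < z - 1 := by linarith
  have : 0 < (z-1)^2 / (1 + (z-1)^2) := by positivity
  linarith

lemma cutB_mono (z : ℝ) : 0 ≤ cutB z + z * (-((max (z-1) 0) / (2*(1 + (max (z-1) 0)^2)^2))) := by
  have h1 := cutB_nonneg z
  rcases le_total z 1 with h | h
  · rw [max_eq_right (by linarith)]; simp; linarith
  · rw [max_eq_left (by linarith)]
    have : z * ((z-1) / (2*(1 + (z-1)^2)^2)) ≤ 3/4 := by
      rw [← mul_div_assoc, div_le_iff₀ (by positivity)]
      nlinarith [sq_nonneg (z-1-1), sq_nonneg (z-1), sq_nonneg ((z-1)^2)]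
    linarith

lemma radial_fderiv {v : E2 → E2} {x : E2} (hv : DifferentiableAt ℝ v x) {g : ℝ → ℝ} {g' : ℝ}
    (hg : HasDerivAt g g' (‖v x‖^2)) :
    HasFDerivAt (fun x => g (‖v x‖^2) • v x) (g (‖v x‖^2) • fderiv ℝ v x +
      (g' • (2 • (innerSL ℝ (v x)).comp (fderiv ℝ v x))).smulRight (v x)) x := by
  have h1 : HasFDerivAt (fun x => g (‖v x‖^2)) _ x :=
    hg.comp_hasFDerivAt x hv.hasFDerivAt.norm_sq
  exact h1.smul hv.hasFDerivAt

lemma radial_gradSq {v : E2 → E2} {x : E2} (hv : DifferentiableAt ℝ v x) {g : ℝ → ℝ} {g' : ℝ}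
    (hg : HasDerivAt g g' (‖v x‖^2)) (h0 : 0 ≤ g (‖v x‖^2)) (h1 : g (‖v x‖^2) ≤ 1)
    (h2 : g' ≤ 0) (h3 : 0 ≤ g (‖v x‖^2) + ‖v x‖^2 * g') :
    gradSq (fun x => g (‖v x‖^2) • v x) x ≤ gradSq v x := by
  unfold gradSq
  rw [(radial_fderiv hv hg).fderiv]
  apply Finset.sum_le_sum
  intro i _
  set h := fderiv ℝ v x (e2basis i)
  have e : (g (‖v x‖^2) • fderiv ℝ v x +
      (g' • (2 • (innerSL ℝ (v x)).comp (fderiv ℝ v x))).smulRight (v x)) (e2basis i)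
      = g (‖v x‖^2) • h + (2 * g' * (inner ℝ (v x) h : ℝ)) • v x := by
    simp [h]; ring_nf
  rw [e, norm_add_sq_real, norm_smul, norm_smul, inner_smul_left, inner_smul_right, mul_pow, mul_pow,
    Real.norm_eq_abs, Real.norm_eq_abs, sq_abs, sq_abs, real_inner_comm (v x) h]
  simp only [conj_trivial]
  set B := g (‖v x‖^2)
  set p : ℝ := inner ℝ (v x) h
  have k1 : B^2 * ‖h‖^2 ≤ ‖h‖^2 := by
    have : B^2 ≤ 1 := pow_le_one₀ h0 h1
    nlinarith [sq_nonneg ‖h‖]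
  have k2 : 4 * g' * p^2 * (B + ‖v x‖^2 * g') ≤ 0 := by
    apply mul_nonpos_of_nonpos_of_nonneg _ h3
    nlinarith [sq_nonneg p]
  nlinarith

section sb
variable {μ : E2 → ℝ} {μrad : ℝ → ℝ} {ρ : ℝ} {f : E2 → E2} {frad : ℝ → ℝ}

lemma pot_alg {ε a m t B p M0 K M : ℝ} (hε : 0 < ε) (hε1 : ε ≤ 1) (hm : m ≤ M0) (hM0 : 0 ≤ M0)
    (hK : 0 ≤ K) (hp : a * p ≤ K * t) (hB0 : 0 ≤ B) (hB1 : B ≤ 1) (hM : 4*(M0+K)+4 ≤ M)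
    (ht : M < t) :
    (1-B) * (1/ε^2) ≤ (-(1/(2*ε^2)) * m * t^2 + (1/(4*ε^2)) * t^4 - (a/ε) * p) -
      (-(1/(2*ε^2)) * m * (B*t)^2 + (1/(4*ε^2)) * (B*t)^4 - (a/ε) * (B*p)) := by
  have e : (-(1/(2*ε^2)) * m * t^2 + (1/(4*ε^2)) * t^4 - (a/ε) * p) -
      (-(1/(2*ε^2)) * m * (B*t)^2 + (1/(4*ε^2)) * (B*t)^4 - (a/ε) * (B*p)) =
      (1-B) * ((1/ε^2) * ((1+B)*(1+B^2)*t^4/4 - m*(1+B)*t^2/2 - ε*(a*p))) := by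
    field_simp; ring
  rw [e]
  apply mul_le_mul_of_nonneg_left _ (by linarith)
  apply le_mul_of_one_le_right (by positivity)
  have ht1 : 4 ≤ t := by linarith
  have h1 : m*(1+B)*t^2/2 ≤ M0 * t^2 := by
    have : m*(1+B) ≤ M0 * 2 := by nlinarith
    nlinarith [sq_nonneg t]
  have h2 : ε*(a*p) ≤ K*t := by
    have : 0 ≤ K*t := by positivity
    nlinarith
  have h3 : t^4/4 ≤ (1+B)*(1+B^2)*t^4/4 := by
    have : 1 ≤ (1+B)*(1+B^2) := by nlinarith [sq_nonneg B, mul_nonneg hB0 (sq_nonneg B)]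
    have : 0 ≤ t^4 := by positivity
    nlinarith
  have h4 : t^2 * (4*(M0+K)+4) ≤ t^2 * t^2 := by
    apply mul_le_mul_of_nonneg_left _ (by positivity)
    nlinarith
  have h5 : K*t ≤ K*t^2 := mul_le_mul_of_nonneg_left (by nlinarith) hK
  nlinarith

set_option maxHeartbeats 1000000 in
theorem sup_bound (hμ : MuHyp μ μrad ρ) (hf : FHyp f frad) (A0 : ℝ) :
    ∃ M : ℝ, 1 ≤ M ∧ ∀ ε a : ℝ, 0 < ε → ε ≤ 1 → 0 ≤ a → a ≤ A0 → 
    ∀ v : E2 → E2, IsMinimizer ε a μ f v → Integrable (dens ε a μ f v) → ∀ x, ‖v x‖ ≤ M := by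
  obtain ⟨M0, hM0⟩ := hμ.bdd
  have hM0' : 0 ≤ M0 := (abs_nonneg _).trans (hM0 0)
  obtain ⟨F, hF⟩ := hf.bdd
  have hF' : 0 ≤ F := (norm_nonneg _).trans (hF 0)
  obtain ⟨M, hMdef⟩ : ∃ M, M = 4*(M0+|A0| * F)+4 := ⟨_, rfl⟩
  have hM4 : 4 ≤ M := by rw [hMdef]; have : 0 ≤ |A0| * F := by positivity
                         linarith
  have hMp : 0 < M := by linarith
  refine ⟨M, by linarith, fun ε a hε hε1 ha haA v hv hvi => ?_⟩
  have hvd := hv.1.1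
  set g : ℝ → ℝ := fun q => cutB (q/M^2) with hgdef
  have hg : ∀ q, HasDerivAt g (-((max (q/M^2-1) 0) / (2*(1 + (max (q/M^2-1) 0)^2)^2)) * (1/M^2)) q :=
    fun q => HasDerivAt.comp (h₂ := cutB) (h := fun q => q/M^2) q (cutB_deriv (q/M^2))
      ((hasDerivAt_id q).div_const (M^2))
  set w : E2 → E2 := fun x => g (‖v x‖^2) • v x with hw
  have hwd : Differentiable ℝ w := fun x => (radial_fderiv (hvd x) (hg _)).differentiableAt
  have hg0 : ∀ q, 0 ≤ g q := fun q => by have := cutB_nonneg (q/M^2); simp only [hgdef]; linarith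
  have hg1 : ∀ q, g q ≤ 1 := fun q => cutB_le _
  have hgr : ∀ x, gradSq w x ≤ gradSq v x := by
    intro x
    apply radial_gradSq (hvd x) (hg _) (hg0 _) (hg1 _)
    · have : 0 ≤ max (‖v x‖^2/M^2-1) 0 := le_max_right _ _
      have h : 0 ≤ (max (‖v x‖^2/M^2-1) 0) / (2*(1 + (max (‖v x‖^2/M^2-1) 0)^2)^2) := by positivity
      have h2 : 0 ≤ 1/M^2 := by positivity
      nlinarith
    · have := cutB_mono (‖v x‖^2/M^2)
      have e : ‖v x‖^2 * (-((max (‖v x‖^2/M^2-1) 0) / (2*(1 + (max (‖v x‖^2/M^2-1) 0)^2)^2)) * (1/M^2))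
       = ‖v x‖^2/M^2 * (-((max (‖v x‖^2/M^2-1) 0) / (2*(1 + (max (‖v x‖^2/M^2-1) 0)^2)^2))) := by ring
      rw [e]; exact this
  have hwn : ∀ x, ‖w x‖ = g (‖v x‖^2) * ‖v x‖ := fun x => by
    simp only [hw]; rw [norm_smul, Real.norm_of_nonneg (hg0 _)]
  have hwle : ∀ x, ‖w x‖ ≤ ‖v x‖ := fun x => by
    rw [hwn]; exact mul_le_of_le_one_left (norm_nonneg _) (hg1 _)
  have hwH : MemH1 w := memH1_of_bound hwd hv.1.integrable_sq hv.1.integrable_gradSq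
    (fun x => pow_le_pow_left₀ (norm_nonneg _) (hwle x) 2) hgr
  have hv4 := integrable_four hμ hf hε hv.1 hvi
  have hw4 : Integrable (fun x => ‖w x‖^4) := by
    refine hv4.mono' (hwd.continuous.norm.pow 4).aestronglyMeasurable ?_
    filter_upwards with x
    rw [Real.norm_of_nonneg (by positivity)]
    exact pow_le_pow_left₀ (norm_nonneg _) (hwle x) 4
  have hwi := integrable_dens hμ hf ε a hwH hw4
  have hmin := hv.2 w hwH
  rw [energy_eq, energy_eq] at hmin
  have hbig : ∀ x, M < ‖v x‖ → dens ε a μ f w x < dens ε a μ f v x := by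
    intro x hx
    have h1 := pot_alg (a := a) (m := μ x) (p := (inner ℝ (f x) (v x) : ℝ)) (M0 := M0)
      (K := |A0| * F) (B := g (‖v x‖^2)) hε hε1 ((le_abs_self _).trans (hM0 x)) hM0' (by positivity)
      (by
        have h1 := real_inner_le_norm (f x) (v x)
        calc a * (inner ℝ (f x) (v x) : ℝ) ≤ a * (‖f x‖ * ‖v x‖) := by gcongr
          _ ≤ |A0| * (F * ‖v x‖) := by
            gcongr
            · exact haA.trans (le_abs_self _)
            · exact hF x
          _ = _ := by ring) (hg0 _) (hg1 _) hMdef.ge hx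
    have h2 : g (‖v x‖^2) < 1 := by
      apply cutB_lt
      rw [lt_div_iff₀ (by positivity), one_mul]
      exact pow_lt_pow_left₀ hx hMp.le (by norm_num)
    have h3 : 0 < (1 - g (‖v x‖^2)) * (1/ε^2) := by
      have : 0 < 1 - g (‖v x‖^2) := by linarith
      positivity
    have h4 := hgr x
    have h5 : (inner ℝ (f x) (w x) : ℝ) = g (‖v x‖^2) * (inner ℝ (f x) (v x) : ℝ) := by
      simp only [hw]; rw [inner_smul_right]
    unfold dens
    rw [hwn, h5]
    linarith
  have hle : ∀ x, dens ε a μ f w x ≤ dens ε a μ f v x := by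
    intro x
    rcases lt_or_ge M ‖v x‖ with h | h
    · exact (hbig x h).le
    · have e : w x = v x := by
        have : g (‖v x‖^2) = 1 := by
          simp only [hgdef, cutB]
          rw [max_eq_right]
          · simp
          · rw [sub_nonpos, div_le_one (by positivity)]
            exact pow_le_pow_left₀ (norm_nonneg _) h 2
        simp only [hw]
        rw [this, one_smul]
      unfold dens
      rw [e]
      linarith [hgr x]
  have hae : (fun x => dens ε a μ f v x - dens ε a μ f w x) =ᵐ[volume] 0 := by
    rw [← integral_eq_zero_iff_of_nonneg (fun x => sub_nonneg.2 (hle x)) (hvi.sub hwi)]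
    apply le_antisymm
    · have := integral_sub hvi hwi
      linarith
    · exact integral_nonneg (fun x => sub_nonneg.2 (hle x))
  by_contra hcon
  push Not at hcon
  obtain ⟨x, hx⟩ := hcon
  have hopen : IsOpen {x | M < ‖v x‖} := isOpen_lt continuous_const hvd.continuous.norm
  have hpos := hopen.measure_pos volume ⟨x, hx⟩
  have hnull : volume {x | M < ‖v x‖} = 0 := by
    refine measure_mono_null ?_ (ae_iff.1 hae)
    intro y hy
    have := hbig y hy
    simp only [Set.mem_ofPred_eq, Pi.zero_apply]
    intro h0
    linarith
  exact hpos.ne' hnull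

end sb


/-! ### Weak Euler–Lagrange equation -/

section weakel
variable {μ : E2 → ℝ} {μrad : ℝ → ℝ} {ρ : ℝ} {f : E2 → E2} {frad : ℝ → ℝ}

lemma memH1_cs {ψ : E2 → E2} (h1 : ContDiff ℝ 1 ψ) (hc : HasCompactSupport ψ) : MemH1 ψ := by
  have hcf : Continuous (fderiv ℝ ψ) := h1.continuous_fderiv (by norm_num)
  refine memH1_of_bound (h1.differentiable (by norm_num)) (g := fun x => ‖ψ x‖^2)
    (g' := fun x => 2 * ‖fderiv ℝ ψ x‖^2) ?_ ?_ (fun x => le_rfl) (fun x => gradSq_le ψ x)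
  · refine Continuous.integrable_of_hasCompactSupport (by have := h1.continuous; fun_prop) ?_
    exact hc.comp_left (g := fun z : E2 => ‖z‖^2) (by simp)
  · refine Continuous.integrable_of_hasCompactSupport (by fun_prop) ?_
    exact (hc.fderiv ℝ).comp_left (g := fun z : E2 →L[ℝ] E2 => 2 * ‖z‖^2) (by simp)

lemma fderiv_pert {v ψ : E2 → E2} (hv : Differentiable ℝ v) (hψ : Differentiable ℝ ψ) (h : ℝ) (x : E2) :
    fderiv ℝ (fun y => v y + h • ψ y) x = fderiv ℝ v x + h • fderiv ℝ ψ x :=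
  ((hv x).hasFDerivAt.add ((hψ x).hasFDerivAt.const_smul h)).fderiv

lemma gradSq_pert {v ψ : E2 → E2} (hv : Differentiable ℝ v) (hψ : Differentiable ℝ ψ) (h : ℝ) (x : E2) :
    gradSq (fun y => v y + h • ψ y) x = gradSq v x + 2 * h * gradInner v ψ x + h^2 * gradSq ψ x := by
  unfold gradSq gradInner
  simp only [fderiv_pert hv hψ, Fin.sum_univ_two, ContinuousLinearMap.add_apply,
    ContinuousLinearMap.smul_apply, norm_add_sq_real, inner_smul_right, norm_smul, mul_pow,
    Real.norm_eq_abs, sq_abs]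
  ring

lemma abs_gradInner_le (v ψ : E2 → E2) (x : E2) :
    |gradInner v ψ x| ≤ gradSq v x + gradSq ψ x := by
  unfold gradSq gradInner
  simp only [Fin.sum_univ_two]
  have h : ∀ i : Fin 2, |(inner ℝ (fderiv ℝ v x (e2basis i)) (fderiv ℝ ψ x (e2basis i)) : ℝ)|
      ≤ ‖fderiv ℝ v x (e2basis i)‖^2 + ‖fderiv ℝ ψ x (e2basis i)‖^2 := by
    intro i
    have := abs_real_inner_le_norm (fderiv ℝ v x (e2basis i)) (fderiv ℝ ψ x (e2basis i))
    nlinarith [sq_nonneg (‖fderiv ℝ v x (e2basis i)‖ - ‖fderiv ℝ ψ x (e2basis i)‖),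
      sq_nonneg (‖fderiv ℝ v x (e2basis i)‖), sq_nonneg (‖fderiv ℝ ψ x (e2basis i)‖)]
  have h0 := h 0
  have h1 := h 1
  refine (abs_add_le _ _).trans ?_
  linarith

lemma measurable_gradInner (v ψ : E2 → E2) : Measurable (gradInner v ψ) := by
  unfold gradInner
  apply Finset.measurable_sum
  intro i _
  exact (measurable_fderiv_apply_const ℝ v _).inner (measurable_fderiv_apply_const ℝ ψ _)

lemma integrable_gradInner {v ψ : E2 → E2} (hv : MemH1 v) (hψ : MemH1 ψ) :
    Integrable (gradInner v ψ) := by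
  refine (hv.integrable_gradSq.add hψ.integrable_gradSq).mono'
    (measurable_gradInner v ψ).aestronglyMeasurable ?_
  filter_upwards with x
  exact abs_gradInner_le v ψ x

lemma memH1_pert {v ψ : E2 → E2} (hv : MemH1 v) (hψ : MemH1 ψ) (h : ℝ) :
    MemH1 (fun y => v y + h • ψ y) := by
  refine memH1_of_bound (hv.1.add (hψ.1.const_smul h))
    ((hv.integrable_sq.const_mul 2).add (hψ.integrable_sq.const_mul (2*h^2)))
    ((hv.integrable_gradSq.add ((integrable_gradInner hv hψ).const_mul (2*h))).add
      (hψ.integrable_gradSq.const_mul (h^2))) (fun x => ?_) (fun x => ?_)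
  · simp only [Pi.add_apply]
    rw [norm_add_sq_real, inner_smul_right, norm_smul, mul_pow, Real.norm_eq_abs, sq_abs]
    have := norm_sub_sq_real (v x) (h • ψ x)
    rw [inner_smul_right, norm_smul, mul_pow, Real.norm_eq_abs, sq_abs] at this
    nlinarith [sq_nonneg (‖v x - h • ψ x‖)]
  · rw [gradSq_pert hv.1 hψ.1]
    simp [mul_assoc]

lemma pert_alg {ε a m b q c g1 g2 fi h A B M0 M : ℝ} (hε : 0 < ε) (hh : |h| ≤ 1) (hm : |m| ≤ M0)
    (hq : q ≤ M^2) (hq0 : 0 ≤ q) (hM : 0 ≤ M) (hc : 0 ≤ c) (hcB : c ≤ B^2) (hB : 0 ≤ B) (hb : b^2 ≤ q * c) :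
    (1/2)*(A + 2*h*g1 + h^2*g2) - (1/(2*ε^2))*m*(q+2*h*b+h^2*c) + (1/(4*ε^2))*(q+2*h*b+h^2*c)^2
      - (a/ε)*(fi + h * g) - ((1/2)*A - (1/(2*ε^2))*m*q + (1/(4*ε^2))*q^2 - (a/ε)*fi)
    ≤ h * (g1 - (1/ε^2)*m*b + (1/ε^2)*q*b - (a/ε)*g) +
      h^2 * ((1/2)*g2 + (1/(4*ε^2))*(2*M0+6*M^2+4*M*B+B^2)*c) := by
  have hh2 := abs_le.1 hh
  have hbb : |b| ≤ M * B := by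
    apply abs_le_of_sq_le_sq _ (by positivity)
    rw [mul_pow]; exact hb.trans (mul_le_mul hq hcB hc (by positivity))
  have e1 : -m * c ≤ M0 * c := mul_le_mul_of_nonneg_right ((neg_le_abs m).trans hm) hc
  have e2 : 4*b^2 + 2*q*c ≤ 6*M^2*c := by nlinarith
  have e3 : h * b ≤ M * B := by
    refine (le_abs_self _).trans ?_
    rw [abs_mul]; nlinarith [abs_nonneg h, abs_nonneg b]
  have e4 : h*b*c ≤ M*B*c := mul_le_mul_of_nonneg_right e3 hc
  have e5 : h^2*c^2 ≤ B^2*c := by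
    have : h^2 ≤ 1 := by rw [← sq_abs]; nlinarith [abs_nonneg h]
    have : h^2 * c ≤ B^2 := by nlinarith
    nlinarith
  have key : (1/(4*ε^2)) * h^2 * (-2*m*c + (4*b^2+2*q*c) + 4*(h*b*c) + h^2*c^2) ≤
      (1/(4*ε^2)) * h^2 * ((2*M0+6*M^2+4*M*B+B^2)*c) := by
    apply mul_le_mul_of_nonneg_left _ (by positivity)
    linarith
  have id : (1/2)*(A + 2*h*g1 + h^2*g2) - (1/(2*ε^2))*m*(q+2*h*b+h^2*c) + (1/(4*ε^2))*(q+2*h*b+h^2*c)^2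
      - (a/ε)*(fi + h * g) - ((1/2)*A - (1/(2*ε^2))*m*q + (1/(4*ε^2))*q^2 - (a/ε)*fi)
    = h * (g1 - (1/ε^2)*m*b + (1/ε^2)*q*b - (a/ε)*g) + h^2*((1/2)*g2) +
      (1/(4*ε^2)) * h^2 * (-2*m*c + (4*b^2+2*q*c) + 4*(h*b*c) + h^2*c^2) := by
    field_simp; ring
  rw [id]
  have : h^2 * ((1/2)*g2 + (1/(4*ε^2))*(2*M0+6*M^2+4*M*B+B^2)*c) = h^2*((1/2)*g2) +
    (1/(4*ε^2)) * h^2 * ((2*M0+6*M^2+4*M*B+B^2)*c) := by ring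
  rw [this]; linarith

set_option maxHeartbeats 1000000 in
lemma weak_el (hμ : MuHyp μ μrad ρ) (hf : FHyp f frad) {ε a : ℝ} (hε : 0 < ε) {v : E2 → E2}
    (hmin : IsMinimizer ε a μ f v) {M : ℝ} (hM0 : 0 ≤ M) (hM : ∀ x, ‖v x‖ ≤ M)
    {ψ : E2 → E2} (h1 : ContDiff ℝ 1 ψ) (hc : HasCompactSupport ψ) :
    ∫ x, gradInner v ψ x = ∫ x, ((1/ε^2)*μ x*(inner ℝ (v x) (ψ x) : ℝ) -
      (1/ε^2)*‖v x‖^2*(inner ℝ (v x) (ψ x) : ℝ) + (a/ε)*(inner ℝ (f x) (ψ x) : ℝ)) := by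
  obtain ⟨M0, hM0'⟩ := hμ.bdd
  have hψ := memH1_cs h1 hc
  obtain ⟨B, hB⟩ : ∃ B, ∀ x, ‖ψ x‖ ≤ B := by
    obtain ⟨B, hB⟩ := hc.exists_bound_of_continuous h1.continuous
    exact ⟨B, hB⟩
  have hB0 : 0 ≤ B := (norm_nonneg _).trans (hB 0)
  have hv := hmin.1
  have i1 := integrable_gradInner hv hψ
  have i2 : Integrable (fun x => ((1/ε^2)*μ x*(inner ℝ (v x) (ψ x) : ℝ) -
      (1/ε^2)*‖v x‖^2*(inner ℝ (v x) (ψ x) : ℝ) + (a/ε)*(inner ℝ (f x) (ψ x) : ℝ))) := by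
    apply Continuous.integrable_of_hasCompactSupport
    · have := hv.1.continuous
      have := h1.continuous
      have := hμ.smooth.continuous
      have := hf.smooth.continuous
      fun_prop
    · apply hc.mono
      intro x hx hx'
      apply hx
      simp [hx']
  have i3 : Integrable (fun x => ((1/2)*gradSq ψ x + (1/(4*ε^2))*(2*M0+6*M^2+4*M*B+B^2)*‖ψ x‖^2)) :=
    (hψ.integrable_gradSq.const_mul _).add (hψ.integrable_sq.const_mul _)
  have i4 : Integrable (fun x => gradInner v ψ x - ((1/ε^2)*μ x*(inner ℝ (v x) (ψ x) : ℝ) -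
      (1/ε^2)*‖v x‖^2*(inner ℝ (v x) (ψ x) : ℝ) + (a/ε)*(inner ℝ (f x) (ψ x) : ℝ))) := i1.sub i2
  obtain ⟨L, hL⟩ : ∃ L, L = ∫ x, (gradInner v ψ x - ((1/ε^2)*μ x*(inner ℝ (v x) (ψ x) : ℝ) -
      (1/ε^2)*‖v x‖^2*(inner ℝ (v x) (ψ x) : ℝ) + (a/ε)*(inner ℝ (f x) (ψ x) : ℝ))) := ⟨_, rfl⟩
  obtain ⟨R, hR⟩ : ∃ R, R = ∫ x, ((1/2)*gradSq ψ x + (1/(4*ε^2))*(2*M0+6*M^2+4*M*B+B^2)*‖ψ x‖^2) := ⟨_, rfl⟩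
  have key : ∀ h : ℝ, |h| ≤ 1 → 0 ≤ h * L + h^2 * R := by
    intro h hh
    have hu := memH1_pert hv hψ h
    have d1 := integrable_dens hμ hf ε a hu (integrable_four_of_bdd hu (M := M + B) (fun x => by
      refine (norm_add_le _ _).trans (add_le_add (hM x) ?_)
      rw [norm_smul]
      have := hB x
      have := norm_nonneg (ψ x)
      have : ‖h‖ ≤ 1 := hh
      nlinarith))
    have d0 := integrable_dens hμ hf ε a hv (integrable_four_of_bdd hv hM)
    have hE := hmin.2 _ hu
    rw [energy_eq, energy_eq] at hE
    have hle : ∫ x, (dens ε a μ f (fun y => v y + h • ψ y) x - dens ε a μ f v x) ≤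
      ∫ x, (h * (gradInner v ψ x - ((1/ε^2)*μ x*(inner ℝ (v x) (ψ x) : ℝ) -
      (1/ε^2)*‖v x‖^2*(inner ℝ (v x) (ψ x) : ℝ) + (a/ε)*(inner ℝ (f x) (ψ x) : ℝ))) +
      h^2 * ((1/2)*gradSq ψ x + (1/(4*ε^2))*(2*M0+6*M^2+4*M*B+B^2)*‖ψ x‖^2)) := by
      apply integral_mono (d1.sub d0) ((i4.const_mul h).add (i3.const_mul (h^2)))
      intro x
      have n1 : ‖v x + h • ψ x‖^2 = ‖v x‖^2 + 2*h*(inner ℝ (v x) (ψ x) : ℝ) + h^2*‖ψ x‖^2 := by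
        rw [norm_add_sq_real, inner_smul_right, norm_smul, mul_pow, Real.norm_eq_abs, sq_abs]; ring
      have n2 : ‖v x + h • ψ x‖^4 = (‖v x‖^2 + 2*h*(inner ℝ (v x) (ψ x) : ℝ) + h^2*‖ψ x‖^2)^2 := by
        rw [← n1]; ring
      have n3 : ‖v x‖^4 = (‖v x‖^2)^2 := by ring
      have := pert_alg (a := a) (A := gradSq v x) (g1 := gradInner v ψ x) (g2 := gradSq ψ x)
        (fi := (inner ℝ (f x) (v x) : ℝ)) (g := (inner ℝ (f x) (ψ x) : ℝ)) hε hh (hM0' x)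
        (pow_le_pow_left₀ (norm_nonneg _) (hM x) 2) (by positivity) hM0 (by positivity : 0 ≤ ‖ψ x‖^2)
        (pow_le_pow_left₀ (norm_nonneg _) (hB x) 2) hB0 (b := (inner ℝ (v x) (ψ x) : ℝ)) (by
          rw [← mul_pow, ← sq_abs]
          exact pow_le_pow_left₀ (abs_nonneg _) (abs_real_inner_le_norm _ _) 2)
      simp only [Pi.sub_apply, Pi.add_apply, dens, gradSq_pert hv.1 hψ.1, inner_add_right, inner_smul_right]
      rw [n1, n2, n3]
      refine this.trans (le_of_eq ?_)
      ring
    rw [integral_sub d1 d0, integral_add (i4.const_mul h) (i3.const_mul (h^2)),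
      integral_const_mul, integral_const_mul] at hle
    rw [← hL, ← hR] at hle
    linarith
  have hL0 : L = 0 := by
    by_contra hne
    have hLp : 0 < |L| := abs_pos.2 hne
    obtain ⟨t, ht⟩ : ∃ t, t = min 1 (|L| / (2*(|R|+1))) := ⟨_, rfl⟩
    have ht0 : 0 < t := by rw [ht]; exact lt_min one_pos (by positivity)
    have ht1 : t ≤ 1 := by rw [ht]; exact min_le_left _ _
    have ht2 : t * (2*(|R|+1)) ≤ |L| := by
      rw [← le_div_iff₀ (by positivity), ht]; exact min_le_right _ _
    have hRR : t^2 * R ≤ t^2 * |R| := mul_le_mul_of_nonneg_left (le_abs_self R) (by positivity)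
    have hcon : t * |L| ≤ t^2 * |R| := by
      rcases le_total 0 L with h0 | h0
      · have := key (-t) (by rw [abs_neg, abs_of_pos ht0]; exact ht1)
        rw [abs_of_nonneg h0]; nlinarith
      · have := key t (by rw [abs_of_pos ht0]; exact ht1)
        rw [abs_of_nonpos h0]; nlinarith
    have : |L| ≤ t * |R| := by
      have : t * |L| ≤ t * (t*|R|) := by linarith [hcon, sq t, mul_assoc t t (|R|)]
      exact le_of_mul_le_mul_left this ht0
    nlinarith [abs_nonneg R]
  rw [hL, integral_sub i1 i2] at hL0
  linarith

end weakel


/-! ### Equicontinuity at scale `ε` -/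

def pker (x0 : E2) (t : ℝ) (z : E2) : ℝ := max (1 - ‖z - x0‖^2 / t^2) 0
def kker (x0 : E2) (t : ℝ) (z : E2) : ℝ := 6 / t^2 * (pker x0 t z)^2
def lker (x0 : E2) (t : ℝ) (z : E2) : ℝ :=
  -12 / t^3 * (pker x0 t z)^2 + 24 / t^5 * pker x0 t z * ‖z - x0‖^2

lemma pker_nonneg (x0 : E2) (t : ℝ) (z : E2) : 0 ≤ pker x0 t z := le_max_right _ _

lemma pker_le_one (x0 : E2) (t : ℝ) (z : E2) : pker x0 t z ≤ 1 := by
  unfold pker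
  apply max_le _ zero_le_one
  have : 0 ≤ ‖z - x0‖^2 / t^2 := by positivity
  linarith

lemma pker_zero {x0 : E2} {t : ℝ} (ht : 0 < t) {z : E2} (hz : t ≤ ‖z - x0‖) : pker x0 t z = 0 := by
  unfold pker
  apply max_eq_right
  have : 1 ≤ ‖z - x0‖^2 / t^2 := by
    rw [le_div_iff₀ (by positivity), one_mul]
    exact pow_le_pow_left₀ ht.le hz 2
  linarith

lemma pker_cont (x0 : E2) (t : ℝ) : Continuous (pker x0 t) := by
  unfold pker; fun_prop

lemma pker_cs (x0 : E2) {t : ℝ} (ht : 0 < t) : HasCompactSupport (pker x0 t) := by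
  apply HasCompactSupport.intro (isCompact_closedBall x0 t)
  intro z hz
  apply pker_zero ht
  rw [Metric.mem_closedBall, dist_eq_norm] at hz
  linarith

lemma kker_int (x0 : E2) {t : ℝ} (ht : 0 < t) {w : E2 → ℝ} (hw : Continuous w) :
    Integrable (fun z => kker x0 t z * w z) := by
  apply Continuous.integrable_of_hasCompactSupport
  · unfold kker; have := pker_cont x0 t; fun_prop
  · apply (pker_cs x0 ht).mono
    intro z hz hz'
    apply hz
    simp [kker, hz']

lemma kker_hasDeriv (x0 : E2) {t : ℝ} (ht : 0 < t) (z : E2) :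
    HasDerivAt (fun t => kker x0 t z) (lker x0 t z) t := by
  have ht0 : t ≠ 0 := ht.ne'
  have h1 : HasDerivAt (fun t : ℝ => 1 - ‖z - x0‖^2 / t^2) (2 * ‖z - x0‖^2 / t^3) t := by
    have := ((hasDerivAt_const t (‖z-x0‖^2)).div (hasDerivAt_pow 2 t) (by positivity)).const_sub 1
    refine this.congr_deriv ?_
    field_simp; norm_num; ring
  have h2 := (hasDerivAt_posSq (1 - ‖z - x0‖^2 / t^2)).comp t h1
  have h3 : HasDerivAt (fun t : ℝ => 6 / t^2) (-12 / t^3) t := by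
    have := (hasDerivAt_const t (6:ℝ)).div (hasDerivAt_pow 2 t) (by positivity)
    refine this.congr_deriv ?_
    field_simp; norm_num; ring
  refine (h3.mul h2).congr_deriv ?_
  simp only [Function.comp, lker, pker]
  field_simp
  ring

lemma lker_zero {x0 : E2} {t : ℝ} (ht : 0 < t) {z : E2} (hz : t ≤ ‖z - x0‖) : lker x0 t z = 0 := by
  simp [lker, pker_zero ht hz]

lemma lker_abs_le {x0 : E2} {t : ℝ} (ht : 0 < t) (z : E2) : |lker x0 t z| ≤ 36 / t^3 := by
  rcases le_total t ‖z - x0‖ with h | h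
  · rw [lker_zero ht h, abs_zero]; positivity
  · unfold lker
    have hp0 := pker_nonneg x0 t z
    have hp1 := pker_le_one x0 t z
    have a1 : |-12 / t^3 * (pker x0 t z)^2| ≤ 12 / t^3 := by
      rw [abs_mul, abs_div, abs_neg, abs_of_pos (by positivity : 0 < t^3), abs_of_nonneg (by positivity : (0:ℝ) ≤ 12),
        abs_of_nonneg (by positivity : 0 ≤ (pker x0 t z)^2)]
      apply mul_le_of_le_one_right (by positivity)
      exact pow_le_one₀ hp0 hp1
    have a2 : |24 / t^5 * pker x0 t z * ‖z - x0‖^2| ≤ 24 / t^3 := by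
      rw [abs_of_nonneg (by positivity)]
      have : 24 / t^5 * pker x0 t z * ‖z - x0‖^2 ≤ 24 / t^5 * 1 * t^2 := by gcongr
      refine this.trans (le_of_eq ?_)
      field_simp
    refine (abs_add_le _ _).trans ((add_le_add a1 a2).trans (le_of_eq ?_))
    ring

lemma kker_int_hasDeriv (x0 : E2) {t : ℝ} (ht : 0 < t) {w : E2 → ℝ} (hw : Continuous w) {W : ℝ}
    (hW : ∀ z, |w z| ≤ W) :
    HasDerivAt (fun t => ∫ z, kker x0 t z * w z) (∫ z, lker x0 t z * w z) t := by
  have hW0 : 0 ≤ W := (abs_nonneg _).trans (hW 0)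
  refine (hasDerivAt_integral_of_dominated_loc_of_deriv_le (μ := volume)
    (F := fun t z => kker x0 t z * w z) (F' := fun t z => lker x0 t z * w z)
    (bound := (Metric.closedBall x0 (2*t)).indicator (fun _ => 36 / (t/2)^3 * W))
    (Ioo_mem_nhds (half_lt_self ht) (by linarith : t < 2*t)) ?_ (kker_int x0 ht hw) ?_ ?_ ?_ ?_).2
  · filter_upwards with s
    have : Continuous (fun z => kker x0 s z * w z) := by
      unfold kker; have := pker_cont x0 s; fun_prop
    exact this.aestronglyMeasurable
  · have : Continuous (fun z => lker x0 t z * w z) := by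
      unfold lker; have := pker_cont x0 t; fun_prop
    exact this.aestronglyMeasurable
  · filter_upwards with z
    intro s hs
    have hs0 : 0 < s := (half_pos ht).trans hs.1
    by_cases hz : z ∈ Metric.closedBall x0 (2*t)
    · rw [indicator_of_mem hz, norm_mul]
      refine mul_le_mul ((lker_abs_le hs0 z).trans ?_) (hW z) (norm_nonneg _) (by positivity)
      have := hs.1.le
      gcongr
    · rw [indicator_of_notMem hz]
      rw [Metric.mem_closedBall, dist_eq_norm] at hz
      rw [lker_zero hs0 (by linarith [hs.2])]
      simp
  · rw [integrable_indicator_iff Metric.isClosed_closedBall.measurableSet]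
    exact integrableOn_const (measure_closedBall_lt_top).ne
  · filter_upwards with z
    intro s hs
    have hs0 : 0 < s := (half_pos ht).trans hs.1
    exact (kker_hasDeriv x0 hs0 z).mul_const _

def cker : ℝ := ∫ z : E2, kker 0 1 z

lemma cker_pos : 0 < cker := by
  unfold cker
  refine Continuous.integral_pos_of_hasCompactSupport_nonneg_nonzero (x := 0) ?_ ?_ ?_ ?_
  · unfold kker; have := pker_cont 0 1; fun_prop
  · apply (pker_cs 0 one_pos).mono
    intro z hz hz'
    apply hz
    simp [kker, hz']
  · intro z; simp only [kker, Pi.zero_apply]; positivity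
  · simp [kker, pker]

lemma kker_integral (x0 : E2) {t : ℝ} (ht : 0 < t) : ∫ z, kker x0 t z = cker := by
  have h1 : ∫ z, kker x0 t z = ∫ z, kker x0 t (x0 + z) := (integral_add_left_eq_self _ _).symm
  have h2 := Measure.integral_comp_smul (volume : Measure E2) (fun z => kker x0 t (x0 + z)) t
  have h3 : ∀ z : E2, kker x0 t (x0 + t • z) = (t^2)⁻¹ * kker 0 1 z := by
    intro z
    unfold kker pker
    have : ‖x0 + t • z - x0‖^2/t^2 = ‖z - 0‖^2/1^2 := by
      rw [add_sub_cancel_left, norm_smul, mul_pow, Real.norm_eq_abs, sq_abs]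
      field_simp; simp
    rw [this]; field_simp
  rw [h1]
  simp only [h3, integral_const_mul] at h2
  rw [finrank_euclideanSpace_fin, abs_of_pos (by positivity), smul_eq_mul] at h2
  have ht2 : (t^2)⁻¹ ≠ 0 := by positivity
  unfold cker
  exact (mul_left_cancel₀ ht2 h2).symm

lemma kker_tendsto (x0 : E2) {w : E2 → ℝ} (hw : Continuous w) :
    Tendsto (fun t => ∫ z, kker x0 t z * w z) (𝓝[>] 0) (𝓝 (cker * w x0)) := by
  rw [Metric.tendsto_nhds]
  intro η hη
  have hc := cker_pos
  obtain ⟨r, hr, hr'⟩ := Metric.continuous_iff.1 hw x0 (η/(2*cker)) (by positivity)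
  filter_upwards [Ioo_mem_nhdsGT hr] with t ht
  have hk0 : ∀ z, 0 ≤ kker x0 t z := fun z => by unfold kker; positivity
  have e : cker * w x0 = ∫ z, kker x0 t z * w x0 := by
    rw [integral_mul_const, kker_integral x0 ht.1]
  rw [e, dist_eq_norm, ← integral_sub (kker_int x0 ht.1 hw) (kker_int x0 ht.1 continuous_const)]
  have : ‖∫ z, (kker x0 t z * w z - kker x0 t z * w x0)‖ ≤ ∫ z, kker x0 t z * (η/(2*cker)) := by
    apply norm_integral_le_of_norm_le (kker_int x0 ht.1 continuous_const)
    filter_upwards with z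
    rw [← mul_sub, norm_mul, Real.norm_of_nonneg (hk0 z)]
    rcases le_total t ‖z - x0‖ with h | h
    · simp [kker, pker_zero ht.1 h]
    · exact mul_le_mul_of_nonneg_left (hr' z (by rw [dist_eq_norm]; linarith [ht.2])).le (hk0 z)
  refine this.trans_lt ?_
  rw [integral_mul_const, kker_integral x0 ht.1]
  have : cker * (η/(2*cker)) = η/2 := by field_simp
  rw [this]; linarith

lemma kker_lip {x y : E2} {s : ℝ} (hs : 0 < s) (hxy : ‖x - y‖ ≤ s) {w : E2 → ℝ} (hw : Continuous w) {W : ℝ}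
    (hW : ∀ z, |w z| ≤ W) :
    |(∫ z, kker x s z * w z) - ∫ z, kker y s z * w z| ≤ 192 * vol1 * W * ‖x - y‖ / s := by
  have hW0 : 0 ≤ W := (abs_nonneg _).trans (hW 0)
  rw [← integral_sub (kker_int x hs hw) (kker_int y hs hw)]
  have : ‖∫ z, (kker x s z * w z - kker y s z * w z)‖ ≤
      ∫ z, (Metric.ball x (2*s)).indicator (fun _ => 48 * ‖x-y‖/s^3 * W) z := by
    apply norm_integral_le_of_norm_le
    · rw [integrable_indicator_iff Metric.isOpen_ball.measurableSet]
      exact integrableOn_const (measure_ball_lt_top).ne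
    filter_upwards with z
    have tri1 : ‖z - y‖ ≤ ‖z - x‖ + ‖x - y‖ := by
      have := norm_add_le (z - x) (x - y); simpa using this
    have tri2 : ‖z - x‖ ≤ ‖z - y‖ + ‖x - y‖ := by
      have := norm_add_le (z - y) (y - x)
      rw [norm_sub_rev y x] at this; simpa using this
    by_cases hz : z ∈ Metric.ball x (2*s)
    · rw [indicator_of_mem hz, ← sub_mul, norm_mul]
      refine mul_le_mul ?_ (hW z) (norm_nonneg _) (by positivity)
      rw [Real.norm_eq_abs]
      by_cases hb : s ≤ ‖z - x‖ ∧ s ≤ ‖z - y‖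
      · simp only [kker, pker_zero hs hb.1, pker_zero hs hb.2]
        simp only [ne_eq, OfNat.ofNat_ne_zero, not_false_eq_true, zero_pow, mul_zero, sub_self, abs_zero]
        positivity
      · have hsum : ‖z - x‖ + ‖z - y‖ ≤ 4 * s := by
          by_contra hcon
          apply hb
          constructor <;> linarith
        have hp : |pker x s z - pker y s z| ≤ 4 * ‖x - y‖ / s := by
          unfold pker
          refine (abs_max_sub_max_le_abs _ _ _).trans ?_
          have : 1 - ‖z - x‖^2/s^2 - (1 - ‖z - y‖^2/s^2) = (‖z-y‖ - ‖z-x‖)*(‖z-x‖+‖z-y‖)/s^2 := by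
            ring
          rw [this, abs_div, abs_mul, abs_of_nonneg (by positivity : 0 ≤ ‖z-x‖+‖z-y‖),
            abs_of_pos (by positivity : 0 < s^2), div_le_div_iff₀ (by positivity) hs]
          have h1 : |‖z-y‖ - ‖z-x‖| ≤ ‖x-y‖ := by rw [abs_le]; constructor <;> linarith
          have h2 : |‖z-y‖ - ‖z-x‖| * (‖z-x‖+‖z-y‖) ≤ ‖x-y‖ * (4*s) :=
            mul_le_mul h1 hsum (by positivity) (by positivity)
          nlinarith
        have : kker x s z - kker y s z = 6/s^2 * ((pker x s z + pker y s z) * (pker x s z - pker y s z)) := by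
          unfold kker; ring
        rw [this, abs_mul, abs_mul, abs_of_pos (by positivity : 0 < 6/s^2),
          abs_of_nonneg (add_nonneg (pker_nonneg _ _ _) (pker_nonneg _ _ _))]
        have h3 : pker x s z + pker y s z ≤ 2 := by linarith [pker_le_one x s z, pker_le_one y s z]
        have h4 : (pker x s z + pker y s z) * |pker x s z - pker y s z| ≤ 2 * (4 * ‖x - y‖ / s) :=
          mul_le_mul h3 hp (abs_nonneg _) (by norm_num)
        refine (mul_le_mul_of_nonneg_left h4 (by positivity : 0 ≤ 6/s^2)).trans (le_of_eq ?_)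
        field_simp; norm_num; ring
    · rw [indicator_of_notMem hz]
      rw [Metric.mem_ball, dist_eq_norm] at hz
      simp only [kker, pker_zero hs (by linarith : s ≤ ‖z - x‖), pker_zero hs (by linarith : s ≤ ‖z - y‖)]
      simp
  rw [integral_indicator Metric.isOpen_ball.measurableSet, setIntegral_const, smul_eq_mul,
    vol_ball x (by positivity)] at this
  refine this.trans (le_of_eq ?_)
  field_simp; norm_num; ring


section equi
variable {μ : E2 → ℝ} {μrad : ℝ → ℝ} {ρ : ℝ} {f : E2 → E2} {frad : ℝ → ℝ}

def thker (x0 : E2) (t : ℝ) (z : E2) : ℝ := t⁻¹ * (pker x0 t z)^3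

lemma pker_arg_hasFDeriv (x0 : E2) (t : ℝ) (z : E2) :
    HasFDerivAt (fun z => 1 - ‖z - x0‖^2 / t^2) ((-(2/t^2)) • innerSL ℝ (z - x0)) z := by
  have h1 : HasFDerivAt (fun z : E2 => ‖z - x0‖^2) (2 • (innerSL ℝ (z - x0))) z := by
    have h0 : HasFDerivAt (fun z : E2 => z - x0) (ContinuousLinearMap.id ℝ E2) z :=
      (hasFDerivAt_id z).sub_const x0
    have := h0.norm_sq
    refine this.congr_fderiv ?_
    ext h; simp
  have h2 := (h1.mul_const ((t^2)⁻¹)).const_sub 1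
  refine (h2.congr_fderiv ?_)
  ext h
  simp
  ring

lemma thker_hasFDeriv (x0 : E2) (t : ℝ) (z : E2) :
    HasFDerivAt (thker x0 t) ((-(6 * t⁻¹ / t^2 * (pker x0 t z)^2)) • innerSL ℝ (z - x0)) z := by
  have h := ((hasDerivAt_posCube (1 - ‖z - x0‖^2/t^2)).comp_hasFDerivAt z
    (pker_arg_hasFDeriv x0 t z)).const_mul t⁻¹
  refine h.congr_fderiv ?_
  ext k
  simp only [pker, ContinuousLinearMap.smul_apply, smul_eq_mul]
  ring

lemma thker_contDiff (x0 : E2) (t : ℝ) : ContDiff ℝ 1 (thker x0 t) := by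
  rw [contDiff_one_iff_fderiv]
  refine ⟨fun z => (thker_hasFDeriv x0 t z).differentiableAt, ?_⟩
  have : fderiv ℝ (thker x0 t) = fun z => (-(6 * t⁻¹ / t^2 * (pker x0 t z)^2)) • innerSL ℝ (z - x0) := by
    ext1 z; exact (thker_hasFDeriv x0 t z).fderiv
  rw [this]
  have := pker_cont x0 t
  have h2 : Continuous (fun z : E2 => innerSL ℝ (z - x0)) := (innerSL ℝ (E := E2)).continuous.comp (by fun_prop)
  have h3 : Continuous (fun z => (-(6 * t⁻¹ / t^2 * (pker x0 t z)^2))) := by fun_prop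
  exact h3.smul h2

def gker (x0 : E2) (t : ℝ) (i : Fin 2) (z : E2) : ℝ := -(6 * t⁻¹ / t^2 * (pker x0 t z)^2) * (z i - x0 i)

lemma inner_e2basis (y : E2) (i : Fin 2) : (inner ℝ y (e2basis i) : ℝ) = y i := by
  simp [e2basis, EuclideanSpace.inner_single_right]

lemma thker_partial (x0 : E2) (t : ℝ) (i : Fin 2) (z : E2) :
    fderiv ℝ (thker x0 t) z (e2basis i) = gker x0 t i z := by
  rw [(thker_hasFDeriv x0 t z).fderiv]
  simp [gker, inner_e2basis]

lemma gker_hasFDeriv (x0 : E2) (t : ℝ) (i : Fin 2) (z : E2) :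
    ∃ L : E2 →L[ℝ] ℝ, HasFDerivAt (gker x0 t i) L z ∧
      L (e2basis i) = -(6 * t⁻¹ / t^2) * (pker x0 t z)^2 + 24 * t⁻¹/t^4 * pker x0 t z * (z i - x0 i)^2 := by
  have h1 := ((hasDerivAt_posSq (1 - ‖z - x0‖^2/t^2)).comp_hasFDerivAt z
    (pker_arg_hasFDeriv x0 t z)).const_mul (-(6 * t⁻¹ / t^2))
  have h2 : HasFDerivAt (fun z : E2 => z i - x0 i) (EuclideanSpace.proj i : E2 →L[ℝ] ℝ) z :=
    (EuclideanSpace.proj i : E2 →L[ℝ] ℝ).hasFDerivAt.sub_const _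
  have h3 := h1.mul h2
  refine ⟨_, h3.congr_of_eventuallyEq ?_, ?_⟩
  · filter_upwards with y
    simp [gker, pker]
  · simp only [Function.comp, pker, ContinuousLinearMap.add_apply, ContinuousLinearMap.smul_apply, smul_eq_mul,
      innerSL_apply_apply, inner_e2basis]
    have : (EuclideanSpace.proj i : E2 →L[ℝ] ℝ) (e2basis i) = 1 := by simp [e2basis]
    rw [this]
    simp only [PiLp.sub_apply]
    ring

lemma lker_eq_sum (x0 : E2) {t : ℝ} (ht : 0 < t) (z : E2) :
    lker x0 t z = ∑ i : Fin 2, fderiv ℝ (gker x0 t i) z (e2basis i) := by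
  have h : ∀ i : Fin 2, fderiv ℝ (gker x0 t i) z (e2basis i) =
      -(6 * t⁻¹ / t^2) * (pker x0 t z)^2 + 24 * t⁻¹/t^4 * pker x0 t z * (z i - x0 i)^2 := by
    intro i
    obtain ⟨L, hL, hL'⟩ := gker_hasFDeriv x0 t i z
    rw [hL.fderiv, hL']
  rw [Fin.sum_univ_two, h 0, h 1, lker, e2_norm_sq]
  simp only [PiLp.sub_apply]
  field_simp
  ring

lemma gker_cs (x0 : E2) {t : ℝ} (ht : 0 < t) (i : Fin 2) : HasCompactSupport (gker x0 t i) := by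
  apply (pker_cs x0 ht).mono
  intro z hz hz'
  apply hz
  simp [gker, hz']

lemma gker_cont (x0 : E2) (t : ℝ) (i : Fin 2) : Continuous (gker x0 t i) := by
  unfold gker; have := pker_cont x0 t; fun_prop

lemma gker_ibp (x0 : E2) {t : ℝ} (ht : 0 < t) (i : Fin 2) {w : E2 → ℝ} (hw : Differentiable ℝ w)
    (hw2 : Integrable (fun x => (fderiv ℝ w x (e2basis i))^2)) :
    Integrable (fun x => fderiv ℝ (gker x0 t i) x (e2basis i) * w x) ∧
    Integrable (fun x => gker x0 t i x * fderiv ℝ w x (e2basis i)) ∧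
    ∫ x, gker x0 t i x * fderiv ℝ w x (e2basis i) = - ∫ x, fderiv ℝ (gker x0 t i) x (e2basis i) * w x := by
  have e : ∀ z, fderiv ℝ (gker x0 t i) z (e2basis i) =
      -(6 * t⁻¹ / t^2) * (pker x0 t z)^2 + 24 * t⁻¹/t^4 * pker x0 t z * (z i - x0 i)^2 := by
    intro z
    obtain ⟨L, hL, hL'⟩ := gker_hasFDeriv x0 t i z
    rw [hL.fderiv, hL']
  have hwc := hw.continuous
  have hpc := pker_cont x0 t
  have i1 : Integrable (fun x => fderiv ℝ (gker x0 t i) x (e2basis i) * w x) := by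
    simp only [e]
    apply Continuous.integrable_of_hasCompactSupport
    · fun_prop
    · apply (pker_cs x0 ht).mono
      intro z hz hz'
      apply hz
      simp [hz']
  have i2 : Integrable (fun x => gker x0 t i x * fderiv ℝ w x (e2basis i)) := by
    have i0 : Integrable (fun x => (gker x0 t i x)^2) :=
      Continuous.integrable_of_hasCompactSupport ((gker_cont x0 t i).pow 2)
        ((gker_cs x0 ht i).comp_left (g := fun s : ℝ => s^2) (by simp))
    refine (i0.add hw2).mono' ((gker_cont x0 t i).measurable.mul
      (measurable_fderiv_apply_const ℝ w _)).aestronglyMeasurable ?_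
    filter_upwards with x
    simp only [Pi.add_apply]
    rw [Real.norm_eq_abs, abs_le]
    constructor <;> nlinarith [sq_nonneg (gker x0 t i x - fderiv ℝ w x (e2basis i)),
      sq_nonneg (gker x0 t i x + fderiv ℝ w x (e2basis i))]
  refine ⟨i1, i2, ?_⟩
  refine integral_mul_fderiv_eq_neg_fderiv_mul_of_integrable i1 i2 ?_ ?_ ?_
  · apply Continuous.integrable_of_hasCompactSupport ((gker_cont x0 t i).mul hwc)
    exact (gker_cs x0 ht i).mul_right
  · intro x _
    obtain ⟨L, hL, _⟩ := gker_hasFDeriv x0 t i x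
    exact hL.differentiableAt
  · intro x _; exact hw x

lemma lker_weak (x0 : E2) {t : ℝ} (ht : 0 < t) {v : E2 → E2} (hv : MemH1 v) (e : E2) :
    ∫ z, lker x0 t z * (inner ℝ (v z) e : ℝ) = - ∫ z, gradInner v (fun y => thker x0 t y • e) z := by
  have hw : Differentiable ℝ (fun z => (inner ℝ (v z) e : ℝ)) := hv.1.inner ℝ (differentiable_const e)
  have hfd : ∀ (z h : E2), fderiv ℝ (fun z => (inner ℝ (v z) e : ℝ)) z h = (inner ℝ (fderiv ℝ v z h) e : ℝ) := by
    intro z h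
    rw [fderiv_inner_apply ℝ (hv.1 z) (differentiableAt_const e)]
    simp
  have hw2 : ∀ i : Fin 2, Integrable (fun x => (fderiv ℝ (fun z => (inner ℝ (v z) e : ℝ)) x (e2basis i))^2) := by
    intro i
    refine (hv.integrable_gradSq.mul_const (‖e‖^2)).mono' 
      ((measurable_fderiv_apply_const ℝ _ _).pow_const 2).aestronglyMeasurable ?_
    filter_upwards with x
    rw [Real.norm_of_nonneg (by positivity), hfd]
    have h1 : (inner ℝ (fderiv ℝ v x (e2basis i)) e : ℝ)^2 ≤ ‖fderiv ℝ v x (e2basis i)‖^2 * ‖e‖^2 := by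
      rw [← sq_abs, ← mul_pow]
      exact pow_le_pow_left₀ (abs_nonneg _) (abs_real_inner_le_norm _ _) 2
    refine h1.trans (mul_le_mul_of_nonneg_right ?_ (by positivity))
    unfold gradSq
    exact Finset.single_le_sum (f := fun i => ‖fderiv ℝ v x (e2basis i)‖^2) (fun j _ => by positivity) (Finset.mem_univ i)
  obtain ⟨a0, b0, c0⟩ := gker_ibp x0 ht 0 hw (hw2 0)
  obtain ⟨a1, b1, c1⟩ := gker_ibp x0 ht 1 hw (hw2 1)
  have l : ∫ z, lker x0 t z * (inner ℝ (v z) e : ℝ) =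
      (∫ z, fderiv ℝ (gker x0 t 0) z (e2basis 0) * (inner ℝ (v z) e : ℝ)) +
      ∫ z, fderiv ℝ (gker x0 t 1) z (e2basis 1) * (inner ℝ (v z) e : ℝ) := by
    rw [← integral_add a0 a1]
    congr 1; ext z
    rw [lker_eq_sum x0 ht, Fin.sum_univ_two, add_mul]
  have r : ∫ z, gradInner v (fun y => thker x0 t y • e) z =
      (∫ z, gker x0 t 0 z * fderiv ℝ (fun z => (inner ℝ (v z) e : ℝ)) z (e2basis 0)) +
      ∫ z, gker x0 t 1 z * fderiv ℝ (fun z => (inner ℝ (v z) e : ℝ)) z (e2basis 1) := by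
    rw [← integral_add b0 b1]
    congr 1; ext z
    unfold gradInner
    have : fderiv ℝ (fun y => thker x0 t y • e) z = (fderiv ℝ (thker x0 t) z).smulRight e :=
      ((thker_hasFDeriv x0 t z).differentiableAt.hasFDerivAt.smul_const e).fderiv
    rw [Fin.sum_univ_two, this]
    simp only [ContinuousLinearMap.smulRight_apply, thker_partial, inner_smul_right, hfd]
  rw [l, r, c0, c1]; ring

set_option maxHeartbeats 400000 in
lemma lker_bound (hμ : MuHyp μ μrad ρ) (hf : FHyp f frad) {M M0 F A0 : ℝ} (hM0 : 0 ≤ M) (hmu : ∀ x, |μ x| ≤ M0)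
    (hF : ∀ x, ‖f x‖ ≤ F) {ε a : ℝ} (hε : 0 < ε) (hε1 : ε ≤ 1) (ha : 0 ≤ a) (haA : a ≤ A0) {v : E2 → E2}
    (hmin : IsMinimizer ε a μ f v) (hM : ∀ x, ‖v x‖ ≤ M) (x0 e : E2) {t : ℝ} (ht : 0 < t) :
    |∫ z, lker x0 t z * (inner ℝ (v z) e : ℝ)| ≤ (M0 * M + M^3 + A0 * F) * vol1 * ‖e‖ * t / ε^2 := by
  have hA0 : 0 ≤ A0 := ha.trans haA
  have hF0 : 0 ≤ F := (norm_nonneg _).trans (hF 0)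
  have hM00 : 0 ≤ M0 := (abs_nonneg _).trans (hmu 0)
  have hcd : ContDiff ℝ 1 (fun y => thker x0 t y • e) := (thker_contDiff x0 t).smul contDiff_const
  have hcs : HasCompactSupport (fun y => thker x0 t y • e) := by
    apply (pker_cs x0 ht).mono
    intro z hz hz'
    apply hz
    simp [thker, hz']
  have hwe := weak_el hμ hf hε hmin hM0 hM hcd hcs
  rw [lker_weak x0 ht hmin.1 e, abs_neg, hwe]
  obtain ⟨K, hK⟩ : ∃ K, K = M0 * M + M^3 + A0 * F := ⟨_, rfl⟩
  have hK0 : 0 ≤ K := by rw [hK]; positivity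
  have : ‖∫ x, ((1/ε^2)*μ x*(inner ℝ (v x) (thker x0 t x • e) : ℝ) -
      (1/ε^2)*‖v x‖^2*(inner ℝ (v x) (thker x0 t x • e) : ℝ) + (a/ε)*(inner ℝ (f x) (thker x0 t x • e) : ℝ))‖ ≤
      ∫ z, (Metric.ball x0 t).indicator (fun _ => 1/ε^2 * K * (t⁻¹ * ‖e‖)) z := by
    apply norm_integral_le_of_norm_le
    · rw [integrable_indicator_iff Metric.isOpen_ball.measurableSet]
      exact integrableOn_const (measure_ball_lt_top).ne
    filter_upwards with z
    by_cases hz : z ∈ Metric.ball x0 t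
    · rw [indicator_of_mem hz]
      have hT : ‖thker x0 t z • e‖ ≤ t⁻¹ * ‖e‖ := by
        rw [norm_smul]
        apply mul_le_mul_of_nonneg_right _ (norm_nonneg _)
        have := pker_nonneg x0 t z
        rw [Real.norm_of_nonneg (by unfold thker; positivity), thker]
        exact mul_le_of_le_one_right (by positivity) (pow_le_one₀ this (pker_le_one x0 t z))
      obtain ⟨ψ, hψ⟩ : ∃ ψ, ψ = thker x0 t z • e := ⟨_, rfl⟩
      rw [← hψ] at hT ⊢
      have b1 : |(inner ℝ (v z) ψ : ℝ)| ≤ M * ‖ψ‖ :=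
        (abs_real_inner_le_norm _ _).trans (mul_le_mul_of_nonneg_right (hM z) (norm_nonneg _))
      have b2 : |(inner ℝ (f z) ψ : ℝ)| ≤ F * ‖ψ‖ :=
        (abs_real_inner_le_norm _ _).trans (mul_le_mul_of_nonneg_right (hF z) (norm_nonneg _))
      have c1 : |(1/ε^2)*μ z*(inner ℝ (v z) ψ : ℝ)| ≤ 1/ε^2 * M0 * (M * ‖ψ‖) := by
        rw [abs_mul, abs_mul, abs_of_pos (by positivity : 0 < 1/ε^2)]
        have := hmu z
        gcongr
      have c2 : |(1/ε^2)*‖v z‖^2*(inner ℝ (v z) ψ : ℝ)| ≤ 1/ε^2 * M^2 * (M * ‖ψ‖) := by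
        rw [abs_mul, abs_mul, abs_of_pos (by positivity : 0 < 1/ε^2), abs_of_nonneg (by positivity : 0 ≤ ‖v z‖^2)]
        have := hM z
        gcongr
      have c3 : |(a/ε)*(inner ℝ (f z) ψ : ℝ)| ≤ 1/ε^2 * A0 * (F * ‖ψ‖) := by
        rw [abs_mul, abs_of_nonneg (by positivity : 0 ≤ a/ε)]
        have : a/ε ≤ 1/ε^2 * A0 := by
          rw [one_div_mul_eq_div, div_le_div_iff₀ hε (by positivity)]
          nlinarith [mul_le_mul_of_nonneg_right haA (by positivity : 0 ≤ ε^2), mul_le_mul_of_nonneg_left hε1 (by positivity : 0 ≤ A0*ε)]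
        gcongr
      have c4 : 1/ε^2 * K * ‖ψ‖ ≤ 1/ε^2 * K * (t⁻¹ * ‖e‖) := mul_le_mul_of_nonneg_left hT (by positivity)
      have c5 : 1/ε^2 * K * ‖ψ‖ = 1/ε^2 * M0 * (M * ‖ψ‖) + 1/ε^2 * M^2 * (M * ‖ψ‖) + 1/ε^2 * A0 * (F * ‖ψ‖) := by
        rw [hK]; ring
      rw [Real.norm_eq_abs]
      refine (abs_add_le _ _).trans ?_
      have := abs_sub ((1/ε^2)*μ z*(inner ℝ (v z) ψ : ℝ)) ((1/ε^2)*‖v z‖^2*(inner ℝ (v z) ψ : ℝ))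
      linarith
    · rw [indicator_of_notMem hz]
      rw [Metric.mem_ball, dist_eq_norm] at hz
      simp [thker, pker_zero ht (by linarith : t ≤ ‖z - x0‖)]
  rw [integral_indicator Metric.isOpen_ball.measurableSet, setIntegral_const, smul_eq_mul,
    vol_ball x0 ht.le] at this
  refine this.trans (le_of_eq ?_)
  rw [← hK]
  field_simp

lemma mean_bound (hμ : MuHyp μ μrad ρ) (hf : FHyp f frad) {M M0 F A0 : ℝ} (hM0 : 0 ≤ M) (hmu : ∀ x, |μ x| ≤ M0)
    (hF : ∀ x, ‖f x‖ ≤ F) {ε a : ℝ} (hε : 0 < ε) (hε1 : ε ≤ 1) (ha : 0 ≤ a) (haA : a ≤ A0) {v : E2 → E2}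
    (hmin : IsMinimizer ε a μ f v) (hM : ∀ x, ‖v x‖ ≤ M) (x0 e : E2) {t : ℝ} (ht : 0 < t) :
    |(∫ z, kker x0 t z * (inner ℝ (v z) e : ℝ)) - cker * (inner ℝ (v x0) e : ℝ)| ≤
      (M0 * M + M^3 + A0 * F) * vol1 * ‖e‖ * t^2 / ε^2 := by
  have hA0 : 0 ≤ A0 := ha.trans haA
  have hF0 : 0 ≤ F := (norm_nonneg _).trans (hF 0)
  have hM00 : 0 ≤ M0 := (abs_nonneg _).trans (hmu 0)
  have hv1 := vol1_pos
  have hwc : Continuous (fun z => (inner ℝ (v z) e : ℝ)) := hmin.1.1.continuous.inner continuous_const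
  have hW : ∀ z, |(inner ℝ (v z) e : ℝ)| ≤ M * ‖e‖ := fun z =>
    (abs_real_inner_le_norm _ _).trans (mul_le_mul_of_nonneg_right (hM z) (norm_nonneg _))
  have hlim := ((kker_tendsto x0 hwc).const_sub (∫ z, kker x0 t z * (inner ℝ (v z) e : ℝ))).abs
  refine le_of_tendsto hlim ?_
  filter_upwards [Ioo_mem_nhdsGT ht] with s hs
  have := Convex.norm_image_sub_le_of_norm_hasDerivWithin_le (s := Icc s t)
    (f := fun t => ∫ z, kker x0 t z * (inner ℝ (v z) e : ℝ)) (f' := fun t => ∫ z, lker x0 t z * (inner ℝ (v z) e : ℝ))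
    (C := (M0 * M + M^3 + A0 * F) * vol1 * ‖e‖ * t / ε^2) (x := s) (y := t)
    (fun r hr => (kker_int_hasDeriv x0 (hs.1.trans_le hr.1) hwc hW).hasDerivWithinAt)
    (fun r hr => (lker_bound hμ hf hM0 hmu hF hε hε1 ha haA hmin hM x0 e (hs.1.trans_le hr.1)).trans (by
      have := hr.2
      gcongr)) (convex_Icc s t) (left_mem_Icc.2 hs.2.le) (right_mem_Icc.2 hs.2.le)
  refine this.trans ?_
  rw [Real.norm_of_nonneg (by linarith [hs.2])]
  have h2 : (M0 * M + M^3 + A0 * F) * vol1 * ‖e‖ * t / ε^2 * (t - s) ≤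
    (M0 * M + M^3 + A0 * F) * vol1 * ‖e‖ * t / ε^2 * t := by
    have := hs.1
    apply mul_le_mul_of_nonneg_left (by linarith) (by positivity)
  refine h2.trans (le_of_eq ?_)
  ring

set_option maxHeartbeats 1000000 in
theorem equicont (hμ : MuHyp μ μrad ρ) (hf : FHyp f frad) (A0 M : ℝ) (hA0 : 0 ≤ A0) (hM0 : 0 ≤ M) {δ : ℝ} (hδ : 0 < δ) :
    ∃ l, 0 < l ∧ l ≤ 1 ∧ ∀ ε a, 0 < ε → ε ≤ 1 → 0 ≤ a → a ≤ A0 → ∀ v, IsMinimizer ε a μ f v → (∀ x, ‖v x‖ ≤ M) →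
      ∀ x y, ‖x - y‖ ≤ l * ε → ‖v x - v y‖ ≤ δ := by
  obtain ⟨M0, hmu⟩ := hμ.bdd
  obtain ⟨F, hF⟩ := hf.bdd
  have hF0 : 0 ≤ F := (norm_nonneg _).trans (hF 0)
  have hM00 : 0 ≤ M0 := (abs_nonneg _).trans (hmu 0)
  have hv1 := vol1_pos
  have hc := cker_pos
  obtain ⟨K, hK⟩ : ∃ K, K = (M0 * M + M^3 + A0 * F) * vol1 := ⟨_, rfl⟩
  have hK0 : 0 ≤ K := by rw [hK]; positivity
  obtain ⟨n, hn⟩ : ∃ n, n = min 1 (cker * δ / (4 * (K + 1))) := ⟨_, rfl⟩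
  have hn0 : 0 < n := by rw [hn]; exact lt_min one_pos (by positivity)
  have hn1 : n ≤ 1 := by rw [hn]; exact min_le_left _ _
  have hn2 : n * (4 * (K+1)) ≤ cker * δ := by
    rw [← le_div_iff₀ (by positivity), hn]; exact min_le_right _ _
  obtain ⟨l, hl⟩ : ∃ l, l = min n (cker * δ * n / (2 * (192 * vol1 * M + 1))) := ⟨_, rfl⟩
  have hl0 : 0 < l := by rw [hl]; exact lt_min hn0 (by positivity)
  have hl1 : l ≤ n := by rw [hl]; exact min_le_left _ _
  have hl2 : l * (2 * (192 * vol1 * M + 1)) ≤ cker * δ * n := by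
    rw [← le_div_iff₀ (by positivity), hl]; exact min_le_right _ _
  refine ⟨l, hl0, hl1.trans hn1, ?_⟩
  intro ε a hε hε1 ha haA v hmin hM x y hxy
  obtain ⟨e, he⟩ : ∃ e, e = v x - v y := ⟨_, rfl⟩
  rw [← he]
  rcases eq_or_ne e 0 with h0 | h0
  · rw [h0, norm_zero]; exact hδ.le
  have hep : 0 < ‖e‖ := norm_pos_iff.2 h0
  have hs : 0 < n * ε := by positivity
  have hwc : Continuous (fun z => (inner ℝ (v z) e : ℝ)) := hmin.1.1.continuous.inner continuous_const
  have hW : ∀ z, |(inner ℝ (v z) e : ℝ)| ≤ M * ‖e‖ := fun z =>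
    (abs_real_inner_le_norm _ _).trans (mul_le_mul_of_nonneg_right (hM z) (norm_nonneg _))
  have m1 := mean_bound hμ hf hM0 hmu hF hε hε1 ha haA hmin hM x e hs
  have m2 := mean_bound hμ hf hM0 hmu hF hε hε1 ha haA hmin hM y e hs
  have m3 := kker_lip (x := x) (y := y) hs (hxy.trans (mul_le_mul_of_nonneg_right hl1 hε.le)) hwc hW
  rw [← hK] at m1 m2
  have t1 : K * ‖e‖ * (n*ε)^2/ε^2 ≤ cker * δ / 4 * ‖e‖ := by
    have : K * ‖e‖ * (n*ε)^2/ε^2 = (K * n^2) * ‖e‖ := by field_simp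
    rw [this]
    apply mul_le_mul_of_nonneg_right _ hep.le
    have : n^2 ≤ n := by nlinarith
    nlinarith
  have t2 : 192 * vol1 * (M * ‖e‖) * ‖x - y‖ / (n*ε) ≤ cker * δ / 2 * ‖e‖ := by
    rw [div_le_iff₀ hs]
    have a1 : 192 * vol1 * (M * ‖e‖) * ‖x - y‖ ≤ 192 * vol1 * (M * ‖e‖) * (l * ε) :=
      mul_le_mul_of_nonneg_left hxy (by positivity)
    have a2 : l * (192 * vol1 * M) ≤ cker * δ * n / 2 := by nlinarith
    have a3 := mul_le_mul_of_nonneg_right a2 (by positivity : 0 ≤ ‖e‖ * ε)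
    nlinarith
  have hin : (inner ℝ (v x) e : ℝ) - (inner ℝ (v y) e : ℝ) = ‖e‖ * ‖e‖ := by
    rw [← inner_sub_left, ← he, real_inner_self_eq_norm_mul_norm]
  have b1 := abs_le.1 m1
  have b2 := abs_le.1 m2
  have b3 := abs_le.1 m3
  have fin : (cker * ‖e‖) * ‖e‖ ≤ (cker * ‖e‖) * δ := by
    have : cker * (‖e‖ * ‖e‖) ≤ cker * δ * ‖e‖ := by
      rw [← hin, mul_sub]
      linarith
    linarith
  exact le_of_mul_le_mul_left fin (by positivity)

end equi


/-! ### Poincaré inequality on annuli -/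

lemma ftc_sq {φ φ' : ℝ → ℝ} {a b : ℝ} (hab : a ≤ b) (hd : ∀ x ∈ Icc a b, HasDerivAt φ (φ' x) x)
    {N : ℝ → ℝ≥0∞} (hN : ∀ x ∈ Icc a b, ENNReal.ofReal (φ' x ^ 2) ≤ N x) :
    ENNReal.ofReal ((φ b - φ a)^2) ≤ ENNReal.ofReal (b - a) * ∫⁻ x in Icc a b, N x := by
  rcases hab.eq_or_lt with rfl | hlt
  · simp
  have hba : 0 < b - a := by linarith
  by_cases hfin : ∫⁻ x in Icc a b, N x = ∞
  · rw [hfin, ENNReal.mul_top (by simpa using hlt)]; exact le_top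
  have hle : ∫⁻ x in Icc a b, ENNReal.ofReal (φ' x ^ 2) ≤ ∫⁻ x in Icc a b, N x :=
    setLIntegral_mono' measurableSet_Icc hN
  have hm : AEStronglyMeasurable φ' (volume.restrict (Icc a b)) := by
    have h1 : AEStronglyMeasurable (deriv φ) (volume.restrict (Icc a b)) :=
      (measurable_deriv φ).aestronglyMeasurable
    refine h1.congr ?_
    filter_upwards [ae_restrict_mem measurableSet_Icc] with x hx
    exact (hd x hx).deriv
  have i2 : IntegrableOn (fun x => φ' x ^ 2) (Icc a b) := by
    refine ⟨hm.pow 2, ?_⟩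
    rw [hasFiniteIntegral_iff_ofReal (Eventually.of_forall fun x => sq_nonneg _)]
    exact lt_of_le_of_lt hle (lt_top_iff_ne_top.2 hfin)
  have ic : ∀ c : ℝ, IntegrableOn (fun _ : ℝ => c) (Icc a b) := fun c =>
    integrableOn_const (by simp)
  have i1 : IntegrableOn φ' (Icc a b) := by
    refine Integrable.mono' (Integrable.add (ic 1) i2) hm ?_
    filter_upwards with x
    simp only [Pi.add_apply]
    rw [Real.norm_eq_abs, abs_le]
    constructor <;> nlinarith [sq_nonneg (φ' x - 1), sq_nonneg (φ' x + 1)]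
  have hftc : ∫ x in Icc a b, φ' x = φ b - φ a := by
    rw [integral_Icc_eq_integral_Ioc, ← intervalIntegral.integral_of_le hab]
    apply intervalIntegral.integral_eq_sub_of_hasDerivAt
    · rw [uIcc_of_le hab]; exact hd
    · rw [intervalIntegrable_iff_integrableOn_Icc_of_le hab]; exact i1
  have hcs : (φ b - φ a)^2 ≤ (b - a) * ∫ x in Icc a b, φ' x ^ 2 := by
    obtain ⟨m, hm'⟩ : ∃ m, m = (φ b - φ a)/(b - a) := ⟨_, rfl⟩
    have h0 : 0 ≤ ∫ x in Icc a b, (φ' x ^ 2 - (2 * m) * φ' x + m^2) := by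
      apply integral_nonneg
      intro x
      have : φ' x ^ 2 - (2 * m) * φ' x + m^2 = (φ' x - m)^2 := by ring
      simp only [Pi.zero_apply]
      rw [this]; positivity
    have i3 : IntegrableOn (fun x => (2*m) * φ' x) (Icc a b) := i1.const_mul _
    have i4 : IntegrableOn (fun x => φ' x ^ 2 - (2*m) * φ' x) (Icc a b) := i2.sub i3
    rw [integral_add i4 (ic _), integral_sub i2 i3, integral_const_mul, hftc, setIntegral_const] at h0
    rw [measureReal_def, Real.volume_Icc, ENNReal.toReal_ofReal hba.le, smul_eq_mul] at h0
    have hmd : m * (b - a) = φ b - φ a := by rw [hm']; field_simp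
    have h5 : (b-a)*(2*m*(φ b - φ a) - (b - a)*m^2) = (φ b - φ a)^2 := by rw [← hmd]; ring
    have h6 := mul_le_mul_of_nonneg_left (by linarith : 2*m*(φ b - φ a) - (b - a)*m^2 ≤ ∫ x in Icc a b, φ' x ^ 2) hba.le
    linarith
  calc ENNReal.ofReal ((φ b - φ a)^2) ≤ ENNReal.ofReal ((b - a) * ∫ x in Icc a b, φ' x ^ 2) :=
        ENNReal.ofReal_le_ofReal hcs
    _ = ENNReal.ofReal (b - a) * ∫⁻ x in Icc a b, ENNReal.ofReal (φ' x ^ 2) := by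
        rw [ENNReal.ofReal_mul hba.le, ofReal_integral_eq_lintegral_ofReal i2 (Eventually.of_forall fun x => sq_nonneg _)]
    _ ≤ _ := by gcongr

lemma ftc_sq' {φ φ' : ℝ → ℝ} {α β a b : ℝ} (ha : a ∈ Ioo α β) (hb : b ∈ Ioo α β)
    (hd : ∀ x ∈ Ioo α β, HasDerivAt φ (φ' x) x)
    {N : ℝ → ℝ≥0∞} (hN : ∀ x ∈ Ioo α β, ENNReal.ofReal (φ' x ^ 2) ≤ N x) :
    ENNReal.ofReal ((φ b - φ a)^2) ≤ ENNReal.ofReal (β - α) * ∫⁻ x in Ioo α β, N x := by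
  rcases le_total a b with h | h
  · have hs : Icc a b ⊆ Ioo α β := Icc_subset_Ioo ha.1 hb.2
    refine (ftc_sq h (fun x hx => hd x (hs hx)) (fun x hx => hN x (hs hx))).trans ?_
    refine mul_le_mul' (ENNReal.ofReal_le_ofReal (by linarith [ha.1, hb.2])) (lintegral_mono_set hs)
  · have hs : Icc b a ⊆ Ioo α β := Icc_subset_Ioo hb.1 ha.2
    have : (φ b - φ a)^2 = (φ a - φ b)^2 := by ring
    rw [this]
    refine (ftc_sq h (fun x hx => hd x (hs hx)) (fun x hx => hN x (hs hx))).trans ?_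
    refine mul_le_mul' (ENNReal.ofReal_le_ofReal (by linarith [hb.1, ha.2])) (lintegral_mono_set hs)

def iota : E2 ≃ₗᵢ[ℝ] ℂ := Complex.orthonormalBasisOneI.repr.symm

def edir (θ : ℝ) : E2 := iota.symm (Complex.exp (θ * Complex.I))

lemma norm_edir (θ : ℝ) : ‖edir θ‖ = 1 := by
  rw [edir, LinearIsometryEquiv.norm_map, Complex.norm_exp_ofReal_mul_I]

lemma edir_hasDeriv (θ : ℝ) : ∃ e' : E2, ‖e'‖ = 1 ∧ HasDerivAt edir e' θ := by
  have h1 : HasDerivAt (fun θ : ℝ => Complex.exp (θ * Complex.I)) (Complex.exp (θ * Complex.I) * (1 * Complex.I)) θ :=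
    (((hasDerivAt_id (θ:ℂ)).mul_const Complex.I).cexp).comp_ofReal
  refine ⟨iota.symm (Complex.exp (θ * Complex.I) * (1 * Complex.I)), ?_, ?_⟩
  · rw [LinearIsometryEquiv.norm_map, norm_mul, Complex.norm_exp_ofReal_mul_I]; simp
  · exact iota.symm.toContinuousLinearEquiv.hasFDerivAt.comp_hasDerivAt θ h1

lemma edir_cont : Continuous edir := by
  rw [continuous_iff_continuousAt]
  intro θ
  obtain ⟨e', _, h⟩ := edir_hasDeriv θ
  exact h.continuousAt

def ann (x0 : E2) (α β : ℝ) : Set E2 := {x | α < ‖x - x0‖ ∧ ‖x - x0‖ < β}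

lemma isOpen_ann (x0 : E2) (α β : ℝ) : IsOpen (ann x0 α β) := by
  have h : Continuous (fun x : E2 => ‖x - x0‖) := by fun_prop
  exact (isOpen_lt continuous_const h).inter (isOpen_lt h continuous_const)

lemma mem_ann_polar (x0 : E2) {α β r θ : ℝ} (hr : 0 < r) : x0 + r • edir θ ∈ ann x0 α β ↔ r ∈ Ioo α β := by
  simp [ann, norm_smul, norm_edir, abs_of_pos hr]

lemma lint_polar (x0 : E2) {α β : ℝ} (hα : 0 ≤ α) (G : E2 → ℝ≥0∞) :
    ∫⁻ x in ann x0 α β, G x =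
      ∫⁻ p in Ioo α β ×ˢ Ioo (-π) π, ENNReal.ofReal p.1 * G (x0 + p.1 • edir p.2) := by
  rw [← lintegral_indicator (isOpen_ann x0 α β).measurableSet]
  rw [← lintegral_add_left_eq_self _ x0]
  have hmp : MeasurePreserving iota.symm (volume : Measure ℂ) (volume : Measure E2) :=
    iota.symm.measurePreserving
  rw [← hmp.lintegral_comp_emb iota.symm.toHomeomorph.measurableEmbedding]
  rw [← Complex.lintegral_comp_polarCoord_symm]
  have e1 : ∀ p : ℝ × ℝ, iota.symm (Complex.polarCoord.symm p) = p.1 • edir p.2 := by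
    intro p
    rw [edir, ← map_smul, Complex.polarCoord_symm_apply, Complex.exp_mul_I, Complex.real_smul, Complex.ofReal_cos, Complex.ofReal_sin]
  simp only [e1, smul_eq_mul]
  have hs : Ioo α β ×ˢ Ioo (-π) π ⊆ polarCoord.target := by
    rw [polarCoord_target]
    exact prod_mono (fun r hr => lt_of_le_of_lt hα hr.1) le_rfl
  have hms : MeasurableSet (Ioo α β ×ˢ Ioo (-π) π) := measurableSet_Ioo.prod measurableSet_Ioo
  rw [← lintegral_indicator hms, ← lintegral_indicator polarCoord.open_target.measurableSet]
  congr 1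
  ext p
  by_cases hp : p ∈ polarCoord.target
  · rw [indicator_of_mem hp]
    have hp' := hp
    rw [polarCoord_target] at hp'
    by_cases hp2 : p ∈ Ioo α β ×ˢ Ioo (-π) π
    · rw [indicator_of_mem hp2, indicator_of_mem ((mem_ann_polar x0 hp'.1).2 hp2.1)]
    · rw [indicator_of_notMem hp2, indicator_of_notMem, mul_zero]
      rw [mem_ann_polar x0 hp'.1]
      exact fun h => hp2 ⟨h, hp'.2⟩
  · rw [indicator_of_notMem hp, indicator_of_notMem (fun h => hp (hs h))]

lemma ofReal_sq_split (A B C : ℝ) : ENNReal.ofReal ((A - C)^2) ≤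
    2 * ENNReal.ofReal ((A - B)^2) + 2 * ENNReal.ofReal ((B - C)^2) := by
  have h2 : (2:ℝ≥0∞) = ENNReal.ofReal 2 := by simp
  rw [h2, ← ENNReal.ofReal_mul (by norm_num), ← ENNReal.ofReal_mul (by norm_num),
      ← ENNReal.ofReal_add (by positivity) (by positivity)]
  apply ENNReal.ofReal_le_ofReal
  nlinarith [sq_nonneg ((A - B) - (B - C))]

set_option maxHeartbeats 1000000 in
lemma poincare_l (x0 : E2) {α β : ℝ} (hα : 0 < α) (hαβ : α < β) (hβ : β ≤ 2 * α) {φ : E2 → ℝ}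
    (hφ : ∀ x ∈ ann x0 α β, DifferentiableAt ℝ φ x) :
    ∃ c, ∫⁻ x in ann x0 α β, ENNReal.ofReal ((φ x - c)^2) ≤
      ENNReal.ofReal (200 * β^2) * ∫⁻ x in ann x0 α β, ENNReal.ofReal (‖fderiv ℝ φ x‖^2) := by
  have hπ := Real.pi_pos
  have hβ0 : 0 < β := hα.trans hαβ
  obtain ⟨N, hNdef⟩ : ∃ N : ℝ × ℝ → ℝ≥0∞, N = fun p => ENNReal.ofReal (‖fderiv ℝ φ (x0 + p.1 • edir p.2)‖^2) := ⟨_, rfl⟩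
  have hX : Continuous (fun p : ℝ × ℝ => x0 + p.1 • edir p.2) := by
    have := edir_cont; fun_prop
  have hNm : Measurable N := by
    rw [hNdef]
    have h1 : Measurable (fun x => ENNReal.ofReal (‖fderiv ℝ φ x‖^2)) :=
      ((measurable_fderiv ℝ φ).norm.pow_const 2).ennreal_ofReal
    exact h1.comp hX.measurable
  obtain ⟨Fθ, hFθ⟩ : ∃ Fθ : ℝ → ℝ≥0∞, Fθ = fun r => ∫⁻ θ in Ioo (-π) π, N (r, θ) := ⟨_, rfl⟩
  obtain ⟨H, hH⟩ : ∃ H : ℝ → ℝ≥0∞, H = fun θ => ∫⁻ r in Ioo α β, N (r, θ) := ⟨_, rfl⟩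
  have hFm : Measurable Fθ := by rw [hFθ]; exact hNm.lintegral_prod_right'
  have hHm : Measurable H := by rw [hH]; exact hNm.lintegral_prod_left'
  obtain ⟨I, hI⟩ : ∃ I, I = ∫⁻ r in Ioo α β, Fθ r := ⟨_, rfl⟩
  have hI2 : ∫⁻ θ in Ioo (-π) π, H θ = I := by
    rw [hI, hFθ, hH]
    exact (lintegral_lintegral_swap (f := fun r θ => N (r, θ)) hNm.aemeasurable).symm
  have hvol : volume (Ioo α β) = ENNReal.ofReal (β - α) := Real.volume_Ioo
  obtain ⟨D, hD⟩ : ∃ D, D = ENNReal.ofReal (β - α) := ⟨_, rfl⟩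
  have hD0 : D ≠ 0 := by rw [hD]; simpa using hαβ
  have hDt : D ≠ ∞ := by rw [hD]; exact ENNReal.ofReal_ne_top
  obtain ⟨r0, hr0, hr0'⟩ := exists_le_setLAverage (μ := volume) (s := Ioo α β) (f := Fθ)
    (by rw [hvol, ← hD]; exact hD0) (by rw [hvol, ← hD]; exact hDt) hFm.aemeasurable
  rw [setLAverage_eq, hvol, ← hI, ← hD] at hr0'
  have hDF : D * Fθ r0 ≤ I := by
    rw [mul_comm]
    exact ENNReal.mul_le_of_le_div hr0'
  refine ⟨φ (x0 + r0 • edir 0), ?_⟩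
  have hr00 : 0 < r0 := hα.trans hr0.1
  have hrad : ∀ r ∈ Ioo α β, ∀ θ, ENNReal.ofReal ((φ (x0 + r • edir θ) - φ (x0 + r0 • edir θ))^2) ≤ D * H θ := by
    intro r hr θ
    rw [hD, hH]
    refine ftc_sq' (φ := fun s => φ (x0 + s • edir θ))
      (φ' := fun s => fderiv ℝ φ (x0 + s • edir θ) (edir θ)) hr0 hr ?_ ?_
    · intro s hs
      have h1 := (hφ _ ((mem_ann_polar x0 (θ := θ) (hα.trans hs.1)).2 hs)).hasFDerivAt
      have h2 : HasDerivAt (fun s : ℝ => x0 + s • edir θ) (edir θ) s := by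
        have := ((hasDerivAt_id s).smul_const (edir θ)).const_add x0
        simpa using this
      exact h1.comp_hasDerivAt s h2
    · intro s hs
      rw [hNdef]
      apply ENNReal.ofReal_le_ofReal
      rw [← sq_abs]
      apply pow_le_pow_left₀ (abs_nonneg _)
      have := (fderiv ℝ φ (x0 + s • edir θ)).le_opNorm (edir θ)
      rwa [norm_edir, mul_one] at this
  have hang : ∀ θ ∈ Ioo (-π) π, ENNReal.ofReal ((φ (x0 + r0 • edir θ) - φ (x0 + r0 • edir 0))^2) ≤
      ENNReal.ofReal (2*π) * (ENNReal.ofReal (β^2) * Fθ r0) := by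
    intro θ hθ
    choose e' he' hed using edir_hasDeriv
    have := ftc_sq' (φ := fun s => φ (x0 + r0 • edir s))
      (φ' := fun s => fderiv ℝ φ (x0 + r0 • edir s) (r0 • e' s)) (α := -π) (β := π) (a := 0) (b := θ)
      (N := fun s => ENNReal.ofReal (β^2) * N (r0, s))
      ⟨by linarith, by linarith⟩ hθ ?_ ?_
    · refine this.trans (le_of_eq ?_)
      rw [lintegral_const_mul _ (by exact hNm.comp measurable_prodMk_left), hFθ]
      congr 2; ring
    · intro s hs
      have h1 := (hφ _ ((mem_ann_polar x0 (θ := s) hr00).2 hr0)).hasFDerivAt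
      have h2 : HasDerivAt (fun s : ℝ => x0 + r0 • edir s) (r0 • e' s) s :=
        ((hed s).const_smul r0).const_add x0
      exact h1.comp_hasDerivAt s h2
    · intro s hs
      simp only [hNdef]
      rw [← ENNReal.ofReal_mul (by positivity)]
      apply ENNReal.ofReal_le_ofReal
      rw [← mul_pow, ← sq_abs]
      apply pow_le_pow_left₀ (abs_nonneg _)
      have := (fderiv ℝ φ (x0 + r0 • edir s)).le_opNorm (r0 • e' s)
      rw [norm_smul, he', mul_one, Real.norm_of_nonneg hr00.le] at this
      refine this.trans ?_
      rw [mul_comm]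
      exact mul_le_mul_of_nonneg_right hr0.2.le (norm_nonneg _)
  obtain ⟨K, hK⟩ : ∃ K, K = ENNReal.ofReal (2*π) * (ENNReal.ofReal (β^2) * Fθ r0) := ⟨_, rfl⟩
  rw [← hK] at hang
  have hpt : ∀ p ∈ Ioo α β ×ˢ Ioo (-π) π,
      ENNReal.ofReal p.1 * ENNReal.ofReal ((φ (x0 + p.1 • edir p.2) - φ (x0 + r0 • edir 0))^2) ≤
      ENNReal.ofReal β * (2 * (D * H p.2) + 2 * K) := by
    intro p hp
    refine mul_le_mul' (ENNReal.ofReal_le_ofReal hp.1.2.le) ?_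
    have h1 := hrad p.1 hp.1 p.2
    have h2 := hang p.2 hp.2
    refine le_trans ?_ (add_le_add (mul_le_mul_right h1 2) (mul_le_mul_right h2 2))
    exact ofReal_sq_split _ _ _
  have hms : MeasurableSet (Ioo α β ×ˢ Ioo (-π) π) := measurableSet_Ioo.prod measurableSet_Ioo
  have hup : ∫⁻ x in ann x0 α β, ENNReal.ofReal ((φ x - φ (x0 + r0 • edir 0))^2) ≤
      D * (ENNReal.ofReal β * (2 * (D * I) + 2 * K * ENNReal.ofReal (2*π))) := by
    rw [lint_polar x0 hα.le]
    refine (setLIntegral_mono' hms hpt).trans (le_of_eq ?_)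
    rw [Measure.volume_eq_prod, setLIntegral_prod_symm]
    · simp only [lintegral_const, Measure.restrict_apply MeasurableSet.univ, univ_inter, hvol, ← hD]
      rw [lintegral_mul_const, lintegral_const_mul, lintegral_add_right _ measurable_const, lintegral_const_mul,
        lintegral_const_mul, hI2]
      · simp only [lintegral_const, Measure.restrict_apply MeasurableSet.univ, univ_inter, Real.volume_Ioo]
        rw [mul_comm D (_ * _)]
        congr 4
        ring_nf
      · exact hHm
      · exact hHm.const_mul _
      · exact ((hHm.const_mul _).const_mul _).add_const _
      · exact (((hHm.const_mul _).const_mul _).add_const _).const_mul _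
    · exact (((((hHm.comp measurable_snd).const_mul _).const_mul _).add_const _).const_mul _).aemeasurable
  have hlow : ENNReal.ofReal α * I ≤ ∫⁻ x in ann x0 α β, ENNReal.ofReal (‖fderiv ℝ φ x‖^2) := by
    rw [lint_polar x0 hα.le]
    have : ∫⁻ p in Ioo α β ×ˢ Ioo (-π) π, ENNReal.ofReal α * N p ≤ 
      ∫⁻ p in Ioo α β ×ˢ Ioo (-π) π, ENNReal.ofReal p.1 * ENNReal.ofReal (‖fderiv ℝ φ (x0 + p.1 • edir p.2)‖^2) := by
      refine setLIntegral_mono' hms (fun p hp => ?_)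
      rw [hNdef]
      exact mul_le_mul' (ENNReal.ofReal_le_ofReal hp.1.1.le) le_rfl
    refine le_trans (le_of_eq ?_) this
    rw [lintegral_const_mul _ hNm, Measure.volume_eq_prod, setLIntegral_prod _ hNm.aemeasurable, hI, hFθ]
  refine hup.trans (le_trans ?_ (mul_le_mul_right hlow _))
  rw [hK]
  calc D * (ENNReal.ofReal β * (2 * (D * I) + 2 * (ENNReal.ofReal (2*π) * (ENNReal.ofReal (β^2) * Fθ r0)) * ENNReal.ofReal (2*π)))
      = ENNReal.ofReal β * (2 * D * D) * I + ENNReal.ofReal β * (2 * ENNReal.ofReal (2*π) * ENNReal.ofReal (β^2) * ENNReal.ofReal (2*π)) * (D * Fθ r0) := by ring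
    _ ≤ ENNReal.ofReal β * (2 * D * D) * I + ENNReal.ofReal β * (2 * ENNReal.ofReal (2*π) * ENNReal.ofReal (β^2) * ENNReal.ofReal (2*π)) * I := by gcongr
    _ = (ENNReal.ofReal β * (2 * D * D) + ENNReal.ofReal β * (2 * ENNReal.ofReal (2*π) * ENNReal.ofReal (β^2) * ENNReal.ofReal (2*π))) * I := by ring
    _ ≤ (ENNReal.ofReal (200*β^2) * ENNReal.ofReal α) * I := by
        refine mul_le_mul' ?_ le_rfl
        have hd : 0 ≤ β - α := by linarith
        rw [hD, ← ENNReal.ofReal_ofNat 2]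
        simp only [← ENNReal.ofReal_mul (by positivity : (0:ℝ) ≤ 2), ← ENNReal.ofReal_mul (by positivity : (0:ℝ) ≤ 2 * (β-α)),
          ← ENNReal.ofReal_mul (by positivity : (0:ℝ) ≤ 2 * (2*π)), ← ENNReal.ofReal_mul (by positivity : (0:ℝ) ≤ 2 * (2*π)*β^2),
          ← ENNReal.ofReal_mul hβ0.le, ← ENNReal.ofReal_mul (by positivity : (0:ℝ) ≤ 200*β^2)]
        rw [← ENNReal.ofReal_add (by positivity) (by positivity)]
        apply ENNReal.ofReal_le_ofReal
        have hpi : π^2 ≤ 10 := by nlinarith [Real.pi_lt_d2, Real.pi_gt_three]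
        have h1 : (β - α)^2 ≤ β^2/4 := by nlinarith
        have h2 : β * (β-α)^2 ≤ β * (β^2/4) := mul_le_mul_of_nonneg_left h1 hβ0.le
        have h3 : β^3 * π^2 ≤ β^3 * 10 := mul_le_mul_of_nonneg_left hpi (by positivity)
        have h4 : β^2 * β ≤ β^2 * (2*α) := mul_le_mul_of_nonneg_left hβ (by positivity)
        nlinarith [pow_pos hβ0 3]
    _ = _ := by rw [mul_assoc]

theorem poincare (x0 : E2) {α β : ℝ} (hα : 0 < α) (hαβ : α < β) (hβ : β ≤ 2 * α) {φ : E2 → ℝ}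
    (hφ : ∀ x ∈ ann x0 α β, DifferentiableAt ℝ φ x)
    (hintg : IntegrableOn (fun x => ‖fderiv ℝ φ x‖^2) (ann x0 α β)) :
    ∃ c, IntegrableOn (fun x => (φ x - c)^2) (ann x0 α β) ∧
      ∫ x in ann x0 α β, (φ x - c)^2 ≤ 200 * β^2 * ∫ x in ann x0 α β, ‖fderiv ℝ φ x‖^2 := by
  obtain ⟨c, hc⟩ := poincare_l x0 hα hαβ hβ hφ
  have h1 : ∫⁻ x in ann x0 α β, ENNReal.ofReal (‖fderiv ℝ φ x‖^2) = ENNReal.ofReal (∫ x in ann x0 α β, ‖fderiv ℝ φ x‖^2) :=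
    (ofReal_integral_eq_lintegral_ofReal hintg (Eventually.of_forall fun x => by positivity)).symm
  rw [h1, ← ENNReal.ofReal_mul (by positivity)] at hc
  have hcont : ContinuousOn φ (ann x0 α β) := fun x hx => (hφ x hx).continuousAt.continuousWithinAt
  have hi : IntegrableOn (fun x => (φ x - c)^2) (ann x0 α β) := by
    refine ⟨((hcont.sub continuousOn_const).pow 2).aestronglyMeasurable (isOpen_ann x0 α β).measurableSet, ?_⟩
    rw [hasFiniteIntegral_iff_ofReal (Eventually.of_forall fun x => sq_nonneg _)]
    exact lt_of_le_of_lt hc ENNReal.ofReal_lt_top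
  refine ⟨c, hi, ?_⟩
  rw [← ofReal_integral_eq_lintegral_ofReal hi (Eventually.of_forall fun x => sq_nonneg _)] at hc
  refine (ENNReal.ofReal_le_ofReal_iff ?_).1 hc
  have : 0 ≤ ∫ x in ann x0 α β, ‖fderiv ℝ φ x‖^2 := integral_nonneg (fun x => by positivity)
  positivity


/-! ### Detection of the potential, local lifting -/

/-- The localized energy density. -/
def Pd (ε : ℝ) (μ : E2 → ℝ) (v : E2 → E2) (y : E2) : ℝ :=
  (1/2) * gradSq v y + (1/(4*ε^2)) * (‖v y‖^2 - μ y)^2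

lemma Pd_nonneg (ε : ℝ) (μ : E2 → ℝ) (v : E2 → E2) (y : E2) : 0 ≤ Pd ε μ v y := by
  unfold Pd
  have := gradSq_nonneg v y
  positivity

section detectsec
variable {μ : E2 → ℝ} {μrad : ℝ → ℝ} {ρ : ℝ} {f : E2 → E2} {frad : ℝ → ℝ}

lemma integrableOn_Pd (hμ : MuHyp μ μrad ρ) {ε : ℝ} {v : E2 → E2} (hv : MemH1 v) {S : Set E2} (hS : Bornology.IsBounded S) :
    IntegrableOn (Pd ε μ v) S := by
  have h1 : IntegrableOn (fun y => (1/2) * gradSq v y) S := (hv.integrable_gradSq.const_mul (1/2)).integrableOn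
  have hc : Continuous (fun y => (1/(4*ε^2)) * (‖v y‖^2 - μ y)^2) := by
    have := hv.1.continuous
    have := hμ.smooth.continuous
    fun_prop
  have h2 : IntegrableOn (fun y => (1/(4*ε^2)) * (‖v y‖^2 - μ y)^2) S := by
    obtain ⟨r, hr⟩ := hS.subset_closedBall (0:E2)
    exact (hc.continuousOn.integrableOn_compact (isCompact_closedBall (0:E2) r)).mono_set hr
  exact h1.add h2

lemma MuHyp.lip (hμ : MuHyp μ μrad ρ) {r L : ℝ} (hL : ∀ x : E2, ‖x‖ ≤ r → ‖fderiv ℝ μ x‖ ≤ L)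
    {x y : E2} (hx : ‖x‖ ≤ r) (hy : ‖y‖ ≤ r) : |μ y - μ x| ≤ L * ‖y - x‖ := by
  have := (convex_closedBall (0:E2) r).norm_image_sub_le_of_norm_fderiv_le (𝕜 := ℝ) (f := μ) (C := L)
    (fun z _ => hμ.smooth.differentiable (by simp) z) (fun z hz => hL z (by simpa using hz))
    (x := x) (y := y) (by simpa using hx) (by simpa using hy)
  simpa using this

theorem detect (hμ : MuHyp μ μrad ρ) (hf : FHyp f frad) (A0 M : ℝ) (hA0 : 0 ≤ A0) (hM : 1 ≤ M)
    {η : ℝ} (hη : 0 < η) :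
    ∃ l κ : ℝ, 0 < l ∧ l ≤ 1 ∧ 0 < κ ∧ ∀ ε a, 0 < ε → ε ≤ 1 → 0 ≤ a → a ≤ A0 → ∀ v,
      IsMinimizer ε a μ f v → (∀ x, ‖v x‖ ≤ M) → ∀ x, ‖x‖ ≤ ρ → η ≤ |‖v x‖^2 - μ x| →
      ∀ S, MeasurableSet S → Bornology.IsBounded S → Metric.ball x (l*ε) ⊆ S → κ ≤ ∫ y in S, Pd ε μ v y := by
  obtain ⟨L, hL0, hL⟩ := hμ.grad_bdd (ρ + 1)
  have hM0 : 0 < M := by linarith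
  obtain ⟨l1, hl1, hl1', heq⟩ := equicont hμ hf A0 M hA0 hM0.le (δ := η/(8*M)) (by positivity)
  obtain ⟨l, hl⟩ : ∃ l, l = min l1 (η/(4*L)) := ⟨_, rfl⟩
  have hlp : 0 < l := by rw [hl]; positivity
  have hla : l ≤ l1 := by rw [hl]; exact min_le_left _ _
  have hlb : L * l ≤ η/4 := by
    have : l ≤ η/(4*L) := by rw [hl]; exact min_le_right _ _
    calc L * l ≤ L * (η/(4*L)) := by gcongr
      _ = η/4 := by field_simp
  refine ⟨l, η^2/16 * (l^2 * vol1), hlp, hla.trans hl1', ?_, ?_⟩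
  · have := vol1_pos; positivity
  intro ε a hε hε1 ha haA v hv hvM x hx hxη S hS hSb hsub
  have hdev : ∀ y ∈ Metric.ball x (l*ε), η^2/(16*ε^2) ≤ Pd ε μ v y := by
    intro y hy
    have hyx : ‖y - x‖ < l * ε := by simpa [dist_eq_norm] using hy
    have hle : l * ε ≤ 1 := by nlinarith
    have hy1 : ‖y‖ ≤ ρ + 1 := by
      have : y = x + (y - x) := by abel
      rw [this]; exact (norm_add_le _ _).trans (by linarith)
    have h1 := hμ.lip hL (x := x) (y := y) (by linarith) hy1
    have h2 : |μ y - μ x| ≤ η/4 := by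
      refine h1.trans (le_trans ?_ hlb)
      have : ‖y - x‖ ≤ l := by nlinarith
      gcongr
    have h3 : ‖v y - v x‖ ≤ η/(8*M) := heq ε a hε hε1 ha haA v hv hvM y x (hyx.le.trans (by gcongr))
    have h4 : |‖v y‖ - ‖v x‖| ≤ η/(8*M) := (abs_norm_sub_norm_le _ _).trans h3
    have h5 : |‖v y‖^2 - ‖v x‖^2| ≤ η/4 := by
      have : ‖v y‖^2 - ‖v x‖^2 = (‖v y‖ - ‖v x‖) * (‖v y‖ + ‖v x‖) := by ring
      rw [this, abs_mul, abs_of_nonneg (by positivity : 0 ≤ ‖v y‖ + ‖v x‖)]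
      calc _ ≤ η/(8*M) * (2*M) := by
            gcongr
            linarith [hvM x, hvM y]
        _ = η/4 := by field_simp; ring
    have h6 : η/2 ≤ |‖v y‖^2 - μ y| := by
      have e : ‖v x‖^2 - μ x = (‖v y‖^2 - μ y) - (‖v y‖^2 - ‖v x‖^2) + (μ y - μ x) := by ring
      rw [e] at hxη
      have := abs_add_le ((‖v y‖^2 - μ y) - (‖v y‖^2 - ‖v x‖^2)) (μ y - μ x)
      have := abs_sub (‖v y‖^2 - μ y) (‖v y‖^2 - ‖v x‖^2)
      linarith
    have h7 : η^2/4 ≤ (‖v y‖^2 - μ y)^2 := by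
      rw [← sq_abs (‖v y‖^2 - μ y)]
      nlinarith
    have h8 := gradSq_nonneg v y
    unfold Pd
    calc η^2/(16*ε^2) = (1/(4*ε^2)) * (η^2/4) := by field_simp; ring
      _ ≤ (1/(4*ε^2)) * (‖v y‖^2 - μ y)^2 := by gcongr
      _ ≤ _ := by linarith
  have hI := integrableOn_Pd (ε := ε) hμ hv.1 hSb
  have hb : ∫ y in Metric.ball x (l*ε), η^2/(16*ε^2) ≤ ∫ y in Metric.ball x (l*ε), Pd ε μ v y := by
    refine setIntegral_mono_on ?_ (hI.mono_set hsub) measurableSet_ball hdev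
    exact integrableOn_const (measure_ball_lt_top.ne)
  rw [setIntegral_const, vol_ball x (by positivity), smul_eq_mul] at hb
  have hm : ∫ y in Metric.ball x (l*ε), Pd ε μ v y ≤ ∫ y in S, Pd ε μ v y :=
    setIntegral_mono_set hI (Eventually.of_forall fun y => Pd_nonneg _ _ _ _) (HasSubset.Subset.eventuallyLE hsub)
  refine le_trans (le_of_eq ?_) (hb.trans hm)
  field_simp

end detectsec

lemma lift_exists {v : E2 → E2} (hv : Differentiable ℝ v) (x0 : E2) {r : ℝ} (hr : 0 < r)
    (hnz : ∀ x ∈ Metric.ball x0 r, v x ≠ 0) :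
    ∃ g : E2 → ℂ, ∀ x ∈ Metric.ball x0 r, Complex.exp (g x) = iota (v x) ∧ DifferentiableAt ℝ g x := by
  have hsc : IsSimplyConnected (Metric.ball x0 r) := by
    have : ContractibleSpace (Metric.ball x0 r) :=
      (convex_ball x0 r).contractibleSpace ⟨x0, Metric.mem_ball_self hr⟩
    unfold IsSimplyConnected
    infer_instance
  have hic : Continuous (fun x => iota (v x)) := iota.continuous.comp hv.continuous
  obtain ⟨g, hgc, hg⟩ := Complex.exists_continuousOn_eqOn_exp_comp hsc Metric.isOpen_ball
    (g := fun x => iota (v x)) hic.continuousOn (by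
      rintro ⟨x, hx, h⟩
      exact hnz x hx (by simpa using h))
  have hg' : ∀ x ∈ Metric.ball x0 r, Complex.exp (g x) = iota (v x) := fun x hx => hg hx
  refine ⟨g, fun x hx => ⟨hg' x hx, ?_⟩⟩
  have hne : iota (v x) ≠ 0 := by
    rw [← hg' x hx]; exact Complex.exp_ne_zero _
  have hgx : ContinuousAt g x := hgc.continuousAt (Metric.isOpen_ball.mem_nhds hx)
  have hev : (fun y => g x + Complex.log (iota (v y) / iota (v x))) =ᶠ[𝓝 x] g := by
    have h1 : ∀ᶠ y in 𝓝 x, |(g y - g x).im| < π := by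
      have : ContinuousAt (fun y => |(g y - g x).im|) x := by fun_prop
      apply this.eventually_lt continuousAt_const
      simpa using Real.pi_pos
    filter_upwards [h1, Metric.isOpen_ball.mem_nhds hx] with y hy hyb
    rw [← hg' x hx, ← hg' y hyb, ← Complex.exp_sub, Complex.log_exp]
    · ring
    · exact (abs_lt.1 hy).1
    · exact (abs_lt.1 hy).2.le
  refine DifferentiableAt.congr_of_eventuallyEq ?_ hev.symm
  have hd : DifferentiableAt ℝ (fun y => iota (v y) / iota (v x)) x := by
    have h2 : DifferentiableAt ℝ (fun y => iota (v y)) x :=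
      iota.toContinuousLinearEquiv.differentiableAt.comp x (hv x)
    simp only [div_eq_mul_inv]
    exact h2.mul_const _
  have hl : DifferentiableAt ℝ Complex.log (iota (v x) / iota (v x)) := by
    rw [div_self hne]
    exact (Complex.hasStrictDerivAt_log (by simp)).hasDerivAt.differentiableAt.restrictScalars ℝ
  have hc : DifferentiableAt ℝ (fun y => Complex.log (iota (v y) / iota (v x))) x :=
    DifferentiableAt.comp (g := Complex.log) x hl hd
  exact (differentiableAt_const _).add hc

lemma gradSq_exp {u : E2 → E2} {G : E2 → ℂ} {G' : E2 →L[ℝ] ℂ} {x : E2} (hG : HasFDerivAt G G' x)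
    (hu : ∀ᶠ y in 𝓝 x, u y = iota.symm (Complex.exp (G y))) :
    DifferentiableAt ℝ u x ∧ gradSq u x = ‖u x‖^2 * ∑ i : Fin 2, ‖G' (e2basis i)‖^2 := by
  have h1 : HasFDerivAt (fun y => Complex.exp (G y)) (Complex.exp (G x) • G') x := hG.cexp
  have h2 : HasFDerivAt (fun y => iota.symm (Complex.exp (G y)))
      ((iota.symm.toContinuousLinearEquiv : ℂ →L[ℝ] E2).comp (Complex.exp (G x) • G')) x :=
    iota.symm.toContinuousLinearEquiv.hasFDerivAt.comp x h1
  have h3 := h2.congr_of_eventuallyEq hu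
  refine ⟨h3.differentiableAt, ?_⟩
  have hn : ‖u x‖ = ‖Complex.exp (G x)‖ := by rw [hu.self_of_nhds, LinearIsometryEquiv.norm_map]
  unfold gradSq
  rw [h3.fderiv, Finset.mul_sum]
  refine Finset.sum_congr rfl fun i _ => ?_
  rw [hn, ← mul_pow]
  congr 1
  have : ((iota.symm.toContinuousLinearEquiv : ℂ →L[ℝ] E2).comp (Complex.exp (G x) • G')) (e2basis i)
    = iota.symm (Complex.exp (G x) * G' (e2basis i)) := rfl
  rw [this, LinearIsometryEquiv.norm_map, norm_mul]

lemma smoothTransition_deriv_zero {t : ℝ} (h : t ≤ 0 ∨ 1 ≤ t) : deriv Real.smoothTransition t = 0 := by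
  rcases h with h | h
  · apply IsLocalMin.deriv_eq_zero
    filter_upwards with s
    rw [Real.smoothTransition.zero_of_nonpos h]
    exact Real.smoothTransition.nonneg s
  · apply IsLocalMax.deriv_eq_zero
    filter_upwards with s
    rw [Real.smoothTransition.one_of_one_le h]
    exact Real.smoothTransition.le_one s

lemma log_half_sq {t m : ℝ} (hm : 0 < m) (ht : m/2 ≤ t) :
    ((1/2) * Real.log t - (1/2) * Real.log m)^2 ≤ (t - m)^2/m^2 := by
  have ht0 : 0 < t := by linarith
  have e : (1/2) * Real.log t - (1/2) * Real.log m = (1/2) * Real.log (t/m) := by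
    rw [Real.log_div ht0.ne' hm.ne']; ring
  obtain ⟨s, hs⟩ : ∃ s, s = t/m := ⟨_, rfl⟩
  have hts : t = s * m := by rw [hs]; field_simp
  have hs2 : 1/2 ≤ s := by rw [hs, le_div_iff₀ hm]; linarith
  have e2 : (t - m)^2/m^2 = (s - 1)^2 := by rw [hts]; field_simp
  rw [e, ← hs, e2]
  have h1 := Real.log_le_sub_one_of_pos (by linarith : 0 < s)
  have h2 := Real.log_le_sub_one_of_pos (by positivity : 0 < s⁻¹)
  rw [Real.log_inv] at h2
  have h3 : |(1/2) * Real.log s| ≤ |s - 1| := by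
    rcases le_total 1 s with h | h
    · rw [abs_of_nonneg (by linarith : 0 ≤ s - 1), abs_le]
      constructor
      · linarith [Real.log_nonneg h]
      · linarith
    · rw [abs_of_nonpos (by linarith : s - 1 ≤ 0), abs_le]
      have h4 : s⁻¹ - 1 ≤ 2 * (1 - s) := by
        have : s⁻¹ - 1 = (1 - s) * s⁻¹ := by field_simp
        rw [this]
        have h5 : s⁻¹ ≤ 2 := by
          rw [inv_le_comm₀ (by linarith) (by norm_num)]; linarith
        nlinarith
      constructor
      · linarith
      · linarith [Real.log_nonpos (by linarith) h]
  exact sq_le_sq.2 h3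

lemma exp_interp {t m χ : ℝ} (hm : 0 < m) (ht : 0 < t) (h0 : 0 ≤ χ) (h1 : χ ≤ 1) :
    let W := Real.exp (2 * ((1/2) * Real.log m + χ * ((1/2) * Real.log t - (1/2) * Real.log m)))
    min m t ≤ W ∧ W ≤ max m t := by
  intro W
  have e : 2 * ((1/2) * Real.log m + χ * ((1/2) * Real.log t - (1/2) * Real.log m)) =
    (1 - χ) * Real.log m + χ * Real.log t := by ring
  have hW : W = Real.exp ((1 - χ) * Real.log m + χ * Real.log t) := by rw [← e]
  rw [hW]
  rcases le_total m t with h | h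
  · have hl := Real.log_le_log hm h
    rw [min_eq_left h, max_eq_right h]
    constructor
    · conv_lhs => rw [← Real.exp_log hm]
      apply Real.exp_le_exp.2; nlinarith
    · conv_rhs => rw [← Real.exp_log ht]
      apply Real.exp_le_exp.2; nlinarith
  · have hl := Real.log_le_log ht h
    rw [min_eq_right h, max_eq_left h]
    constructor
    · conv_lhs => rw [← Real.exp_log ht]
      apply Real.exp_le_exp.2; nlinarith
    · conv_rhs => rw [← Real.exp_log hm]
      apply Real.exp_le_exp.2; nlinarith


/-! ### The competitor on a disc and the annulus lemma -/

lemma cutoff_exists : ∃ X : ℝ, 0 < X ∧ ∀ (x0 : E2) (α β : ℝ), 0 < α → α < β →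
    ∃ (χ : E2 → ℝ) (χ' : E2 → (E2 →L[ℝ] ℝ)), ∀ y, HasFDerivAt χ (χ' y) y ∧ 0 ≤ χ y ∧ χ y ≤ 1 ∧
      (‖y - x0‖ ≤ α → χ y = 0 ∧ χ' y = 0) ∧ (β ≤ ‖y - x0‖ → χ y = 1 ∧ χ' y = 0) ∧ ‖χ' y‖ ≤ X/(β - α) := by
  obtain ⟨C, hC, hCb⟩ := smoothTransition_deriv_bdd
  refine ⟨2*C, by positivity, fun x0 α β hα hαβ => ?_⟩
  have hD : 0 < β^2 - α^2 := by nlinarith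
  obtain ⟨s, hs⟩ : ∃ s : E2 → ℝ, s = fun y => (‖y - x0‖^2 - α^2)/(β^2-α^2) := ⟨_, rfl⟩
  obtain ⟨s', hs'⟩ : ∃ s' : E2 → (E2 →L[ℝ] ℝ), s' = fun y => (β^2-α^2)⁻¹ • ((2:ℝ) • innerSL ℝ (y - x0)) := ⟨_, rfl⟩
  have hds : ∀ y, HasFDerivAt s (s' y) y := by
    intro y
    rw [hs, hs']
    have h1 : HasFDerivAt (fun y : E2 => y - x0) (ContinuousLinearMap.id ℝ E2) y := (hasFDerivAt_id y).sub_const x0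
    have h2 := ((h1.norm_sq).sub_const (α^2)).mul_const ((β^2-α^2)⁻¹)
    simp only [div_eq_mul_inv]
    refine HasFDerivAt.congr_fderiv h2 ?_
    ext z
    simp [mul_comm, mul_assoc, two_mul]
  refine ⟨fun y => Real.smoothTransition (s y), fun y => deriv Real.smoothTransition (s y) • s' y, fun y => ?_⟩
  have hneg : ‖y - x0‖ ≤ α → s y ≤ 0 := by
    intro h
    rw [hs]
    apply div_nonpos_of_nonpos_of_nonneg _ hD.le
    have := pow_le_pow_left₀ (norm_nonneg _) h 2
    linarith
  have hone : β ≤ ‖y - x0‖ → 1 ≤ s y := by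
    intro h
    simp only [hs]
    rw [le_div_iff₀ hD]
    have := pow_le_pow_left₀ (by linarith) h 2
    linarith
  refine ⟨?_, Real.smoothTransition.nonneg _, Real.smoothTransition.le_one _, ?_, ?_, ?_⟩
  · have hd : DifferentiableAt ℝ Real.smoothTransition (s y) :=
      (Real.smoothTransition.contDiff (n := 1)).differentiable (by simp) _
    exact hd.hasDerivAt.comp_hasFDerivAt y (hds y)
  · intro h
    refine ⟨Real.smoothTransition.zero_of_nonpos (hneg h), ?_⟩
    simp only [smoothTransition_deriv_zero (Or.inl (hneg h)), zero_smul]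
  · intro h
    refine ⟨Real.smoothTransition.one_of_one_le (hone h), ?_⟩
    simp only [smoothTransition_deriv_zero (Or.inr (hone h)), zero_smul]
  · rcases le_or_gt β ‖y - x0‖ with h | h
    · simp only [smoothTransition_deriv_zero (Or.inr (hone h)), zero_smul, norm_zero]
      have : 0 < β - α := by linarith
      positivity
    · have hsn : ‖s' y‖ ≤ 2/(β - α) := by
        rw [hs', norm_smul, norm_smul, innerSL_apply_norm, Real.norm_of_nonneg (by positivity), Real.norm_of_nonneg (by norm_num)]
        have hba : 0 < β - α := by linarith
        have e : β^2 - α^2 = (β - α) * (β + α) := by ring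
        rw [e, mul_inv]
        have : (β + α)⁻¹ * ‖y - x0‖ ≤ 1 := by
          rw [inv_mul_le_iff₀ (by linarith)]; linarith
        calc (β - α)⁻¹ * (β + α)⁻¹ * (2 * ‖y - x0‖) = 2/(β-α) * ((β + α)⁻¹ * ‖y - x0‖) := by
              rw [div_eq_mul_inv]; ring
          _ ≤ 2/(β-α) * 1 := by gcongr
          _ = _ := by ring
      rw [norm_smul, Real.norm_eq_abs]
      calc _ ≤ C * (2/(β-α)) := mul_le_mul (hCb _) hsn (norm_nonneg _) hC.le
        _ = _ := by ring

set_option maxHeartbeats 1000000 in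
lemma comp_point {μ : E2 → ℝ} (hμd : Differentiable ℝ μ) {v u : E2 → E2} {g : E2 → ℂ} {g' : E2 →L[ℝ] ℂ}
    {χ : E2 → ℝ} {χ' : E2 →L[ℝ] ℝ} {y : E2} {c m0 L : ℝ} (hm0 : 0 < m0) (hm : m0 ≤ μ y)
    (hL : ‖fderiv ℝ μ y‖ ≤ L) (hg : HasFDerivAt g g' y)
    (hgv : ∀ᶠ z in 𝓝 y, v z = iota.symm (Complex.exp (g z)))
    (hχ : HasFDerivAt χ χ' y) (hχ0 : 0 ≤ χ y) (hχ1 : χ y ≤ 1)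
    (hu : ∀ᶠ z in 𝓝 y, u z = iota.symm (Complex.exp ((((1/2) * Real.log (μ z) : ℝ) + c * Complex.I) +
      χ z * (g z - (((1/2) * Real.log (μ z) : ℝ) + c * Complex.I))))) :
    DifferentiableAt ℝ u y ∧ min (μ y) (‖v y‖^2) ≤ ‖u y‖^2 ∧ ‖u y‖^2 ≤ max (μ y) (‖v y‖^2) ∧
    (χ y = 0 → ‖u y‖^2 = μ y) ∧ (χ y = 1 → ‖u y‖^2 = ‖v y‖^2) ∧
    0 < ‖v y‖^2 ∧ gradSq v y = ‖v y‖^2 * ∑ i : Fin 2, ‖g' (e2basis i)‖^2 ∧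
    gradSq u y ≤ 3 * ‖u y‖^2 * ((1 - χ y)^2 * (L^2/(2*m0^2)) + (χ y)^2 * (gradSq v y / ‖v y‖^2) +
      2 * ‖χ'‖^2 * (((1/2) * Real.log (‖v y‖^2) - (1/2) * Real.log (μ y))^2 + ((g y).im - c)^2)) := by
  have hmp : 0 < μ y := by linarith
  obtain ⟨_, hgv2⟩ := gradSq_exp hg hgv
  have hvn : ‖v y‖ = Real.exp (g y).re := by
    rw [hgv.self_of_nhds, LinearIsometryEquiv.norm_map, Complex.norm_exp]
  have hvpos : 0 < ‖v y‖^2 := by rw [hvn]; positivity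
  have hre : (g y).re = (1/2) * Real.log (‖v y‖^2) := by
    rw [hvn, ← Real.exp_nat_mul, Real.log_exp]; push_cast; ring
  -- derivative of h
  obtain ⟨h, hh⟩ : ∃ h : E2 → ℂ, h = fun z => (((1/2) * Real.log (μ z) : ℝ) + c * Complex.I) := ⟨_, rfl⟩
  obtain ⟨h', hh'⟩ : ∃ h' : E2 →L[ℝ] ℂ, h' = Complex.ofRealCLM.comp ((1/2:ℝ) • ((μ y)⁻¹ • fderiv ℝ μ y)) := ⟨_, rfl⟩
  have hhd : HasFDerivAt h h' y := by
    rw [hh, hh']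
    have h1 : HasFDerivAt (fun z => (1/2) * Real.log (μ z)) ((1/2:ℝ) • ((μ y)⁻¹ • fderiv ℝ μ y)) y :=
      ((hμd y).hasFDerivAt.log hmp.ne').const_mul (1/2)
    exact (Complex.ofRealCLM.hasFDerivAt.comp y h1).add_const _
  have hhb : ∀ i, ‖h' (e2basis i)‖^2 ≤ L^2/(4*m0^2) := by
    intro i
    have e : h' (e2basis i) = (((1/2:ℝ) * ((μ y)⁻¹ * fderiv ℝ μ y (e2basis i)) : ℝ) : ℂ) := by
      rw [hh']; rfl
    rw [e, Complex.norm_real, Real.norm_eq_abs, sq_abs]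
    have h1 := (norm_basis_le (fderiv ℝ μ y) i).trans hL
    have h2 : (fderiv ℝ μ y (e2basis i))^2 ≤ L^2 := by
      rw [← sq_abs]; exact pow_le_pow_left₀ (abs_nonneg _) h1 2
    have h3 : ((μ y)⁻¹)^2 ≤ (m0⁻¹)^2 := by gcongr
    calc _ = (1/4) * (((μ y)⁻¹)^2 * (fderiv ℝ μ y (e2basis i))^2) := by ring
      _ ≤ (1/4) * ((m0⁻¹)^2 * L^2) := by gcongr
      _ = _ := by field_simp
  have hGd : HasFDerivAt (fun z => h z + (χ z : ℂ) * (g z - h z))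
      (h' + ((χ y : ℂ) • (g' - h') + (g y - h y) • (Complex.ofRealCLM.comp χ'))) y := by
    have h1 : HasFDerivAt (fun z => (χ z : ℂ)) (Complex.ofRealCLM.comp χ') y := Complex.ofRealCLM.hasFDerivAt.comp y hχ
    exact hhd.add (h1.mul (hg.sub hhd))
  have hu' : ∀ᶠ z in 𝓝 y, u z = iota.symm (Complex.exp (h z + (χ z : ℂ) * (g z - h z))) := by
    rw [hh]; exact hu
  obtain ⟨hud, hugrad⟩ := gradSq_exp hGd hu'
  have hun : ‖u y‖^2 = Real.exp (2 * ((1/2) * Real.log (μ y) + χ y * ((1/2) * Real.log (‖v y‖^2) - (1/2) * Real.log (μ y)))) := by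
    rw [hu'.self_of_nhds, LinearIsometryEquiv.norm_map, Complex.norm_exp, ← Real.exp_nat_mul]
    congr 1
    rw [← hre, hh]
    simp
  have hintg := exp_interp hmp hvpos hχ0 hχ1
  simp only [] at hintg
  rw [← hun] at hintg
  refine ⟨hud, hintg.1, hintg.2, ?_, ?_, hvpos, hgv2, ?_⟩
  · intro h0
    rw [hun, h0, zero_mul, add_zero, ← mul_assoc]
    norm_num
    exact Real.exp_log hmp
  · intro h0
    rw [hun, h0, one_mul, add_sub_cancel, ← mul_assoc]
    norm_num [-Real.log_pow]
    exact Real.exp_log hvpos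
  · rw [hugrad]
    have hgh : ‖g y - h y‖^2 = ((1/2) * Real.log (‖v y‖^2) - (1/2) * Real.log (μ y))^2 + ((g y).im - c)^2 := by
      rw [← Complex.normSq_eq_norm_sq, Complex.normSq_apply, ← hre, hh]
      simp
      ring
    have hterm : ∀ i : Fin 2, ‖(h' + ((χ y : ℂ) • (g' - h') + (g y - h y) • (Complex.ofRealCLM.comp χ'))) (e2basis i)‖^2 ≤
        3 * ((1 - χ y)^2 * (L^2/(4*m0^2)) + (χ y)^2 * ‖g' (e2basis i)‖^2 + ‖χ'‖^2 * ‖g y - h y‖^2) := by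
      intro i
      obtain ⟨b, hb⟩ : ∃ b, b = e2basis i := ⟨_, rfl⟩
      have e : (h' + ((χ y : ℂ) • (g' - h') + (g y - h y) • (Complex.ofRealCLM.comp χ'))) (e2basis i) =
          ((1 - χ y : ℝ) : ℂ) * h' (e2basis i) + (χ y : ℂ) * g' (e2basis i) + (g y - h y) * (χ' (e2basis i) : ℂ) := by
        have e0 : (h' + ((χ y : ℂ) • (g' - h') + (g y - h y) • (Complex.ofRealCLM.comp χ'))) (e2basis i) =
          h' (e2basis i) + ((χ y : ℂ) * (g' (e2basis i) - h' (e2basis i)) + (g y - h y) * (χ' (e2basis i) : ℂ)) := rfl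
        rw [e0]; push_cast; ring
      rw [e]
      have hn := norm_add₃_le (a := ((1 - χ y : ℝ) : ℂ) * h' (e2basis i)) (b := (χ y : ℂ) * g' (e2basis i)) (c := (g y - h y) * (χ' (e2basis i) : ℂ))
      rw [norm_mul, norm_mul, norm_mul, Complex.norm_real, Complex.norm_real, Complex.norm_real, Real.norm_of_nonneg hχ0,
        Real.norm_of_nonneg (by linarith)] at hn
      have hn2 := pow_le_pow_left₀ (norm_nonneg _) hn 2
      have hp := norm_basis_le χ' i
      have hp2 : ‖χ' (e2basis i)‖^2 ≤ ‖χ'‖^2 := pow_le_pow_left₀ (norm_nonneg _) hp 2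
      have hA : (1 - χ y)^2 * ‖h' (e2basis i)‖^2 ≤ (1 - χ y)^2 * (L^2/(4*m0^2)) := mul_le_mul_of_nonneg_left (hhb i) (sq_nonneg _)
      have hB : ‖g y - h y‖^2 * ‖χ' (e2basis i)‖^2 ≤ ‖g y - h y‖^2 * ‖χ'‖^2 := mul_le_mul_of_nonneg_left hp2 (sq_nonneg _)
      obtain ⟨A, hA'⟩ : ∃ A, A = (1 - χ y) * ‖h' (e2basis i)‖ := ⟨_, rfl⟩
      obtain ⟨B, hB'⟩ : ∃ B, B = χ y * ‖g' (e2basis i)‖ := ⟨_, rfl⟩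
      obtain ⟨D, hD'⟩ : ∃ D, D = ‖g y - h y‖ * ‖χ' (e2basis i)‖ := ⟨_, rfl⟩
      rw [← hA', ← hB', ← hD'] at hn2
      rw [← mul_pow, ← hA'] at hA
      rw [← mul_pow, ← hD'] at hB
      rw [← mul_pow (χ y), ← hB']
      have : (A + B + D)^2 ≤ 3 * (A^2 + B^2 + D^2) := by
        nlinarith [sq_nonneg (A - B), sq_nonneg (B - D), sq_nonneg (A - D)]
      linarith
    have hsum := Finset.sum_le_sum (fun i (_ : i ∈ Finset.univ) => hterm i)
    have hgs : gradSq v y / ‖v y‖^2 = ∑ i : Fin 2, ‖g' (e2basis i)‖^2 := by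
      rw [hgv2, mul_div_cancel_left₀ _ hvpos.ne']
    have hnn : 0 ≤ ‖u y‖^2 := by positivity
    have h5 := mul_le_mul_of_nonneg_left hsum hnn
    refine h5.trans (le_of_eq ?_)
    rw [hgs, ← hgh, Fin.sum_univ_two, Fin.sum_univ_two]
    field_simp
    ring


section annulussec
variable {μ : E2 → ℝ} {μrad : ℝ → ℝ} {ρ : ℝ} {f : E2 → E2} {frad : ℝ → ℝ}

lemma ann_alg1 {gs U t m L m0 G M Q : ℝ} (hU : U = m) (hm : m ≤ M^2) (hL : 0 ≤ L^2/(2*m0^2))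
    (h : gs ≤ 3 * U * ((1 - 0)^2 * (L^2/(2*m0^2)) + (0:ℝ)^2 * (G/t) + 2 * (0:ℝ)^2 * Q)) :
    gs ≤ 3 * M^2 * (L^2/(2*m0^2)) := by
  subst hU
  have h1 : gs ≤ 3 * (U * (L^2/(2*m0^2))) := by
    refine h.trans (le_of_eq ?_); ring
  have := mul_le_mul_of_nonneg_right hm hL
  linarith

lemma ann_alg2 {gs U t L m0 G M : ℝ} (hU : U = t) (ht : 0 < t)
    (h : gs ≤ 3 * U * ((1 - 1)^2 * (L^2/(2*m0^2)) + (1:ℝ)^2 * (G/t) + 2 * (0:ℝ)^2 * M)) :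
    gs ≤ 3 * G := by
  subst hU
  refine h.trans (le_of_eq ?_)
  field_simp
  ring

lemma ann_alg3 {gs U t m L m0 G M χ N X d ε Λ φ : ℝ} (hUM : U ≤ M^2) (hU0 : 0 ≤ U) (hUt : U ≤ 2 * t) (ht : 0 < t)
    (hm0 : 0 < m0) (hm : m0 ≤ m)
    (hG : 0 ≤ G) (h0 : 0 ≤ χ) (h1 : χ ≤ 1) (hN0 : 0 ≤ N) (hd : 0 < d) (hN : N ≤ X/d) (hε : 0 < ε) (hεd : ε ≤ d)
    (hΛ : Λ ≤ (t - m)^2/m^2)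
    (h : gs ≤ 3 * U * ((1 - χ)^2 * (L^2/(2*m0^2)) + χ^2 * (G/t) + 2 * N^2 * (Λ + φ^2))) :
    gs ≤ 3 * M^2 * (L^2/(2*m0^2)) + 6 * G + 6 * M^2*X^2 / m0^2 * ((t - m)^2/ε^2) + 6 * M^2 * X^2/d^2 * φ^2 := by
  have hA : 0 ≤ L^2/(2*m0^2) := by positivity
  have hχ1 : (1 - χ)^2 ≤ 1 := by nlinarith
  have hχ2 : χ^2 ≤ 1 := by nlinarith
  have hN2 : N^2 ≤ X^2/d^2 := by rw [← div_pow]; exact pow_le_pow_left₀ hN0 hN 2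
  have hΛ2 : Λ ≤ (t-m)^2/m0^2 := hΛ.trans (by gcongr)
  have b1 : U * ((1 - χ)^2 * (L^2/(2*m0^2))) ≤ M^2 * (1 * (L^2/(2*m0^2))) := by gcongr
  have b2 : U * (χ^2 * (G/t)) ≤ 2 * G := by
    have : 0 ≤ G/t := by positivity
    calc U * (χ^2 * (G/t)) ≤ (2 * t) * (1 * (G/t)) := by gcongr
      _ = 2 * G := by field_simp
  have b3 : U * (N^2 * Λ) ≤ M^2 * (X^2 / ε^2 * ((t-m)^2/m0^2)) := by
    have : X^2/d^2 ≤ X^2/ε^2 := by gcongr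
    have h3 : N^2 * Λ ≤ X^2 / ε^2 * ((t-m)^2/m0^2) := by
      calc N^2 * Λ ≤ N^2 * ((t-m)^2/m0^2) := by gcongr
        _ ≤ _ := by gcongr; linarith
    calc U * (N^2 * Λ) ≤ U * (X^2 / ε^2 * ((t-m)^2/m0^2)) := by gcongr
      _ ≤ _ := by gcongr
  have b4 : U * (N^2 * φ^2) ≤ M^2 * (X^2/d^2 * φ^2) := by gcongr
  have e : 3 * U * ((1 - χ)^2 * (L^2/(2*m0^2)) + χ^2 * (G/t) + 2 * N^2 * (Λ + φ^2)) =
    3 * (U * ((1 - χ)^2 * (L^2/(2*m0^2)))) + 3 * (U * (χ^2 * (G/t))) + 6 * (U * (N^2 * Λ)) + 6 * (U * (N^2 * φ^2)) := by ring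
  rw [e] at h
  have e2 : 6 * M^2*X^2 / m0^2 * ((t - m)^2/ε^2) = 6 * (M^2 * (X^2 / ε^2 * ((t-m)^2/m0^2))) := by
    ring
  have e3 : 6 * M^2 * X^2/d^2 * φ^2 = 6 * (M^2 * (X^2/d^2 * φ^2)) := by ring
  rw [e2, e3]
  linarith

lemma dens_id2 (ε a : ℝ) (hε : 0 < ε) (μ : E2 → ℝ) (f u : E2 → E2) (x : E2) :
    dens ε a μ f u x = Pd ε μ u x - (1/(4*ε^2)) * (μ x)^2 - (a/ε) * inner ℝ (f x) (u x) := by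
  unfold dens Pd
  field_simp
  ring

end annulussec


section competitorsec
variable {μ : E2 → ℝ} {μrad : ℝ → ℝ} {ρ : ℝ} {f : E2 → E2} {frad : ℝ → ℝ}

lemma between_sq {U t m : ℝ} (h1 : min m t ≤ U) (h2 : U ≤ max m t) : (U - m)^2 ≤ (t - m)^2 := by
  rcases le_total m t with h | h
  · rw [min_eq_left h] at h1; rw [max_eq_right h] at h2; nlinarith
  · rw [min_eq_right h] at h1; rw [max_eq_left h] at h2; nlinarith

set_option maxHeartbeats 1000000 in
lemma competitor {X : ℝ} (hX0 : 0 < X) (hX : ∀ (x0 : E2) (α β : ℝ), 0 < α → α < β →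
    ∃ (χ : E2 → ℝ) (χ' : E2 → (E2 →L[ℝ] ℝ)), ∀ y, HasFDerivAt χ (χ' y) y ∧ 0 ≤ χ y ∧ χ y ≤ 1 ∧
      (‖y - x0‖ ≤ α → χ y = 0 ∧ χ' y = 0) ∧ (β ≤ ‖y - x0‖ → χ y = 1 ∧ χ' y = 0) ∧ ‖χ' y‖ ≤ X/(β - α))
    (hμd : Differentiable ℝ μ) {v : E2 → E2} (hv : Differentiable ℝ v) {g : E2 → ℂ} {x0 : E2} {R α β r ε c m0 M L : ℝ}
    (hR : 0 < R) (hRα : R < α) (hαβ : α < β) (hβr : β < r) (hε : 0 < ε) (hεd : ε ≤ 2 * (β - α)) (hm0 : 0 < m0) (hM : 0 ≤ M)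
    (hg : ∀ x ∈ Metric.ball x0 r, Complex.exp (g x) = iota (v x) ∧ DifferentiableAt ℝ g x)
    (hm : ∀ y ∈ Metric.ball x0 r, m0 ≤ μ y ∧ μ y ≤ M^2 ∧ ‖fderiv ℝ μ y‖ ≤ L ∧ ‖v y‖ ≤ M)
    (hT : ∀ y ∈ ann x0 α β, μ y / 2 ≤ ‖v y‖^2) :
    ∃ u : E2 → E2, Differentiable ℝ u ∧ (∀ y, y ∉ Metric.ball x0 r → u y = v y ∧ gradSq u y = gradSq v y) ∧
      ∀ y ∈ Metric.ball x0 r, ‖u y‖ ≤ M ∧ Pd ε μ u y ≤ 3 * M^2 * (L^2/(2*m0^2)) +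
        (7 + 48 * M^2 * X^2/m0^2) * indicator (ann x0 R r) (Pd ε μ v) y +
        3 * M^2 * X^2/(β - α)^2 * indicator (ann x0 α β) (fun y => ((g y).im - c)^2) y := by
  classical
  obtain ⟨χ, χ', hχ⟩ := hX x0 α β (hR.trans hRα) hαβ
  have hba : 0 < β - α := by linarith
  obtain ⟨w, hw⟩ : ∃ w : E2 → E2, w = fun z => iota.symm (Complex.exp ((((1/2) * Real.log (μ z) : ℝ) + c * Complex.I) +
      χ z * (g z - (((1/2) * Real.log (μ z) : ℝ) + c * Complex.I)))) := ⟨_, rfl⟩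
  obtain ⟨u, hu⟩ : ∃ u : E2 → E2, u = fun z => if z ∈ Metric.ball x0 r then w z else v z := ⟨_, rfl⟩
  have mem : ∀ y, y ∈ Metric.ball x0 r ↔ ‖y - x0‖ < r := fun y => by simp [dist_eq_norm]
  have hin : ∀ y ∈ Metric.ball x0 r, ∀ᶠ z in 𝓝 y, u z = w z := by
    intro y hy
    filter_upwards [Metric.isOpen_ball.mem_nhds hy] with z hz
    simp only [hu]; rw [if_pos hz]
  have hgv : ∀ y ∈ Metric.ball x0 r, v y = iota.symm (Complex.exp (g y)) := by
    intro y hy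
    rw [(hg y hy).1]; simp
  have hout0 : ∀ y, β < ‖y - x0‖ → u y = v y := by
    intro y hy
    simp only [hu]
    split_ifs with h
    · rw [hgv y h, hw]
      simp only [((hχ y).2.2.2.2.1 hy.le).1]
      congr 2
      push_cast
      ring
    · rfl
  have hout : ∀ y, y ∉ Metric.ball x0 r → u =ᶠ[𝓝 y] v := by
    intro y hy
    rw [mem, not_lt] at hy
    have hc : Continuous (fun z : E2 => ‖z - x0‖) := by fun_prop
    filter_upwards [(isOpen_lt continuous_const hc).mem_nhds (show y ∈ {z : E2 | β < ‖z - x0‖} from by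
      show β < ‖y - x0‖
      linarith)] with z hz
    exact hout0 z hz
  have key : ∀ y (hy : y ∈ Metric.ball x0 r), _ := fun y hy =>
    comp_point (u := u) (v := v) (g := g) (g' := fderiv ℝ g y) (χ := χ) (χ' := χ' y) (c := c) (L := L) hμd hm0 (hm y hy).1 (hm y hy).2.2.1
      (hg y hy).2.hasFDerivAt (by
        filter_upwards [Metric.isOpen_ball.mem_nhds hy] with z hz
        exact hgv z hz) (hχ y).1 (hχ y).2.1 (hχ y).2.2.1 (by
        filter_upwards [hin y hy] with z hz
        rw [hz, hw])
  refine ⟨u, ?_, ?_, ?_⟩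
  · intro y
    by_cases hy : y ∈ Metric.ball x0 r
    · exact (key y hy).1
    · exact (hv y).congr_of_eventuallyEq (hout y hy)
  · intro y hy
    refine ⟨(hout y hy).self_of_nhds, ?_⟩
    unfold gradSq
    rw [(hout y hy).fderiv_eq]
  · intro y hy
    obtain ⟨_, k1, k2, k3, k4, k5, _, k7⟩ := key y hy
    obtain ⟨hm1, hm2, hm3, hm4⟩ := hm y hy
    obtain ⟨_, x1, x2, x3, x4, x5⟩ := hχ y
    have ht2 : ‖v y‖^2 ≤ M^2 := pow_le_pow_left₀ (norm_nonneg _) hm4 2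
    have hUM : ‖u y‖^2 ≤ M^2 := k2.trans (max_le hm2 ht2)
    have hpv := Pd_nonneg ε μ v y
    have hgv0 := gradSq_nonneg v y
    have hgu0 := gradSq_nonneg u y
    refine ⟨by nlinarith [norm_nonneg (u y)], ?_⟩
    have hK1 : 0 ≤ 3 * M^2 * (L^2/(2*m0^2)) := by positivity
    have hind1 : 0 ≤ indicator (ann x0 R r) (Pd ε μ v) y := indicator_nonneg (fun y _ => Pd_nonneg ε μ v y) y
    have hind2 : 0 ≤ indicator (ann x0 α β) (fun y => ((g y).im - c)^2) y := indicator_nonneg (fun y _ => sq_nonneg _) y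
    have hK2 : 0 ≤ 48 * M^2 * X^2/m0^2 := by positivity
    have hK3 : 0 ≤ 3 * M^2 * X^2/(β-α)^2 := by positivity
    rcases le_or_gt ‖y - x0‖ α with hc1 | hc1
    · obtain ⟨z1, z2⟩ := x3 hc1
      rw [z1, z2, norm_zero] at k7
      have h1 := ann_alg1 (M := M) (L := L) (m0 := m0) (k3 z1) hm2 (by positivity) k7
      have h2 : Pd ε μ u y = (1/2) * gradSq u y := by
        unfold Pd; rw [k3 z1]; ring
      rw [h2]
      have h3 := mul_nonneg hK2 hind1
      have h4 := mul_nonneg hK3 hind2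
      nlinarith
    · rcases le_or_gt β ‖y - x0‖ with hc2 | hc2
      · obtain ⟨z1, z2⟩ := x4 hc2
        rw [z1, z2, norm_zero] at k7
        have h1 := ann_alg2 (k4 z1) k5 k7
        have h2 : Pd ε μ u y ≤ 3 * Pd ε μ v y := by
          unfold Pd; rw [k4 z1]
          have : 0 ≤ 1 / (4 * ε ^ 2) * (‖v y‖ ^ 2 - μ y) ^ 2 := by positivity
          linarith
        have hmem : y ∈ ann x0 R r := ⟨by linarith, (mem y).1 hy⟩
        rw [indicator_of_mem hmem]
        have h4 := mul_nonneg hK3 hind2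
        have h5 := mul_nonneg hK2 hpv
        linarith
      · have hmT : y ∈ ann x0 α β := ⟨hc1, hc2⟩
        have hmem : y ∈ ann x0 R r := ⟨by linarith, (mem y).1 hy⟩
        rw [indicator_of_mem hmem, indicator_of_mem hmT]
        have hUt : ‖u y‖^2 ≤ 2 * ‖v y‖^2 := k2.trans (max_le (by linarith [hT y hmT]) (by linarith))
        have h1 := ann_alg3 (M := M) (X := 2*X) (d := 2*(β-α)) hUM (by positivity) hUt k5 hm0 hm1 hgv0 x1 x2 (norm_nonneg _)
          (by positivity) (x5.trans (le_of_eq (by field_simp))) hε hεd (log_half_sq (by linarith) (hT y hmT)) k7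
        have h2 := between_sq k1 k2
        have hq : (1/(4*ε^2)) * (‖u y‖^2 - μ y)^2 ≤ (1/(4*ε^2)) * (‖v y‖^2 - μ y)^2 := by gcongr
        obtain ⟨P, hP⟩ : ∃ P, P = (1/(4*ε^2)) * (‖v y‖^2 - μ y)^2 := ⟨_, rfl⟩
        have hP0 : 0 ≤ P := by rw [hP]; positivity
        have e1 : (‖v y‖^2 - μ y)^2/ε^2 = 4 * P := by rw [hP]; field_simp
        rw [e1] at h1
        have e2 : 6 * M^2 * (2*X)^2/m0^2 * (4*P) = 2 * (48 * M^2 * X^2/m0^2 * P) := by ring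
        have e3 : 6 * M^2 * (2*X)^2/(2*(β-α))^2 * ((g y).im - c)^2 = 2 * (3 * M^2 * X^2/(β-α)^2 * ((g y).im - c)^2) := by
          field_simp
          ring
        rw [e2, e3] at h1
        have e4 : Pd ε μ v y = (1/2) * gradSq v y + P := by rw [hP]; rfl
        have e5 : Pd ε μ u y ≤ (1/2) * gradSq u y + P := by
          have : Pd ε μ u y = (1/2) * gradSq u y + (1/(4*ε^2)) * (‖u y‖^2 - μ y)^2 := rfl
          rw [this, hP]; linarith
        rw [e4]
        have h6 := mul_nonneg hK2 hgv0
        have h7 := mul_nonneg hK2 hP0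
        have e6 : (7 + 48 * M^2 * X^2/m0^2) * ((1/2) * gradSq v y + P) = (7/2) * gradSq v y + 7 * P +
          (1/2) * (48 * M^2 * X^2/m0^2 * gradSq v y) + 48 * M^2 * X^2/m0^2 * P := by ring
        rw [e6]
        linarith

end competitorsec


section annulusthm
variable {μ : E2 → ℝ} {μrad : ℝ → ℝ} {ρ : ℝ} {f : E2 → E2} {frad : ℝ → ℝ}

lemma ann_subset_ball (x0 : E2) {α β r : ℝ} (h : β ≤ r) : ann x0 α β ⊆ Metric.ball x0 r := by
  intro y hy
  rw [Metric.mem_ball, dist_eq_norm]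
  exact hy.2.trans_le h

lemma ann_subset_ann (x0 : E2) {α β α' β' : ℝ} (h : α' ≤ α) (h' : β ≤ β') : ann x0 α β ⊆ ann x0 α' β' :=
  fun _ hy => ⟨lt_of_le_of_lt h hy.1, lt_of_lt_of_le hy.2 h'⟩

set_option maxHeartbeats 1000000 in
theorem annulus (hμ : MuHyp μ μrad ρ) (hf : FHyp f frad) {A0 M m0 q : ℝ} (hA0 : 0 ≤ A0) (hM : 1 ≤ M)
    (hμM : ∀ x, μ x ≤ M^2) (hm0 : 0 < m0) (hq1 : 1 < q) (hq2 : q ≤ 2) :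
    ∃ C : ℝ, 0 < C ∧ ∀ ε a, 0 < ε → ε ≤ 1 → 0 ≤ a → a ≤ A0 → ∀ v, IsMinimizer ε a μ f v →
      Integrable (dens ε a μ f v) → (∀ x, ‖v x‖ ≤ M) → ∀ (x0 : E2) (R : ℝ), 0 < R → ε ≤ (q-1)*R →
      Metric.ball x0 (q*R) ⊆ Metric.ball 0 ρ → (∀ y ∈ Metric.ball x0 (q*R), m0 ≤ μ y ∧ v y ≠ 0) →
      (∀ y ∈ ann x0 (R + (q-1)*R/4) (R + 3*((q-1)*R)/4), μ y / 2 ≤ ‖v y‖^2) →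
      ∫ y in Metric.ball x0 (q*R), Pd ε μ v y ≤ C * ((∫ y in ann x0 R (q*R), Pd ε μ v y) + R^2/ε) := by
  obtain ⟨X, hX0, hX⟩ := cutoff_exists
  obtain ⟨L, hL0, hL⟩ := hμ.grad_bdd ρ
  obtain ⟨Cf, hCf⟩ := hf.bdd
  have hCf0 : 0 ≤ Cf := (norm_nonneg _).trans (hCf 0)
  have hM0 : 0 < M := by linarith
  have hv1 := vol1_pos
  obtain ⟨K1, hK1⟩ : ∃ K, K = 3 * M^2 * (L^2/(2*m0^2)) := ⟨_, rfl⟩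
  obtain ⟨K2, hK2⟩ : ∃ K, K = 7 + 48 * M^2 * X^2/m0^2 := ⟨_, rfl⟩
  have hK1p : 0 ≤ K1 := by rw [hK1]; positivity
  have hK2p : 0 < K2 := by rw [hK2]; positivity
  obtain ⟨C1, hC1⟩ : ∃ C, C = (K1 + 2 * A0 * Cf * M) * (4 * vol1) := ⟨_, rfl⟩
  obtain ⟨C2, hC2⟩ : ∃ C, C = K2 + 3 * M^2 * X^2 * 12800/(m0*(q-1)^2) := ⟨_, rfl⟩
  have hq0 : 0 < q - 1 := by linarith
  have hC1p : 0 ≤ C1 := by rw [hC1]; positivity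
  have hC2p : 0 < C2 := by rw [hC2]; positivity
  refine ⟨C1 + C2, by linarith, ?_⟩
  intro ε a hε hε1 ha haA v hv hvd hvM x0 R hR hεd hsub hB hT
  obtain ⟨d, hd⟩ : ∃ d, d = (q-1)*R := ⟨_, rfl⟩
  obtain ⟨r, hr⟩ : ∃ r, r = q*R := ⟨_, rfl⟩
  obtain ⟨α, hα⟩ : ∃ α, α = R + d/4 := ⟨_, rfl⟩
  obtain ⟨β, hβ⟩ : ∃ β, β = R + 3*d/4 := ⟨_, rfl⟩
  rw [← hd, ← hα, ← hβ] at hT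
  rw [← hr] at hB hsub ⊢
  rw [← hd] at hεd
  have hdp : 0 < d := by rw [hd]; positivity
  have hrd : r = R + d := by rw [hr, hd]; ring
  have hdR : d ≤ R := by rw [hd]; nlinarith
  have hba : β - α = d/2 := by rw [hα, hβ]; ring
  have hr0 : 0 < r := by linarith
  have hvdiff : Differentiable ℝ v := hv.1.1
  obtain ⟨g, hg⟩ := lift_exists hvdiff x0 hr0 (fun x hx => (hB x hx).2)
  obtain ⟨B, hBdef⟩ : ∃ B, B = Metric.ball x0 r := ⟨_, rfl⟩
  obtain ⟨A, hAdef⟩ : ∃ A, A = ann x0 R r := ⟨_, rfl⟩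
  obtain ⟨T, hTdef⟩ : ∃ T, T = ann x0 α β := ⟨_, rfl⟩
  have hTB : T ⊆ B := by rw [hTdef, hBdef]; exact ann_subset_ball x0 (by linarith)
  have hAB : A ⊆ B := by rw [hAdef, hBdef]; exact ann_subset_ball x0 le_rfl
  have hTA : T ⊆ A := by rw [hTdef, hAdef]; exact ann_subset_ann x0 (by linarith) (by linarith)
  have hBm : MeasurableSet B := by rw [hBdef]; exact measurableSet_ball
  have hAm : MeasurableSet A := by rw [hAdef]; exact (isOpen_ann _ _ _).measurableSet
  have hTm : MeasurableSet T := by rw [hTdef]; exact (isOpen_ann _ _ _).measurableSet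
  have hPB : IntegrableOn (Pd ε μ v) B := integrableOn_Pd hμ hv.1 (by rw [hBdef]; exact Metric.isBounded_ball)
  have hPA : IntegrableOn (Pd ε μ v) A := hPB.mono_set hAB
  have hPT : IntegrableOn (Pd ε μ v) T := hPB.mono_set hTB
  -- the phase
  have hφd : ∀ y ∈ T, HasFDerivAt (fun y => (g y).im) (Complex.imCLM.comp (fderiv ℝ g y)) y := by
    intro y hy
    have := (hg y (by rw [← hBdef]; exact hTB hy)).2.hasFDerivAt
    exact Complex.imCLM.hasFDerivAt.comp y this
  have hφb : ∀ y ∈ T, ‖fderiv ℝ (fun y => (g y).im) y‖^2 ≤ (4/m0) * Pd ε μ v y := by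
    intro y hy
    have hyB : y ∈ Metric.ball x0 r := by rw [← hBdef]; exact hTB hy
    rw [(hφd y hy).fderiv]
    refine (opnorm_sq_le _).trans ?_
    have hgg := (gradSq_exp (u := v) (hg y hyB).2.hasFDerivAt (by
        filter_upwards [Metric.isOpen_ball.mem_nhds hyB] with z hz
        rw [(hg z hz).1]; simp)).2
    have h1 : ∑ i : Fin 2, ‖(Complex.imCLM.comp (fderiv ℝ g y)) (e2basis i)‖^2 ≤ ∑ i : Fin 2, ‖fderiv ℝ g y (e2basis i)‖^2 := by
      refine Finset.sum_le_sum fun i _ => ?_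
      apply pow_le_pow_left₀ (norm_nonneg _)
      exact Complex.abs_im_le_norm _
    refine h1.trans ?_
    have h2 : m0/2 ≤ ‖v y‖^2 := by
      have := hT y (by rw [← hTdef]; exact hy)
      have := (hB y hyB).1
      linarith
    obtain ⟨S, hS⟩ : ∃ S, S = ∑ i : Fin 2, ‖fderiv ℝ g y (e2basis i)‖^2 := ⟨_, rfl⟩
    have hS0 : 0 ≤ S := by rw [hS]; positivity
    rw [← hS] at hgg ⊢
    have h3 : m0/2 * S ≤ gradSq v y := by rw [hgg]; gcongr
    have h4 : (1/2) * gradSq v y ≤ Pd ε μ v y := by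
      unfold Pd
      have : 0 ≤ (1/(4*ε^2)) * (‖v y‖^2 - μ y)^2 := by positivity
      linarith
    rw [div_mul_eq_mul_div, le_div_iff₀ hm0]
    linarith
  have hφi : IntegrableOn (fun y => ‖fderiv ℝ (fun y => (g y).im) y‖^2) T := by
    have h0 : IntegrableOn (fun y => (4/m0) * Pd ε μ v y) T := hPT.const_mul _
    refine Integrable.mono' h0 ((measurable_fderiv ℝ _).norm.pow_const 2).aestronglyMeasurable ?_
    filter_upwards [ae_restrict_mem hTm] with y hy
    rw [Real.norm_of_nonneg (by positivity)]
    exact hφb y hy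
  have hpo := poincare x0 (α := α) (β := β) (φ := fun y => (g y).im) (by linarith) (by linarith) (by linarith)
    (by rw [← hTdef]; exact fun y hy => (hφd y hy).differentiableAt) (by rw [← hTdef]; exact hφi)
  rw [← hTdef] at hpo
  obtain ⟨c, hci, hcb⟩ := hpo
  have hcb2 : ∫ y in T, ((g y).im - c)^2 ≤ 200 * (2*R)^2 * ((4/m0) * ∫ y in A, Pd ε μ v y) := by
    have h1 : ∫ y in T, ‖fderiv ℝ (fun y => (g y).im) y‖^2 ≤ ∫ y in T, (4/m0) * Pd ε μ v y :=
      setIntegral_mono_on hφi (hPT.const_mul _) hTm hφb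
    rw [integral_const_mul] at h1
    have h2 : ∫ y in T, Pd ε μ v y ≤ ∫ y in A, Pd ε μ v y :=
      setIntegral_mono_set hPA (Eventually.of_forall fun y => Pd_nonneg _ _ _ _) (HasSubset.Subset.eventuallyLE hTA)
    have h0 : 0 ≤ ∫ y in A, Pd ε μ v y := integral_nonneg fun y => Pd_nonneg _ _ _ _
    have h3 : (4/m0) * ∫ y in T, Pd ε μ v y ≤ (4/m0) * ∫ y in A, Pd ε μ v y := by gcongr
    refine hcb.trans ?_
    have hb0 : 0 ≤ β := by linarith
    have hb2 : β ≤ 2*R := by linarith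
    calc 200 * β^2 * ∫ y in T, ‖fderiv ℝ (fun y => (g y).im) y‖^2 ≤ 200 * β^2 * ((4/m0) * ∫ y in A, Pd ε μ v y) := by
          apply mul_le_mul_of_nonneg_left (h1.trans h3) (by positivity)
      _ ≤ _ := by gcongr
  -- competitor
  obtain ⟨u, hud, huo, hui⟩ := competitor (c := c) (L := L) (M := M) (m0 := m0) (R := R) (α := α) (β := β) (r := r) (ε := ε) hX0 hX
    (hμ.smooth.differentiable (by simp)) hvdiff hR (by linarith) (by linarith) (by linarith) hε (by linarith) hm0 hM0.le hg
    (fun y hy => ⟨(hB y hy).1, hμM y, hL y (by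
      have := hsub hy
      rw [Metric.mem_ball, dist_zero_right] at this
      exact this.le), hvM y⟩) hT
  rw [← hBdef] at huo hui
  rw [← hAdef, ← hTdef, ← hK1, ← hK2] at hui
  obtain ⟨K3, hK3⟩ : ∃ K, K = 3 * M^2 * X^2/(β-α)^2 := ⟨_, rfl⟩
  have hK3p : 0 ≤ K3 := by rw [hK3]; positivity
  rw [← hK3] at hui
  have i1 : ∀ k : ℝ, Integrable (indicator B (fun _ => k)) := fun k => by
    rw [integrable_indicator_iff hBm]
    exact integrableOn_const (by rw [hBdef]; exact measure_ball_lt_top.ne)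
  have i2 : Integrable (fun y => K2 * indicator A (Pd ε μ v) y) := ((integrable_indicator_iff hAm).2 hPA).const_mul K2
  have i3 : Integrable (fun y => K3 * indicator T (fun y => ((g y).im - c)^2) y) := ((integrable_indicator_iff hTm).2 hci).const_mul K3
  have i4 : Integrable (indicator B (Pd ε μ v)) := (integrable_indicator_iff hBm).2 hPB
  have i23 : Integrable (fun y => K2 * indicator A (Pd ε μ v) y + K3 * indicator T (fun y => ((g y).im - c)^2) y) := i2.add i3
  have huM : ∀ y, ‖u y‖ ≤ M := by
    intro y
    by_cases hy : y ∈ B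
    · exact (hui y hy).1
    · rw [(huo y hy).1]; exact hvM y
  have hind1 : ∀ y, 0 ≤ K2 * indicator A (Pd ε μ v) y := fun y => mul_nonneg hK2p.le (indicator_nonneg (fun y _ => Pd_nonneg ε μ v y) y)
  have hind2 : ∀ y, 0 ≤ K3 * indicator T (fun y => ((g y).im - c)^2) y := fun y => mul_nonneg hK3p (indicator_nonneg (fun y _ => sq_nonneg _) y)
  have huH : MemH1 u := by
    have j1 : Integrable (fun y => ‖v y‖^2 + indicator B (fun _ => M^2) y) := hv.1.integrable_sq.add (i1 _)
    have j2 : Integrable (fun y => gradSq v y + 2 * (indicator B (fun _ => K1) y + (K2 * indicator A (Pd ε μ v) y + K3 * indicator T (fun y => ((g y).im - c)^2) y))) :=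
      hv.1.integrable_gradSq.add (((i1 K1).add i23).const_mul 2)
    refine memH1_of_bound hud j1 j2 ?_ ?_
    · intro y
      by_cases hy : y ∈ B
      · rw [indicator_of_mem hy]
        have := pow_le_pow_left₀ (norm_nonneg _) (huM y) 2
        have : 0 ≤ ‖v y‖^2 := by positivity
        linarith
      · rw [indicator_of_notMem hy, (huo y hy).1]; linarith
    · intro y
      have h1 := hind1 y
      have h2 := hind2 y
      by_cases hy : y ∈ B
      · rw [indicator_of_mem hy]
        have h3 := (hui y hy).2
        have h4 : (1/2) * gradSq u y ≤ Pd ε μ u y := by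
          unfold Pd
          have : 0 ≤ (1/(4*ε^2)) * (‖u y‖^2 - μ y)^2 := by positivity
          linarith
        have := gradSq_nonneg v y
        linarith
      · rw [indicator_of_notMem hy, (huo y hy).2]; linarith
  have huD : Integrable (dens ε a μ f u) := integrable_dens hμ hf ε a huH (integrable_four_of_bdd huH huM)
  have hmin := hv.2 u huH
  rw [energy_eq, energy_eq] at hmin
  obtain ⟨K4, hK4⟩ : ∃ K, K = K1 + 2 * A0 * Cf * M/ε := ⟨_, rfl⟩
  have i14 : Integrable (fun y => indicator B (fun _ => K4) y + (K2 * indicator A (Pd ε μ v) y + K3 * indicator T (fun y => ((g y).im - c)^2) y)) := (i1 K4).add i23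
  have hpt : ∀ y, dens ε a μ f u y - dens ε a μ f v y ≤ (indicator B (fun _ => K4) y + (K2 * indicator A (Pd ε μ v) y + K3 * indicator T (fun y => ((g y).im - c)^2) y)) - indicator B (Pd ε μ v) y := by
    intro y
    by_cases hy : y ∈ B
    · rw [indicator_of_mem hy, indicator_of_mem hy, dens_id2 ε a hε, dens_id2 ε a hε]
      have h3 := (hui y hy).2
      have h5 : |(inner ℝ (f y) (v y) : ℝ) - inner ℝ (f y) (u y)| ≤ 2 * Cf * M := by
        rw [← inner_sub_right]
        refine (abs_real_inner_le_norm _ _).trans ?_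
        have : ‖v y - u y‖ ≤ 2 * M := (norm_sub_le _ _).trans (by linarith [hvM y, huM y])
        calc _ ≤ Cf * (2*M) := mul_le_mul (hCf y) this (norm_nonneg _) hCf0
          _ = _ := by ring
      have h6 : (a/ε) * ((inner ℝ (f y) (v y) : ℝ) - inner ℝ (f y) (u y)) ≤ 2 * A0 * Cf * M/ε := by
        calc _ ≤ (a/ε) * (2 * Cf * M) := by
              apply mul_le_mul_of_nonneg_left (le_of_abs_le h5) (by positivity)
          _ ≤ (A0/ε) * (2 * Cf * M) := by gcongr
          _ = _ := by ring
      rw [hK4]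
      rw [mul_sub] at h6
      linarith
    · rw [indicator_of_notMem hy, indicator_of_notMem hy]
      have e : dens ε a μ f u y = dens ε a μ f v y := by
        unfold dens; rw [(huo y hy).1, (huo y hy).2]
      rw [e]
      have h1 := hind1 y
      have h2 := hind2 y
      linarith
  have hI := integral_mono (huD.sub hvd) (i14.sub i4) hpt
  have e1 : ∫ y, (dens ε a μ f u - dens ε a μ f v) y = (∫ y, dens ε a μ f u y) - ∫ y, dens ε a μ f v y := integral_sub huD hvd
  have e2 : ∫ y, ((fun y => indicator B (fun _ => K4) y + (K2 * indicator A (Pd ε μ v) y + K3 * indicator T (fun y => ((g y).im - c)^2) y)) - indicator B (Pd ε μ v)) y =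
      (∫ y, (indicator B (fun _ => K4) y + (K2 * indicator A (Pd ε μ v) y + K3 * indicator T (fun y => ((g y).im - c)^2) y))) - ∫ y, indicator B (Pd ε μ v) y := integral_sub i14 i4
  have e3 : (∫ y, (indicator B (fun _ => K4) y + (K2 * indicator A (Pd ε μ v) y + K3 * indicator T (fun y => ((g y).im - c)^2) y))) =
      (∫ y, indicator B (fun _ => K4) y) + ∫ y, (K2 * indicator A (Pd ε μ v) y + K3 * indicator T (fun y => ((g y).im - c)^2) y) := integral_add (i1 K4) i23
  have e4 : ∫ y, (K2 * indicator A (Pd ε μ v) y + K3 * indicator T (fun y => ((g y).im - c)^2) y) =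
      (∫ y, K2 * indicator A (Pd ε μ v) y) + ∫ y, K3 * indicator T (fun y => ((g y).im - c)^2) y := integral_add i2 i3
  rw [e1, e2, e3, e4, integral_const_mul, integral_const_mul, integral_indicator hAm, integral_indicator hTm, integral_indicator hBm, integral_indicator hBm,
    setIntegral_const] at hI
  have hvolB : volume.real B = r^2 * vol1 := by rw [hBdef]; exact vol_ball x0 hr0.le
  rw [hvolB, smul_eq_mul] at hI
  obtain ⟨FA, hFA⟩ : ∃ F, F = ∫ y in A, Pd ε μ v y := ⟨_, rfl⟩
  have hFA0 : 0 ≤ FA := by rw [hFA]; exact integral_nonneg fun y => Pd_nonneg _ _ _ _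
  rw [← hBdef, ← hAdef, ← hFA]
  rw [← hFA] at hI hcb2
  have b1 : r^2 * vol1 * K4 ≤ C1 * (R^2/ε) := by
    have hr2 : r^2 ≤ 4 * R^2 := by
      have : r ≤ 2 * R := by linarith
      nlinarith
    have hK4' : K4 ≤ (K1 + 2 * A0 * Cf * M)/ε := by
      rw [hK4, add_div]
      have : K1 ≤ K1/ε := by rw [le_div_iff₀ hε]; nlinarith
      linarith
    have hK4p : 0 ≤ K4 := by rw [hK4]; positivity
    calc r^2 * vol1 * K4 ≤ (4*R^2) * vol1 * ((K1 + 2 * A0 * Cf * M)/ε) := by gcongr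
      _ = _ := by rw [hC1]; ring
  have b2 : K2 * FA + K3 * ∫ y in T, ((g y).im - c)^2 ≤ C2 * FA := by
    have h1 := mul_le_mul_of_nonneg_left hcb2 hK3p
    have h2 : K3 * (200 * (2*R)^2 * ((4/m0) * FA)) = 3 * M^2 * X^2 * 12800/(m0*(q-1)^2) * FA := by
      rw [hK3, hba, hd]
      have := hq0.ne'
      field_simp
      ring
    rw [hC2, add_mul]
    linarith
  have b3 : 0 ≤ R^2/ε := by positivity
  have b4 := mul_nonneg hC1p hFA0
  have b5 := mul_nonneg hC2p.le b3
  have e5 : (C1 + C2) * (FA + R^2/ε) = C1 * FA + C1 * (R^2/ε) + C2 * FA + C2 * (R^2/ε) := by ring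
  rw [e5]
  linarith

end annulusthm

section pigeonthm

variable {μ : E2 → ℝ} {μrad : ℝ → ℝ} {ρ : ℝ} {f : E2 → E2} {frad : ℝ → ℝ}

lemma pigeon {F : E2 → ℝ} (hF : ∀ y, 0 ≤ F y) (x0 : E2) (s : ℕ → ℝ) (hs : Monotone s) (a J : ℕ) (hJ : 0 < J)
    {D : Set E2} (hFD : IntegrableOn F D) (hD : Metric.ball x0 (s (a+J)) ⊆ D) :
    ∃ j, a ≤ j ∧ j < a + J ∧ (J:ℝ) * ∫ y in ann x0 (s j) (s (j+1)), F y ≤ ∫ y in D, F y := by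
  have hsub : ∀ i ∈ Finset.Ico a (a+J), ann x0 (s i) (s (i+1)) ⊆ D := by
    intro i hi
    rw [Finset.mem_Ico] at hi
    exact (ann_subset_ball x0 (hs (by omega))).trans hD
  have hdis : Set.Pairwise (↑(Finset.Ico a (a+J)) : Set ℕ) (Function.onFun Disjoint fun i => ann x0 (s i) (s (i+1))) := by
    intro i _ j _ hij
    rw [Function.onFun, Set.disjoint_left]
    intro y hy hy'
    have h1 : s i < ‖y - x0‖ := hy.1
    have h2 : ‖y - x0‖ < s (i+1) := hy.2
    have h3 : s j < ‖y - x0‖ := hy'.1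
    have h4 : ‖y - x0‖ < s (j+1) := hy'.2
    rcases lt_or_gt_of_ne hij with h | h
    · have := hs (show i+1 ≤ j from h)
      linarith
    · have := hs (show j+1 ≤ i from h)
      linarith
  have hU := integral_biUnion_finset (μ := (volume : Measure E2)) (f := F) (Finset.Ico a (a+J))
    (s := fun i => ann x0 (s i) (s (i+1)))
    (fun i _ => (isOpen_ann _ _ _).measurableSet) hdis (fun i hi => hFD.mono_set (hsub i hi))
  have hle : ∑ i ∈ Finset.Ico a (a+J), ∫ y in ann x0 (s i) (s (i+1)), F y ≤ ∫ y in D, F y := by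
    rw [← hU]
    exact setIntegral_mono_set hFD (Eventually.of_forall fun y => hF y)
      (HasSubset.Subset.eventuallyLE (Set.iUnion₂_subset hsub))
  by_contra hcon
  push Not at hcon
  have hJ' : (0:ℝ) < J := by exact_mod_cast hJ
  have hlt : ∑ i ∈ Finset.Ico a (a+J), (∫ y in D, F y)/J < ∑ i ∈ Finset.Ico a (a+J), ∫ y in ann x0 (s i) (s (i+1)), F y := by
    refine Finset.sum_lt_sum_of_nonempty (by simp [hJ]) ?_
    intro i hi
    rw [Finset.mem_Ico] at hi
    rw [div_lt_iff₀' hJ']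
    exact hcon i hi.1 hi.2
  rw [Finset.sum_const, Nat.card_Ico, nsmul_eq_mul] at hlt
  have : a + J - a = J := by omega
  rw [this, mul_div_cancel₀ _ hJ'.ne'] at hlt
  linarith

theorem smallann (hμ : MuHyp μ μrad ρ) (hf : FHyp f frad) {A0 M m0 : ℝ} (hA0 : 0 ≤ A0) (hM : 1 ≤ M)
    (hμM : ∀ x, μ x ≤ M^2) (hm0 : 0 < m0) :
    ∃ κ0 : ℝ, 0 < κ0 ∧ ∀ q : ℝ, 1 < q → q ≤ 2 →
    ∃ C : ℝ, 0 < C ∧ ∀ ε a, 0 < ε → ε ≤ 1 → 0 ≤ a → a ≤ A0 → ∀ v, IsMinimizer ε a μ f v →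
      Integrable (dens ε a μ f v) → (∀ x, ‖v x‖ ≤ M) → ∀ (x0 : E2) (R : ℝ), 0 < R → 4*ε ≤ (q-1)*R →
      Metric.ball x0 (q*R) ⊆ Metric.ball 0 ρ → (∀ y ∈ Metric.ball x0 (q*R), m0 ≤ μ y ∧ v y ≠ 0) →
      (∫ y in ann x0 R (q*R), Pd ε μ v y) < κ0 →
      ∫ y in Metric.ball x0 (q*R), Pd ε μ v y ≤ C*((∫ y in ann x0 R (q*R), Pd ε μ v y) + R^2/ε) := by
  obtain ⟨l, κ0, hl, hl1, hκ0, hdet⟩ := detect hμ hf A0 M hA0 hM (η := m0/2) (by positivity)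
  refine ⟨κ0, hκ0, fun q hq1 hq2 => ?_⟩
  obtain ⟨C, hC, hann⟩ := annulus hμ hf hA0 hM hμM hm0 hq1 hq2
  refine ⟨C, hC, ?_⟩
  intro ε a hε hε1 ha haA v hv hvi hvM x0 R hR h4 hball hnz hsmall
  refine hann ε a hε hε1 ha haA v hv hvi hvM x0 R hR (by linarith) hball hnz ?_
  intro y hy
  by_contra hcon
  push Not at hcon
  have hy1 : R + (q-1)*R/4 < ‖y - x0‖ := hy.1
  have hy2 : ‖y - x0‖ < R + 3*((q-1)*R)/4 := hy.2
  have hyb : y ∈ Metric.ball x0 (q*R) := by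
    rw [Metric.mem_ball, dist_eq_norm]
    nlinarith
  have hyρ : ‖y‖ ≤ ρ := by
    have := hball hyb
    rw [mem_ball_zero_iff] at this
    exact this.le
  have hμy := (hnz y hyb).1
  refine absurd hsmall (not_lt.mpr ?_)
  refine hdet ε a hε hε1 ha haA v hv hvM y hyρ ?_ _ (isOpen_ann _ _ _).measurableSet
    (Metric.isBounded_ball.subset (ann_subset_ball x0 le_rfl)) ?_
  · rw [abs_of_neg (by linarith)]
    linarith
  · intro z hz
    rw [Metric.mem_ball, dist_eq_norm] at hz
    have hz' : ‖z - y‖ < ε := by nlinarith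
    have e1 : ‖y - x0‖ ≤ ‖z - y‖ + ‖z - x0‖ := by
      have := norm_sub_le (z - x0) (z - y)
      have e : (z - x0) - (z - y) = y - x0 := by abel
      rw [e] at this
      linarith
    have e2 : ‖z - x0‖ ≤ ‖z - y‖ + ‖y - x0‖ := by
      have := norm_add_le (z - y) (y - x0)
      rwa [sub_add_sub_cancel] at this
    constructor
    · show R < ‖z - x0‖
      linarith
    · show ‖z - x0‖ < q * R
      linarith

end pigeonthm

section corethm

variable {μ : E2 → ℝ} {μrad : ℝ → ℝ} {ρ : ℝ} {f : E2 → E2} {frad : ℝ → ℝ}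

set_option maxHeartbeats 1000000 in
theorem core (hμ : MuHyp μ μrad ρ) (hf : FHyp f frad) {A0 m0 r0 η : ℝ} (hA0 : 0 ≤ A0) (hm0 : 0 < m0)
    (hr0 : 0 < r0) (hη : 0 < η) :
    ∃ σ0 : ℝ, 0 < σ0 ∧ ∀ σ a, 0 < σ → σ ≤ σ0 → 0 ≤ a → a ≤ A0 → ∀ v, IsMinimizer (σ^3) a μ f v →
      ∀ x0 : E2, Metric.ball x0 r0 ⊆ Metric.ball 0 ρ →
      (∀ y ∈ Metric.ball x0 r0, m0 ≤ μ y ∧ v y ≠ 0) → |‖v x0‖^2 - μ x0| < η := by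
  obtain ⟨CE, σE, hCE, hσE, hσE1, hEB⟩ := energy_bound hμ hf A0
  obtain ⟨M1, hM1, hsup⟩ := sup_bound hμ hf A0
  obtain ⟨Cμ, hCμ⟩ := hμ.bdd
  obtain ⟨M, hMdef⟩ : ∃ t, t = max M1 Cμ := ⟨_, rfl⟩
  have hM1M : M1 ≤ M := by rw [hMdef]; exact le_max_left _ _
  have hCM : Cμ ≤ M := by rw [hMdef]; exact le_max_right _ _
  have hM : 1 ≤ M := hM1.trans hM1M
  have hμM : ∀ x, μ x ≤ M^2 := by
    intro x
    have := (le_abs_self _).trans (hCμ x)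
    nlinarith
  obtain ⟨κ0, hκ0, hsa⟩ := smallann hμ hf hA0 hM hμM hm0
  obtain ⟨l, κ, hl, hl1, hκ, hdet⟩ := detect hμ hf A0 M hA0 hM hη
  obtain ⟨δ, hδdef⟩ : ∃ t, t = min 1 (κ0/(64*CE)) := ⟨_, rfl⟩
  have hδ : 0 < δ := by rw [hδdef]; exact lt_min one_pos (by positivity)
  have hδ1 : δ ≤ 1 := by rw [hδdef]; exact min_le_left _ _
  have hδ2 : 64*CE*δ ≤ κ0 := by
    have : δ ≤ κ0/(64*CE) := by rw [hδdef]; exact min_le_right _ _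
    rwa [le_div_iff₀' (by positivity)] at this
  obtain ⟨C, hC, hann⟩ := hsa (1+δ) (by linarith) (by linarith)
  obtain ⟨S, hS⟩ : ∃ t, t = 4/δ := ⟨_, rfl⟩
  have hδS : δ * S = 4 := by rw [hS]; field_simp
  have hS4 : 4 ≤ S := by rw [hS, le_div_iff₀ hδ]; nlinarith
  obtain ⟨C3, hC3⟩ : ∃ t, t = C*(κ0+1) := ⟨_, rfl⟩
  have hC3p : 0 < C3 := by rw [hC3]; positivity
  obtain ⟨Λ0, hΛ0⟩ : ∃ t, t = 1 + 4*δ*(1 + C3/κ0 + 2*C*C3/κ) := ⟨_, rfl⟩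
  obtain ⟨σ0, hσ0⟩ : ∃ t, t = min (min σE (Real.exp (-Λ0))) (min (r0/S) (min (1/S^2) (κ/(4*C*S^2)))) := ⟨_, rfl⟩
  have hσ0p : 0 < σ0 := by
    rw [hσ0]
    refine lt_min (lt_min hσE (Real.exp_pos _)) (lt_min (by positivity) (lt_min (by positivity) (by positivity)))
  refine ⟨σ0, hσ0p, ?_⟩
  intro σ a hσ hσσ0 ha haA v hv x0 hsub hnz
  have hs1 : σ ≤ σE := hσσ0.trans (by rw [hσ0]; exact (min_le_left _ _).trans (min_le_left _ _))
  have hs2 : σ ≤ Real.exp (-Λ0) := hσσ0.trans (by rw [hσ0]; exact (min_le_left _ _).trans (min_le_right _ _))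
  have hs3 : σ ≤ r0/S := hσσ0.trans (by rw [hσ0]; exact (min_le_right _ _).trans (min_le_left _ _))
  have hs4 : σ ≤ 1/S^2 := hσσ0.trans (by
    rw [hσ0]; exact (min_le_right _ _).trans ((min_le_right _ _).trans (min_le_left _ _)))
  have hs5 : σ ≤ κ/(4*C*S^2) := hσσ0.trans (by
    rw [hσ0]; exact (min_le_right _ _).trans ((min_le_right _ _).trans (min_le_right _ _)))
  have hσ1 : σ ≤ 1 := hs1.trans hσE1
  have hs3' : S * σ ≤ r0 := by rwa [le_div_iff₀' (by positivity)] at hs3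
  have hs4' : S^2 * σ ≤ 1 := by rwa [le_div_iff₀' (by positivity)] at hs4
  have hs5' : 4*C*S^2 * σ ≤ κ := by rwa [le_div_iff₀' (by positivity)] at hs5
  obtain ⟨ε, hε⟩ : ∃ t, t = σ^3 := ⟨_, rfl⟩
  obtain ⟨hdi, hintg, hbound⟩ := hEB σ a hσ hs1 ha haA v hv
  rw [← hε] at hv hdi hintg hbound
  have hεp : 0 < ε := by rw [hε]; positivity
  have hε1 : ε ≤ 1 := by rw [hε]; exact pow_le_one₀ hσ.le hσ1
  have hvM : ∀ x, ‖v x‖ ≤ M := fun x => (hsup ε a hεp hε1 ha haA v hv hdi x).trans hM1M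
  obtain ⟨Λ, hΛ⟩ : ∃ t, t = Real.log (1/σ) := ⟨_, rfl⟩
  have hΛexp : Real.exp Λ = 1/σ := by rw [hΛ, Real.exp_log (by positivity)]
  have hΛ0le : Λ0 ≤ Λ := by
    rw [hΛ, Real.le_log_iff_exp_le (by positivity), le_div_iff₀ hσ]
    calc Real.exp Λ0 * σ ≤ Real.exp Λ0 * Real.exp (-Λ0) := by gcongr
      _ = 1 := by rw [← Real.exp_add]; simp
  rw [← hΛ] at hbound
  have hp1 : 0 < C3/κ0 := by positivity
  have hp2 : 0 < 2*C*C3/κ := by positivity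
  have hΛ1 : 1 ≤ Λ := by
    have : 0 < 4*δ*(1 + C3/κ0 + 2*C*C3/κ) := by positivity
    linarith
  obtain ⟨J, hJ⟩ : ∃ t, t = ⌊Λ/(2*δ)⌋₊ := ⟨_, rfl⟩
  have hJ1 : (J:ℝ) ≤ Λ/(2*δ) := by rw [hJ]; exact Nat.floor_le (by positivity)
  have hJ2 : Λ/(2*δ) < J + 1 := by rw [hJ]; exact Nat.lt_floor_add_one _
  have hΛ4 : 1 + C3/κ0 + 2*C*C3/κ < Λ/(4*δ) := by
    rw [lt_div_iff₀ (by positivity)]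
    nlinarith
  have hhalf : Λ/(2*δ) = Λ/(4*δ) + Λ/(4*δ) := by field_simp; ring
  have hJ3 : Λ/(4*δ) ≤ J := by linarith
  have hJr : (0:ℝ) < J := by linarith
  have hJp : 0 < J := by exact_mod_cast hJr
  have hJκ0 : C3 < κ0 * J := by
    have : C3/κ0 < J := by linarith
    rwa [div_lt_iff₀' hκ0] at this
  have hJκ : 2*C*C3 < κ * J := by
    have : 2*C*C3/κ < J := by linarith
    rwa [div_lt_iff₀' hκ] at this
  have hJΛ : Λ ≤ 4*δ*J := by rwa [div_le_iff₀' (by positivity)] at hJ3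
  have hJΛ2 : 2*δ*J ≤ Λ := by rwa [le_div_iff₀' (by positivity)] at hJ1
  -- radii
  obtain ⟨s, hsdef⟩ : ∃ t : ℕ → ℝ, t = fun j => S*(1+δ)^j*ε := ⟨_, rfl⟩
  have hsj : ∀ j, s j = S*(1+δ)^j*ε := fun j => by rw [hsdef]
  have hsmono : Monotone s := by
    refine monotone_nat_of_le_succ fun j => ?_
    rw [hsj, hsj, pow_succ]
    have : 0 ≤ S*(1+δ)^j*ε := by positivity
    nlinarith
  have hssucc : ∀ j, s (j+1) = (1+δ) * s j := fun j => by rw [hsj, hsj, pow_succ]; ring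
  have hs0 : s 0 = S*ε := by rw [hsj]; ring
  have hs0le : ∀ j, S*ε ≤ s j := fun j => by rw [← hs0]; exact hsmono (Nat.zero_le j)
  have hspos : ∀ j, 0 < s j := fun j => lt_of_lt_of_le (by positivity) (hs0le j)
  have hs2J : s (J+J) ≤ S*σ^2 := by
    have h1 : (1+δ)^(J+J) ≤ 1/σ := by
      calc (1+δ)^(J+J) ≤ (Real.exp δ)^(J+J) := by
            have := Real.add_one_le_exp δ
            gcongr
            linarith
        _ = Real.exp (2*δ*J) := by
            rw [← Real.exp_nat_mul]; congr 1; push_cast; ring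
        _ ≤ Real.exp Λ := Real.exp_le_exp.mpr hJΛ2
        _ = _ := hΛexp
    rw [hsj]
    calc S*(1+δ)^(J+J)*ε ≤ S*(1/σ)*ε := by gcongr
      _ = S*σ^2 := by rw [hε]; field_simp
  have hs2Jr : s (J+J) ≤ r0 := by
    refine hs2J.trans (le_trans ?_ hs3')
    have : σ^2 ≤ σ := by nlinarith
    gcongr
  have hsq : ∀ j, j ≤ J+J → (s j)^2/ε ≤ S^2*σ := by
    intro j hj
    rw [div_le_iff₀ hεp]
    have h1 : s j ≤ S*σ^2 := (hsmono hj).trans hs2J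
    have h2 := hspos j
    calc (s j)^2 ≤ (S*σ^2)^2 := by gcongr
      _ = S^2*σ*ε := by rw [hε]; ring
  have hsub' : ∀ j, j ≤ J+J → Metric.ball x0 (s j) ⊆ Metric.ball x0 r0 :=
    fun j hj => Metric.ball_subset_ball ((hsmono hj).trans hs2Jr)
  have hPi : ∀ r, IntegrableOn (Pd ε μ v) (Metric.ball x0 r) := fun r => integrableOn_Pd hμ hv.1 Metric.isBounded_ball
  have hstep : ∀ j, j < J+J → (∫ y in ann x0 (s j) (s (j+1)), Pd ε μ v y) < κ0 →
      ∫ y in Metric.ball x0 (s (j+1)), Pd ε μ v y ≤ C*((∫ y in ann x0 (s j) (s (j+1)), Pd ε μ v y) + S^2*σ) := by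
    intro j hj hsm
    have hb := hsub' (j+1) hj
    have h4 : 4*ε ≤ ((1+δ)-1) * s j := by
      have h1 := mul_le_mul_of_nonneg_left (hs0le j) hδ.le
      have h2 : δ*(S*ε) = 4*ε := by rw [← mul_assoc, hδS]
      linarith
    have := hann ε a hεp hε1 ha haA v hv hdi hvM x0 (s j) (hspos j) h4
    rw [← hssucc] at this
    refine (this (hb.trans hsub) (fun y hy => hnz y (hb hy)) hsm).trans ?_
    have := hsq j hj.le
    gcongr
  -- total energy
  have htot : ∫ y in Metric.ball x0 r0, Pd ε μ v y ≤ 4*CE*Λ := by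
    obtain ⟨G, hG⟩ : ∃ G : E2 → ℝ, G = fun x => (1/2)*gradSq v x + (1/(8*ε^2))*(‖v x‖^2 - max (μ x) 0)^2 := ⟨_, rfl⟩
    rw [← hG] at hintg
    have hbound' : ∫ x, G x ≤ CE*(1+Λ) := by rw [hG]; exact hbound
    have hG0 : ∀ x, 0 ≤ G x := by
      intro x
      rw [hG]
      have := gradSq_nonneg v x
      positivity
    have hle : ∫ y in Metric.ball x0 r0, Pd ε μ v y ≤ ∫ y in Metric.ball x0 r0, 2 * G y := by
      refine setIntegral_mono_on (hPi r0) (hintg.const_mul 2).integrableOn Metric.isOpen_ball.measurableSet ?_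
      intro y hy
      have h1 : max (μ y) 0 = μ y := max_eq_left (hm0.le.trans (hnz y hy).1)
      have h2 := gradSq_nonneg v y
      have h3 : Pd ε μ v y = (1/2)*gradSq v y + (1/(4*ε^2))*(‖v y‖^2 - μ y)^2 := rfl
      have h4 : 2*(1/(8*ε^2)) = 1/(4*ε^2) := by field_simp; norm_num
      rw [h3, hG]
      show _ ≤ 2 * ((1/2)*gradSq v y + (1/(8*ε^2))*(‖v y‖^2 - max (μ y) 0)^2)
      rw [h1, mul_add, ← mul_assoc 2 (1/(8*ε^2)), h4]
      linarith
    have hle2 : ∫ y in Metric.ball x0 r0, 2 * G y ≤ ∫ y, 2 * G y :=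
      setIntegral_le_integral (hintg.const_mul 2) (Eventually.of_forall fun y => mul_nonneg zero_le_two (hG0 y))
    have hle3 : ∫ y, 2 * G y = 2 * ∫ y, G y := integral_const_mul _ _
    rw [hle3] at hle2
    have : CE*(1+Λ) ≤ CE*(2*Λ) := by gcongr; linarith
    linarith
  -- first pigeonhole
  obtain ⟨j, hj1, hj2, hjF⟩ := pigeon (fun y => Pd_nonneg ε μ v y) x0 s hsmono J J hJp (hPi r0) (hsub' (J+J) le_rfl)
  have hFj : (∫ y in ann x0 (s j) (s (j+1)), Pd ε μ v y) < κ0 := by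
    have h1 : (J:ℝ) * ∫ y in ann x0 (s j) (s (j+1)), Pd ε μ v y ≤ J * (16*CE*δ) := by
      refine hjF.trans (htot.trans ?_)
      have := mul_le_mul_of_nonneg_left hJΛ (show 0 ≤ 4*CE by positivity)
      linarith
    have h2 := le_of_mul_le_mul_left h1 hJr
    have : 0 < CE*δ := by positivity
    linarith
  have hB1 : ∫ y in Metric.ball x0 (s (j+1)), Pd ε μ v y ≤ C3 := by
    refine (hstep j hj2 hFj).trans ?_
    rw [hC3]
    gcongr
  -- second pigeonhole
  obtain ⟨i, hi1, hi2, hiF⟩ := pigeon (fun y => Pd_nonneg ε μ v y) x0 s hsmono 0 J hJp (hPi (s (j+1)))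
    (Metric.ball_subset_ball (hsmono (by omega)))
  have hiF' : (J:ℝ) * ∫ y in ann x0 (s i) (s (i+1)), Pd ε μ v y ≤ C3 := hiF.trans hB1
  obtain ⟨X, hX⟩ : ∃ X, X = ∫ y in ann x0 (s i) (s (i+1)), Pd ε μ v y := ⟨_, rfl⟩
  have hst := hstep i (by omega)
  rw [← hX] at hiF' hst
  have hXκ0 : X < κ0 := by
    have h2 : J * X < J * κ0 := by
      rw [mul_comm (J:ℝ) κ0]
      exact hiF'.trans_lt hJκ0
    exact lt_of_mul_lt_mul_left h2 hJr.le
  have hCX : C*X < κ/2 := by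
    have h1 := mul_le_mul_of_nonneg_left hiF' hC.le
    have h2 : J * (C*X) < J * (κ/2) := by
      have e1 : C * (J * X) = J * (C*X) := by ring
      have e2 : J * (κ/2) = (κ * J)/2 := by ring
      rw [e1] at h1
      rw [e2]
      linarith only [h1, hJκ]
    exact lt_of_mul_lt_mul_left h2 hJr.le
  have hB2 := hst hXκ0
  have hB3 : ∫ y in Metric.ball x0 (s (i+1)), Pd ε μ v y < κ := by
    have : C*(X+S^2*σ) = C*X + (4*C*S^2*σ)/4 := by ring
    rw [this] at hB2
    linarith
  by_contra hcon
  push Not at hcon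
  refine absurd hB3 (not_lt.mpr ?_)
  have hx0 : ‖x0‖ ≤ ρ := by
    have := hsub (Metric.mem_ball_self hr0)
    rw [mem_ball_zero_iff] at this
    exact this.le
  refine hdet ε a hεp hε1 ha haA v hv hvM x0 hx0 hcon _ Metric.isOpen_ball.measurableSet Metric.isBounded_ball
    (Metric.ball_subset_ball ?_)
  refine le_trans ?_ (hs0le (i+1))
  gcongr
  linarith

end corethm

theorem statement1_aux
    (μ : E2 → ℝ) (μrad : ℝ → ℝ) (ρ : ℝ) (f : E2 → E2) (frad : ℝ → ℝ)
    (hμ : MuHyp μ μrad ρ) (hf : FHyp f frad)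
    (a : ℝ → ℝ) (ha0 : ∀ ε : ℝ, 0 < ε → 0 ≤ a ε) (haB : ∃ C : ℝ, ∀ ε : ℝ, 0 < ε → a ε ≤ C)
    (v : ℝ → E2 → E2) (hv : ∀ ε : ℝ, 0 < ε → IsMinimizer ε (a ε) μ f (v ε))
    (Ω : Set E2) (hΩo : IsOpen Ω) (hΩs : Ω ⊆ Metric.ball 0 ρ)
    (hnz : ∀ᶠ ε in 𝓝[>] (0:ℝ), ∀ x ∈ Ω, v ε x ≠ 0) :
    TendstoLocallyUniformlyOn (fun ε x => ‖v ε x‖) (fun x => √(μ x)) (𝓝[>] (0:ℝ)) Ω := by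
  obtain ⟨CA, hCA⟩ := haB
  rw [Metric.tendstoLocallyUniformlyOn_iff]
  intro e he x hx
  obtain ⟨r, hr, hrΩ⟩ := Metric.isOpen_iff.mp hΩo x hx
  obtain ⟨t, ht⟩ : ∃ t, t = r/4 := ⟨_, rfl⟩
  have htp : 0 < t := by rw [ht]; positivity
  have hcb : Metric.closedBall x (2*t) ⊆ Ω := (Metric.closedBall_subset_ball (by linarith)).trans hrΩ
  obtain ⟨z, hz, hzmin⟩ := (isCompact_closedBall x (2*t)).exists_isMinOn
    ⟨x, Metric.mem_closedBall_self (by positivity)⟩ hμ.smooth.continuous.continuousOn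
  have hm0 : 0 < μ z := hμ.pos (by
    have := hΩs (hcb hz)
    rwa [mem_ball_zero_iff] at this)
  have hmin : ∀ y ∈ Metric.closedBall x (2*t), μ z ≤ μ y := fun y hy => hzmin hy
  obtain ⟨σ0, hσ0, hcore⟩ := core hμ hf (A0 := max CA 0) (m0 := μ z) (r0 := t) (η := e * √(μ z))
    (le_max_right _ _) hm0 htp (mul_pos he (Real.sqrt_pos.mpr hm0))
  refine ⟨Metric.ball x t, mem_nhdsWithin_of_mem_nhds (Metric.ball_mem_nhds x htp), ?_⟩
  have hsmall : ∀ᶠ ε in 𝓝[>] (0:ℝ), ε < σ0^3 :=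
    mem_nhdsWithin_of_mem_nhds (Iio_mem_nhds (by positivity))
  filter_upwards [hnz, hsmall, self_mem_nhdsWithin] with ε hnzε hεσ hεp y hy
  have hεp' : 0 < ε := hεp
  obtain ⟨σ, hσ⟩ : ∃ s, s = ε^((1:ℝ)/3) := ⟨_, rfl⟩
  have hσp : 0 < σ := by rw [hσ]; positivity
  have hσ3 : σ^3 = ε := by
    rw [hσ, ← Real.rpow_natCast, ← Real.rpow_mul hεp'.le]
    norm_num
  have hσσ : σ ≤ σ0 := by
    rw [← hσ3] at hεσ
    exact (lt_of_pow_lt_pow_left₀ 3 hσ0.le hεσ).le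
  have hyt : Metric.ball y t ⊆ Metric.closedBall x (2*t) := by
    intro w hw
    rw [Metric.mem_ball] at hw hy
    rw [Metric.mem_closedBall]
    linarith [dist_triangle w y x]
  have hmv := hv ε hεp'
  rw [← hσ3] at hmv
  have hc := hcore σ (a (σ^3)) hσp hσσ (by rw [hσ3]; exact ha0 ε hεp') (by rw [hσ3]; exact (hCA ε hεp').trans (le_max_left _ _))
    (v (σ^3)) hmv y ((hyt.trans hcb).trans hΩs)
    (fun w hw => ⟨hmin w (hyt hw), by rw [hσ3]; exact hnzε w (hcb (hyt hw))⟩)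
  rw [hσ3] at hc
  have hμy : μ z ≤ μ y := hmin y (hyt (Metric.mem_ball_self htp))
  have hsq : √(μ y)^2 = μ y := Real.sq_sqrt (by linarith)
  have hsz : 0 < √(μ z) := Real.sqrt_pos.mpr hm0
  have hszy : √(μ z) ≤ √(μ y) := Real.sqrt_le_sqrt hμy
  rw [dist_comm, Real.dist_eq]
  have hfac : ‖v ε y‖^2 - μ y = (‖v ε y‖ - √(μ y)) * (‖v ε y‖ + √(μ y)) := by
    nth_rewrite 1 [← hsq]; ring
  rw [hfac, abs_mul, abs_of_nonneg (by positivity : 0 ≤ ‖v ε y‖ + √(μ y))] at hc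
  have h1 : |‖v ε y‖ - √(μ y)| * √(μ z) ≤ |‖v ε y‖ - √(μ y)| * (‖v ε y‖ + √(μ y)) := by
    have := norm_nonneg (v ε y)
    gcongr
    linarith
  exact lt_of_mul_lt_mul_right (h1.trans_lt hc) hsz.le

/-- if the global minimizers do not vanish on an open set
`Ω ⊆ D(0;ρ)` for all small `ε`, then `|v_{ε,a}| → √μ` in `C⁰_loc(Ω)` as `ε → 0`. -/
theorem statement1
    (μ : E2 → ℝ) (μrad : ℝ → ℝ) (ρ : ℝ) (f : E2 → E2) (frad : ℝ → ℝ)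
    (hμ : MuHyp μ μrad ρ) (hf : FHyp f frad)
    (a : ℝ → ℝ) (ha0 : ∀ ε : ℝ, 0 < ε → 0 ≤ a ε) (haB : ∃ C : ℝ, ∀ ε : ℝ, 0 < ε → a ε ≤ C)
    (v : ℝ → E2 → E2) (hv : ∀ ε : ℝ, 0 < ε → IsMinimizer ε (a ε) μ f (v ε))
    (Ω : Set E2) (hΩo : IsOpen Ω) (hΩs : Ω ⊆ Metric.ball (0:E2) ρ)
    (hnz : ∀ᶠ ε in 𝓝[>] (0:ℝ), ∀ x ∈ Ω, v ε x ≠ 0) :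
    TendstoLocallyUniformlyOn (fun ε x => ‖v ε x‖) (fun x => Real.sqrt (μ x))
      (𝓝[>] (0:ℝ)) Ω := by
  exact statement1_aux μ μrad ρ f frad hμ hf a ha0 haB v hv Ω hΩo hΩs hnz
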